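/- arXiv:2503.06830 — 2 statements merged into one kernel-verified Lean document; each statement's English description precedes it below -/
import Mathlib

section
/- There exist exactly 94 isomorphism classes of q-matroids of rank 2 on a 5-dimensional vector space over F_2; that is, the set of functions r on the lattice of subspaces of F_2^5 satisfying the q-matroid axioms with r(F_2^5) = 2, considered up to the equivalence r ~ r∘ĝ for F_2-linear automorphisms g of F_2^5, has exactly 94 equivalence classes. -/
open Module Submodule

variable {K V V₁ V₂ : Type*}

section Defs

variable [Field K] [AddCommGroup V] [Module K V]

/-- A one-dimensional subspace. -/
def OneDim (x : Submodule K V) : Prop := Module.finrank K x = 1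

/-- The q-matroid rank axioms (R1), (R2), (R3) for a rank function on the
lattice of subspaces of `V`. -/
def IsQMatroid (r : Submodule K V → ℕ) : Prop :=
  (∀ X : Submodule K V, r X ≤ Module.finrank K X) ∧
  (∀ X Y : Submodule K V, X ≤ Y → r X ≤ r Y) ∧
  (∀ X Y : Submodule K V, r (X ⊔ Y) + r (X ⊓ Y) ≤ r X + r Y)

/-- The closure of `X`: the sum of all one-dimensional subspaces `x`
with `r (X + x) = r X`. -/
def qcl (r : Submodule K V → ℕ) (X : Submodule K V) : Submodule K V :=
  sSup {x : Submodule K V | OneDim x ∧ r (X ⊔ x) = r X}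

/-- `F` is a flat: adding any one-dimensional subspace not contained in `F`
increases the rank. -/
def IsFlat (r : Submodule K V → ℕ) (F : Submodule K V) : Prop :=
  ∀ x : Submodule K V, OneDim x → ¬ x ≤ F → r F < r (F ⊔ x)

/-- `(F₁, F₂)` is a modular pair. -/
def ModularPair (r : Submodule K V → ℕ) (F₁ F₂ : Submodule K V) : Prop :=
  r (F₁ ⊔ F₂) + r (F₁ ⊓ F₂) = r F₁ + r F₂

/-- A modular cut: a collection of flats satisfying (M1) and (M2). -/
def IsModularCut (r : Submodule K V → ℕ) (M : Set (Submodule K V)) : Prop :=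
  (∀ F ∈ M, IsFlat r F) ∧
  (∀ F ∈ M, ∀ F' : Submodule K V, IsFlat r F' → F ≤ F' → F' ∈ M) ∧
  (∀ F₁ ∈ M, ∀ F₂ ∈ M, ModularPair r F₁ F₂ → F₁ ⊓ F₂ ∈ M)

/-- `Δ_q(V, W)`: the set of one-dimensional subspaces of `V` not contained
in the subspace `W`. -/
def Delta (W : Submodule K V) : Set (Submodule K V) :=
  {e : Submodule K V | OneDim e ∧ ¬ e ≤ W}

/-- A modular cut selector for a q-matroid `rM` on `W` (with respect to the
ambient space `V`): every value is a modular cut, and property (QM) holds. -/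
def IsMCS (W : Submodule K V) (rM : Submodule K ↥W → ℕ)
    (μ : Delta W → Set (Submodule K ↥W)) : Prop :=
  (∀ e : Delta W, IsModularCut rM (μ e)) ∧
  (∀ e₁ e₂ : Delta W, ∀ F ∈ μ e₁,
    (Submodule.map W.subtype F ⊔ (e₁ : Submodule K V) =
      Submodule.map W.subtype F ⊔ (e₂ : Submodule K V) ↔ F ∈ μ e₂))

/-- `B` is a basis of the q-matroid with rank function `r`:
`r B = dim B = r ⊤`. -/
def IsBasisOf (r : Submodule K V → ℕ) (B : Submodule K V) : Prop :=
  r B = Module.finrank K B ∧ Module.finrank K B = r ⊤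

end Defs

namespace QMatroidCount

section Config

variable [Field K] [AddCommGroup V] [Module K V]

/-- A loop space together with a collection of rank-one flats. -/
@[ext]
structure Config (K V : Type*) [Field K] [AddCommGroup V] [Module K V] where
  loops : Submodule K V
  flats : Set (Submodule K V)

namespace Config

/-- The conditions under which `C` consists of the loop space and of those rank-one flats of a
q-matroid of rank two that are not generated by the loops and one further vector. -/
structure Valid (C : Config K V) : Prop where
  loops_le : ∀ F ∈ C.flats, C.loops ≤ F
  ne_top : ∀ F ∈ C.flats, F ≠ ⊤
  nontrivial : ∀ F ∈ C.flats, ∀ x, ¬ F ≤ C.loops ⊔ span K {x}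
  inf_le : ∀ F ∈ C.flats, ∀ F' ∈ C.flats, F ≠ F' → F ⊓ F' ≤ C.loops
  sup_ne_top : ∀ x, C.loops ⊔ span K {x} ≠ ⊤

/-- `X` lies in a rank-one flat. -/
def Small (C : Config K V) (X : Submodule K V) : Prop :=
  (∃ F ∈ C.flats, X ≤ F) ∨ ∃ x, X ≤ C.loops ⊔ span K {x}

open Classical in
/-- The rank function described by a configuration. -/
noncomputable def rk (C : Config K V) (X : Submodule K V) : ℕ :=
  if X ≤ C.loops then 0 else if C.Small X then 1 else 2

/-- The image of a configuration under a linear automorphism. -/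
def map (C : Config K V) (g : V ≃ₗ[K] V) : Config K V :=
  ⟨C.loops.map g.toLinearMap, Submodule.map g.toLinearMap '' C.flats⟩

variable {C C' : Config K V}

lemma rk_eq_zero {X : Submodule K V} : C.rk X = 0 ↔ X ≤ C.loops := by
  unfold rk; split_ifs <;> simp_all

lemma rk_le_one {X : Submodule K V} : C.rk X ≤ 1 ↔ C.Small X := by
  have h0 : X ≤ C.loops → C.Small X := fun h => .inr ⟨0, h.trans le_sup_left⟩
  unfold rk; split_ifs <;> simp_all

lemma rk_le_two (X : Submodule K V) : C.rk X ≤ 2 := by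
  unfold rk; split_ifs <;> simp

lemma Small.mono {X Y : Submodule K V} (hXY : X ≤ Y) : C.Small Y → C.Small X := by
  rintro (⟨F, hF, h⟩ | ⟨x, h⟩)
  exacts [.inl ⟨F, hF, hXY.trans h⟩, .inr ⟨x, hXY.trans h⟩]

lemma rk_mono {X Y : Submodule K V} (hXY : X ≤ Y) : C.rk X ≤ C.rk Y := by
  have h0 := rk_eq_zero (C := C) (X := X)
  have h0' := rk_eq_zero (C := C) (X := Y)
  have h1 := rk_le_one (C := C) (X := X)
  have h1' := rk_le_one (C := C) (X := Y)
  have h2 := rk_le_two (C := C) X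
  by_cases hY0 : C.rk Y = 0
  · rw [h0.2 (hXY.trans (h0'.1 hY0))]; simp
  · by_cases hY1 : C.rk Y ≤ 1
    · have := h1.2 ((h1'.1 hY1).mono hXY)
      omega
    · omega

lemma sup_span_eq {L : Submodule K V} {x u : V} (hu : u ∈ L ⊔ span K {x}) (huL : u ∉ L) :
    L ⊔ span K {x} ≤ L ⊔ span K {u} := by
  obtain ⟨l, hl, y, hy, rfl⟩ := Submodule.mem_sup.1 hu
  obtain ⟨c, rfl⟩ := Submodule.mem_span_singleton.1 hy
  have hc : c ≠ 0 := by
    rintro rfl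
    exact huL (by simpa using hl)
  refine sup_le le_sup_left ((Submodule.span_singleton_le_iff_mem _ _).2 ?_)
  have h : c⁻¹ • (l + c • x) - c⁻¹ • l = x := by
    rw [smul_add, smul_smul, inv_mul_cancel₀ hc, one_smul, add_sub_cancel_left]
  have hmem := Submodule.sub_mem _
    (Submodule.smul_mem (L ⊔ span K {l + c • x}) c⁻¹
      (Submodule.mem_sup_right (Submodule.mem_span_singleton_self _)))
    (Submodule.smul_mem _ c⁻¹ (Submodule.mem_sup_left hl))
  rwa [h] at hmem

lemma Valid.small_sup (hC : C.Valid) {X Y : Submodule K V} (hX : C.Small X) (hY : C.Small Y)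
    (h : ¬ X ⊓ Y ≤ C.loops) : C.Small (X ⊔ Y) := by
  obtain ⟨u, ⟨huX, huY⟩, hu⟩ := SetLike.not_le_iff_exists.1 h
  rcases hX with ⟨F, hF, hX⟩ | ⟨x, hX⟩ <;> rcases hY with ⟨F', hF', hY⟩ | ⟨y, hY⟩
  · have : F = F' := by
      by_contra hne
      exact hu (hC.inf_le F hF F' hF' hne ⟨hX huX, hY huY⟩)
    subst this
    exact .inl ⟨F, hF, sup_le hX hY⟩
  · refine .inl ⟨F, hF, sup_le hX ((hY.trans (sup_span_eq (hY huY) hu)).trans ?_)⟩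
    exact sup_le (hC.loops_le F hF) ((Submodule.span_singleton_le_iff_mem _ _).2 (hX huX))
  · refine .inl ⟨F', hF', sup_le ((hX.trans (sup_span_eq (hX huX) hu)).trans ?_) hY⟩
    exact sup_le (hC.loops_le F' hF') ((Submodule.span_singleton_le_iff_mem _ _).2 (hY huY))
  · exact .inr ⟨u, sup_le (hX.trans (sup_span_eq (hX huX) hu))
      (hY.trans (sup_span_eq (hY huY) hu))⟩

lemma rk_sup_of_rk_eq_zero (hC : C.Valid) {X Y : Submodule K V} (hX : C.rk X = 0) :
    C.rk (X ⊔ Y) ≤ C.rk Y := by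
  have hXL := rk_eq_zero.1 hX
  by_cases hY0 : C.rk Y = 0
  · rw [rk_eq_zero.2 (sup_le hXL (rk_eq_zero.1 hY0))]; simp
  by_cases hY1 : C.rk Y ≤ 1
  · have : C.Small (X ⊔ Y) := by
      rcases rk_le_one.1 hY1 with ⟨F, hF, h⟩ | ⟨x, h⟩
      · exact .inl ⟨F, hF, sup_le (hXL.trans (hC.loops_le F hF)) h⟩
      · exact .inr ⟨x, sup_le (hXL.trans le_sup_left) h⟩
    have := rk_le_one.2 this
    omega
  · have := rk_le_two (C := C) (X ⊔ Y)
    omega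

lemma Valid.isQMatroid [FiniteDimensional K V] (hC : C.Valid) : IsQMatroid C.rk := by
  refine ⟨fun X => ?_, fun X Y => rk_mono, fun X Y => ?_⟩
  · by_cases h0 : finrank K X = 0
    · rw [Submodule.finrank_eq_zero] at h0
      subst h0
      rw [rk_eq_zero.2 bot_le]; simp
    by_cases h1 : finrank K X ≤ 1
    · obtain ⟨v, hv⟩ := finrank_le_one_iff.1 h1
      have : C.Small X := by
        refine .inr ⟨v, fun w hw => Submodule.mem_sup_right ?_⟩
        obtain ⟨c, hc⟩ := hv ⟨w, hw⟩
        exact Submodule.mem_span_singleton.2 ⟨c, congrArg Subtype.val hc⟩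
      have := rk_le_one.2 this
      omega
    · have := rk_le_two (C := C) X
      omega
  · have hXi := rk_mono (C := C) (inf_le_left : X ⊓ Y ≤ X)
    have hYi := rk_mono (C := C) (inf_le_right : X ⊓ Y ≤ Y)
    have h2 := rk_le_two (C := C) (X ⊔ Y)
    by_cases hX0 : C.rk X = 0
    · have := rk_sup_of_rk_eq_zero hC (Y := Y) hX0
      omega
    by_cases hY0 : C.rk Y = 0
    · have := rk_sup_of_rk_eq_zero hC (Y := X) hY0
      rw [sup_comm] at this
      omega
    by_cases hX : C.rk X ≤ 1
    · by_cases hY : C.rk Y ≤ 1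
      · by_cases hi : X ⊓ Y ≤ C.loops
        · have := rk_eq_zero.2 hi
          omega
        · have := rk_le_one.2 (hC.small_sup (rk_le_one.1 hX) (rk_le_one.1 hY) hi)
          omega
      · omega
    · omega

lemma Valid.rk_top (hC : C.Valid) : C.rk ⊤ = 2 := by
  have h : ¬ C.rk ⊤ ≤ 1 := by
    rw [rk_le_one]
    rintro (⟨F, hF, h⟩ | ⟨x, h⟩)
    exacts [hC.ne_top F hF (top_le_iff.1 h), hC.sup_ne_top x (top_le_iff.1 h)]
  have := rk_le_two (C := C) ⊤
  omega

lemma Valid.mem_flats_iff (hC : C.Valid) {F : Submodule K V} :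
    F ∈ C.flats ↔ C.loops ≤ F ∧ C.rk F ≤ 1 ∧ (∀ x ∉ F, ¬ C.rk (F ⊔ span K {x}) ≤ 1) ∧
      ∀ x, ¬ F ≤ C.loops ⊔ span K {x} := by
  constructor
  · intro hF
    refine ⟨hC.loops_le F hF, rk_le_one.2 (.inl ⟨F, hF, le_rfl⟩), fun x hx h => ?_,
      hC.nontrivial F hF⟩
    rcases rk_le_one.1 h with ⟨F', hF', h⟩ | ⟨y, h⟩
    · have hne : F ≠ F' := by
        rintro rfl
        exact hx (h (Submodule.mem_sup_right (Submodule.mem_span_singleton_self x)))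
      have := hC.inf_le F hF F' hF' hne
      rw [inf_eq_left.2 (le_sup_left.trans h)] at this
      exact hC.nontrivial F hF 0 (this.trans le_sup_left)
    · exact hC.nontrivial F hF y (le_sup_left.trans h)
  · rintro ⟨-, h1, h2, h3⟩
    rcases rk_le_one.1 h1 with ⟨F', hF', h⟩ | ⟨y, h⟩
    · have : F = F' := by
        refine le_antisymm h fun x hx => ?_
        by_contra hxF
        exact h2 x hxF (rk_le_one.2 (.inl ⟨F', hF',
          sup_le h ((Submodule.span_singleton_le_iff_mem _ _).2 hx)⟩))
      rwa [this]
    · exact absurd h (h3 y)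

lemma Valid.eq_of_rk_eq (hC : C.Valid) (hC' : C'.Valid) (h : C.rk = C'.rk) : C = C' := by
  have hL : C.loops = C'.loops := by
    apply le_antisymm
    · rw [← rk_eq_zero, ← h, rk_eq_zero]
    · rw [← rk_eq_zero, h, rk_eq_zero]
  refine Config.ext hL (Set.ext fun F => ?_)
  rw [hC.mem_flats_iff, hC'.mem_flats_iff, hL, h]

lemma map_le_map {g : V ≃ₗ[K] V} {X Y : Submodule K V} :
    X.map g.toLinearMap ≤ Y.map g.toLinearMap ↔ X ≤ Y :=
  Submodule.map_le_map_iff_of_injective g.injective X Y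

lemma map_sup_span (g : V ≃ₗ[K] V) (L : Submodule K V) (x : V) :
    (L ⊔ span K {x}).map g.toLinearMap = L.map g.toLinearMap ⊔ span K {g x} := by
  simp [Submodule.map_sup, Submodule.map_span]

lemma map_top (g : V ≃ₗ[K] V) : (⊤ : Submodule K V).map g.toLinearMap = ⊤ := by
  simp

lemma rk_map (g : V ≃ₗ[K] V) (X : Submodule K V) :
    (C.map g).rk (X.map g.toLinearMap) = C.rk X := by
  have h0 : X.map g.toLinearMap ≤ (C.map g).loops ↔ X ≤ C.loops := map_le_map
  have h1 : (C.map g).Small (X.map g.toLinearMap) ↔ C.Small X := by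
    refine or_congr ?_ ?_
    · simp [map, map_le_map]
    · rw [g.surjective.exists]
      refine exists_congr fun x => ?_
      change _ ≤ C.loops.map g.toLinearMap ⊔ _ ↔ _
      rw [← map_sup_span, map_le_map]
  unfold rk
  by_cases h : X ≤ C.loops <;> by_cases h' : C.Small X <;> simp [h0, h1, h, h']

lemma Valid.map (hC : C.Valid) (g : V ≃ₗ[K] V) : (C.map g).Valid where
  loops_le := by
    rintro _ ⟨F, hF, rfl⟩
    exact map_le_map.2 (hC.loops_le F hF)
  ne_top := by
    rintro _ ⟨F, hF, rfl⟩ h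
    rw [← map_top g] at h
    exact hC.ne_top F hF (Submodule.map_injective_of_injective g.injective h)
  nontrivial := by
    rintro _ ⟨F, hF, rfl⟩ x
    obtain ⟨x, rfl⟩ := g.surjective x
    change ¬ _ ≤ C.loops.map g.toLinearMap ⊔ _
    rw [← map_sup_span, map_le_map]
    exact hC.nontrivial F hF x
  inf_le := by
    rintro _ ⟨F, hF, rfl⟩ _ ⟨F', hF', rfl⟩ hne
    rw [← Submodule.map_inf _ g.injective]
    exact map_le_map.2 (hC.inf_le F hF F' hF' fun h => hne (by rw [h]))
  sup_ne_top := by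
    intro x h
    obtain ⟨x, rfl⟩ := g.surjective x
    change C.loops.map g.toLinearMap ⊔ _ = _ at h
    rw [← map_sup_span, ← map_top g] at h
    exact hC.sup_ne_top x (Submodule.map_injective_of_injective g.injective h)

lemma map_refl : C.map (LinearEquiv.refl K V) = C := by
  ext <;> simp [map]

lemma map_map (g h : V ≃ₗ[K] V) : (C.map g).map h = C.map (g.trans h) := by
  have hc (X : Submodule K V) : (X.map g.toLinearMap).map h.toLinearMap =
      X.map (g.trans h).toLinearMap := by
    rw [← Submodule.map_comp]; rfl
  refine Config.ext (hc _) ?_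
  change (_ '' (_ '' _)) = _ '' _
  rw [Set.image_image]
  simp only [hc]

/-- Two configurations are isomorphic if a linear automorphism maps one to the other. -/
def Iso (C C' : Config K V) : Prop := ∃ g : V ≃ₗ[K] V, C.map g = C'

lemma Iso.refl (C : Config K V) : C.Iso C := ⟨.refl K V, map_refl⟩

lemma Iso.trans {C'' : Config K V} : C.Iso C' → C'.Iso C'' → C.Iso C'' := by
  rintro ⟨g, rfl⟩ ⟨h, rfl⟩
  exact ⟨g.trans h, (map_map g h).symm⟩

lemma Iso.symm : C.Iso C' → C'.Iso C := by
  rintro ⟨g, rfl⟩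
  exact ⟨g.symm, by rw [map_map, g.self_trans_symm, map_refl]⟩

lemma Valid.iso_iff (hC : C.Valid) (hC' : C'.Valid) :
    C.Iso C' ↔ ∃ g : V ≃ₗ[K] V, ∀ X, C.rk X = C'.rk (X.map g.toLinearMap) := by
  constructor
  · rintro ⟨g, rfl⟩
    exact ⟨g, fun X => (rk_map g X).symm⟩
  · rintro ⟨g, hg⟩
    refine ⟨g, (hC.map g).eq_of_rk_eq hC' (funext fun Y => ?_)⟩
    obtain ⟨X, rfl⟩ := Submodule.map_surjective_of_surjective
      (f := g.toLinearMap) g.surjective Y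
    rw [rk_map, hg]

end Config

section OfRank

variable {r : Submodule K V → ℕ}

/-- The loop space of a q-matroid. -/
def loopSpace (hr : IsQMatroid r) : Submodule K V where
  carrier := {x | r (span K {x}) = 0}
  add_mem' {x y} hx hy := by
    have h1 : span K {x + y} ≤ span K {x} ⊔ span K {y} :=
      (Submodule.span_singleton_le_iff_mem _ _).2 (Submodule.add_mem_sup
        (Submodule.mem_span_singleton_self x) (Submodule.mem_span_singleton_self y))
    have h2 := hr.2.1 _ _ h1
    have h3 := hr.2.2 (span K {x}) (span K {y})
    simp only [Set.mem_ofPred_eq] at hx hy ⊢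
    omega
  zero_mem' := by
    have := hr.1 (⊥ : Submodule K V)
    rw [finrank_bot] at this
    simpa using this
  smul_mem' c x hx := by
    have h := hr.2.1 _ _ (Submodule.span_singleton_smul_le K c x)
    simp only [Set.mem_ofPred_eq] at hx ⊢
    omega

lemma rank_eq_zero_of_le_loopSpace [FiniteDimensional K V] (hr : IsQMatroid r)
    {X : Submodule K V} (hX : X ≤ loopSpace hr) : r X = 0 := by
  have hfg : X.FG := IsNoetherian.noetherian X
  induction X, hfg using Submodule.fg_induction with
  | singleton x => exact (Submodule.span_singleton_le_iff_mem _ _).1 hX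
  | sup X Y _ _ h1 h2 =>
    have := h1 (le_sup_left.trans hX)
    have := h2 (le_sup_right.trans hX)
    have := hr.2.2 X Y
    omega

lemma one_le_rank_of_notMem (hr : IsQMatroid r) {X : Submodule K V} {x : V} (hx : x ∈ X)
    (hxL : x ∉ loopSpace hr) : 1 ≤ r X := by
  have := hr.2.1 _ _ ((Submodule.span_singleton_le_iff_mem x X).2 hx)
  have : r (span K {x}) ≠ 0 := hxL
  omega

/-- The configuration of loops and nontrivial rank-one flats of a q-matroid. -/
def configOf (hr : IsQMatroid r) : Config K V where
  loops := loopSpace hr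
  flats := {F | loopSpace hr ≤ F ∧ r F ≤ 1 ∧ (∀ x ∉ F, ¬ r (F ⊔ span K {x}) ≤ 1) ∧
    ∀ x, ¬ F ≤ loopSpace hr ⊔ span K {x}}

lemma rank_loopSpace_sup_span_le [FiniteDimensional K V] (hr : IsQMatroid r) (x : V) :
    r (loopSpace hr ⊔ span K {x}) ≤ 1 := by
  have h0 := rank_eq_zero_of_le_loopSpace hr le_rfl
  have h1 := hr.2.2 (loopSpace hr) (span K {x})
  have h2 := hr.1 (span K {x})
  have h3 := finrank_span_le_card (R := K) ({x} : Set V)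
  simp only [Set.toFinset_singleton, Finset.card_singleton] at h3
  omega

lemma rank_sup_le_one (hr : IsQMatroid r) {X Y : Submodule K V} (hX : r X ≤ 1) (hY : r Y ≤ 1)
    {u : V} (huX : u ∈ X) (huY : u ∈ Y) (hu : u ∉ loopSpace hr) : r (X ⊔ Y) ≤ 1 := by
  have h1 := hr.2.2 X Y
  have h2 := one_le_rank_of_notMem hr (Submodule.mem_inf.2 ⟨huX, huY⟩) hu
  omega

lemma valid_configOf [FiniteDimensional K V] (hr : IsQMatroid r) (h2 : r ⊤ = 2) :
    (configOf hr).Valid where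
  loops_le F hF := hF.1
  ne_top := by
    rintro F hF rfl
    have := hF.2.1
    omega
  nontrivial F hF := hF.2.2.2
  inf_le := by
    intro F hF F' hF' hne u hu
    by_contra huL
    have h := rank_sup_le_one hr hF.2.1 hF'.2.1 hu.1 hu.2 huL
    refine hne (le_antisymm (fun x hx => ?_) (fun x hx => ?_))
    · by_contra hx'
      refine hF'.2.2.1 x hx' ((hr.2.1 _ _ (sup_le le_sup_right ?_)).trans h)
      exact (Submodule.span_singleton_le_iff_mem _ _).2 (Submodule.mem_sup_left hx)
    · by_contra hx'
      refine hF.2.2.1 x hx' ((hr.2.1 _ _ (sup_le le_sup_left ?_)).trans h)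
      exact (Submodule.span_singleton_le_iff_mem _ _).2 (Submodule.mem_sup_right hx)
  sup_ne_top x h := by
    have := rank_loopSpace_sup_span_le hr x
    change loopSpace hr ⊔ _ = _ at h
    rw [h] at this
    omega

lemma rk_configOf [FiniteDimensional K V] (hr : IsQMatroid r) (h2 : r ⊤ = 2) :
    (configOf hr).rk = r := by
  funext X
  have hX2 : r X ≤ 2 := h2 ▸ hr.2.1 X ⊤ le_top
  by_cases hX0 : X ≤ loopSpace hr
  · rw [rank_eq_zero_of_le_loopSpace hr hX0]
    exact Config.rk_eq_zero.2 hX0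
  have hne : (configOf hr).rk X ≠ 0 := fun h => hX0 (Config.rk_eq_zero.1 h)
  obtain ⟨u, huX, hu⟩ := SetLike.not_le_iff_exists.1 hX0
  have hX1 := one_le_rank_of_notMem hr huX hu
  have key : (configOf hr).Small X ↔ r X ≤ 1 := by
    constructor
    · rintro (⟨F, hF, h⟩ | ⟨x, h⟩)
      exacts [(hr.2.1 _ _ h).trans hF.2.1,
        (hr.2.1 _ _ h).trans (rank_loopSpace_sup_span_le hr x)]
    · intro h
      obtain ⟨F, ⟨hXF, hF⟩, hmax⟩ := WellFounded.has_min
        (wellFounded_gt (α := Submodule K V)) {F | X ≤ F ∧ r F ≤ 1} ⟨X, le_rfl, h⟩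
      have hle : ∀ G, F ≤ G → r G ≤ 1 → G ≤ F := by
        intro G hFG hG
        by_contra hn
        exact hmax G ⟨hXF.trans hFG, hG⟩ (lt_of_le_not_ge hFG hn)
      by_cases ht : ∃ x, F ≤ loopSpace hr ⊔ span K {x}
      · obtain ⟨x, hx⟩ := ht
        exact .inr ⟨x, hXF.trans hx⟩
      · refine .inl ⟨F, ⟨?_, hF, fun x hx h' => ?_, not_exists.1 ht⟩, hXF⟩
        · refine le_sup_right.trans (hle (F ⊔ loopSpace hr) le_sup_left ?_)
          have h0 := rank_eq_zero_of_le_loopSpace hr le_rfl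
          have h1 := hr.2.2 F (loopSpace hr)
          omega
        · exact hx (hle _ le_sup_left h'
            (Submodule.mem_sup_right (Submodule.mem_span_singleton_self x)))
  have := Config.rk_le_one.trans key
  have := Config.rk_le_two (C := configOf hr) X
  omega

end OfRank

end Config

/-! ### Computations with packed data -/

noncomputable section

/-- Fold over a list, written with the recursor for fast kernel evaluation. -/
def fold {α β : Type} (f : α → β → β) (b : β) (l : List α) : β :=
  List.rec b (fun x _ ih => f x ih) l

/-- Boolean conjunction, lazy in its second argument. -/
def both (a b : Bool) : Bool := Bool.rec false b a
/-- Boolean disjunction, lazy in its second argument. -/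
def either (a b : Bool) : Bool := Bool.rec b true a

/-- Universal quantification over a list. -/
def all {α : Type} (l : List α) (p : α → Bool) : Bool := fold (fun x b => both (p x) b) true l
/-- Existential quantification over a list. -/
def any {α : Type} (l : List α) (p : α → Bool) : Bool := fold (fun x b => either (p x) b) false l
/-- The entries of a list, with default `a`. -/
def nth {α : Type} (a : α) (l : List α) : ℕ → α :=
  fold (fun x (f : ℕ → α) n => Nat.rec x (fun k _ => f k) n) (fun _ => a) l

/-- The `x`-th bit of `m`. -/
def bitOf (m x : ℕ) : Bool := Nat.beq (Nat.land 1 (Nat.shiftRight m x)) 1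

/-- The codes of all vectors. -/
def range32 : List ℕ := [0, 1, 2, 3, 4, 5, 6, 7, 8, 9, 10, 11, 12, 13, 14, 15, 16, 17, 18, 19, 20,
  21, 22, 23, 24, 25, 26, 27, 28, 29, 30, 31]

/-- The bit mask of the coset of `x` modulo the subspace generated by `gs`. -/
def cosetMask (gs : List ℕ) : ℕ → ℕ :=
  fold (fun g (F : ℕ → ℕ) x => Nat.lor (F x) (F (Nat.xor g x))) (Nat.pow 2) gs

/-- The bit mask of the subspace generated by `gs`. -/
def spanMask (gs : List ℕ) : ℕ := cosetMask gs 0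

/-- The `k`-th column of the matrix packed into the number `e`, five bits per column. -/
def col (e k : ℕ) : ℕ := Nat.land (Nat.shiftRight e k) 31

/-- The image of the encoded vector `x` under the matrix packed into `e`. -/
def applyCode (e x : ℕ) : ℕ :=
  Nat.xor (Nat.mul (Nat.land x 1) (col e 7)) <|
  Nat.xor (Nat.mul (Nat.land (Nat.shiftRight x 1) 1) (col e 12)) <|
  Nat.xor (Nat.mul (Nat.land (Nat.shiftRight x 2) 1) (col e 17)) <|
  Nat.xor (Nat.mul (Nat.land (Nat.shiftRight x 3) 1) (col e 22))
    (Nat.mul (Nat.land (Nat.shiftRight x 4) 1) (col e 27))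

/-- The bit mask of the image under `e` of the subspace generated by `gs`. -/
def imageMask (e : ℕ) (gs : List ℕ) : ℕ :=
  fold (fun g (F : ℕ → ℕ) x => Nat.lor (F x) (F (Nat.xor (applyCode e g) x))) (Nat.pow 2) gs 0

/-- Generators of the standard subspace of dimension `d ≤ 3`. -/
def stdGens (d : ℕ) : List ℕ := [1, 2, 4].take d

/-- The mask of the standard subspace of dimension `d ≤ 3`. -/
def stdMask (d : ℕ) : ℕ := spanMask (stdGens d)

/-- Representatives of the configurations: the dimension of the loop space, and the
nontrivial rank-one flats, each given by its mask and by generators. -/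
def confs : List (ℕ × List (ℕ × List ℕ)) := [
  (0, []),
  (1, []),
  (2, []),
  (3, []),
  (0, [(15, [1, 2])]),
  (0, [(255, [1, 2, 4])]),
  (0, [(65535, [1, 2, 4, 8])]),
  (1, [(255, [1, 2, 4])]),
  (1, [(65535, [1, 2, 4, 8])]),
  (2, [(65535, [1, 2, 4, 8])]),
  (0, [(15, [1, 2]), (4369, [4, 8])]),
  (0, [(15, [1, 2]), (286331153, [4, 8, 16])]),
  (1, [(255, [1, 2, 4]), (50529027, [1, 8, 16])]),
  (0, [(15, [1, 2]), (4369, [4, 8]), (9345, [7, 10])]),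
  (0, [(15, [1, 2]), (4369, [4, 8]), (1179681, [5, 17])]),
  (0, [(15, [1, 2]), (4369, [4, 8]), (306742305, [5, 10, 19])]),
  (1, [(255, [1, 2, 4]), (50529027, [1, 8, 16]), (204521475, [1, 14, 20])]),
  (0, [(15, [1, 2]), (4369, [4, 8]), (9345, [7, 10]), (18465, [5, 11])]),
  (0, [(15, [1, 2]), (4369, [4, 8]), (9345, [7, 10]), (1179681, [5, 17])]),
  (0, [(15, [1, 2]), (4369, [4, 8]), (9345, [7, 10]), (310659105, [5, 11, 18])]),
  (0, [(15, [1, 2]), (4369, [4, 8]), (1179681, [5, 17]), (17040385, [10, 18])]),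
  (0, [(15, [1, 2]), (4369, [4, 8]), (1179681, [5, 17]), (20987905, [14, 22])]),
  (0, [(15, [1, 2]), (4369, [4, 8]), (1179681, [5, 17]), (338199105, [6, 9, 19])]),
  (1, [(255, [1, 2, 4]), (50529027, [1, 8, 16]), (204521475, [1, 14, 20]), (817892355, [1, 10,
  22])]),
  (0, [(15, [1, 2]), (4369, [4, 8]), (9345, [7, 10]), (18465, [5, 11]), (33345, [6, 9])]),
  (0, [(15, [1, 2]), (4369, [4, 8]), (9345, [7, 10]), (18465, [5, 11]), (1310785, [6, 18])]),
  (0, [(15, [1, 2]), (4369, [4, 8]), (9345, [7, 10]), (18465, [5, 11]), (338199105, [6, 9, 19])]),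
  (0, [(15, [1, 2]), (4369, [4, 8]), (9345, [7, 10]), (1179681, [5, 17]), (2621505, [6, 19])]),
  (0, [(15, [1, 2]), (4369, [4, 8]), (9345, [7, 10]), (1179681, [5, 17]), (17303553, [11, 19])]),
  (0, [(15, [1, 2]), (4369, [4, 8]), (9345, [7, 10]), (1179681, [5, 17]), (25198593, [15, 23])]),
  (0, [(15, [1, 2]), (4369, [4, 8]), (9345, [7, 10]), (1179681, [5, 17]), (338199105, [6, 9,
  19])]),
  (0, [(15, [1, 2]), (4369, [4, 8]), (1179681, [5, 17]), (17040385, [10, 18]), (37781505, [15,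
  22])]),
  (0, [(15, [1, 2]), (4369, [4, 8]), (1179681, [5, 17]), (17040385, [10, 18]), (41959425, [14,
  23])]),
  (0, [(15, [1, 2]), (4369, [4, 8]), (1179681, [5, 17]), (17040385, [10, 18]), (75505665, [13,
  23])]),
  (0, [(15, [1, 2]), (4369, [4, 8]), (1179681, [5, 17]), (17040385, [10, 18]), (338199105, [6, 9,
  19])]),
  (0, [(15, [1, 2]), (4369, [4, 8]), (1179681, [5, 17]), (17040385, [10, 18]), (2147581953, [15,
  16])]),
  (0, [(15, [1, 2]), (4369, [4, 8]), (1179681, [5, 17]), (17040385, [10, 18]), (2185331265, [6,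
  9, 16])]),
  (0, [(15, [1, 2]), (4369, [4, 8]), (1179681, [5, 17]), (20987905, [14, 22]), (338199105, [6, 9,
  19])]),
  (0, [(15, [1, 2]), (4369, [4, 8]), (1179681, [5, 17]), (20987905, [14, 22]), (402653313, [7,
  27])]),
  (1, [(255, [1, 2, 4]), (50529027, [1, 8, 16]), (204521475, [1, 14, 20]), (817892355, [1, 10,
  22]), (3222024195, [1, 12, 18])]),
  (0, [(15, [1, 2]), (4369, [4, 8]), (9345, [7, 10]), (18465, [5, 11]), (1310785, [6, 18]),
  (16908801, [9, 17])]),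
  (0, [(15, [1, 2]), (4369, [4, 8]), (9345, [7, 10]), (1179681, [5, 17]), (2621505, [6, 19]),
  (20987905, [14, 22])]),
  (0, [(15, [1, 2]), (4369, [4, 8]), (9345, [7, 10]), (1179681, [5, 17]), (2621505, [6, 19]),
  (33620481, [9, 16])]),
  (0, [(15, [1, 2]), (4369, [4, 8]), (9345, [7, 10]), (1179681, [5, 17]), (2621505, [6, 19]),
  (268713985, [14, 18])]),
  (0, [(15, [1, 2]), (4369, [4, 8]), (9345, [7, 10]), (1179681, [5, 17]), (17303553, [11, 19]),
  (41959425, [14, 23])]),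
  (0, [(15, [1, 2]), (4369, [4, 8]), (9345, [7, 10]), (1179681, [5, 17]), (17303553, [11, 19]),
  (69238785, [15, 21])]),
  (0, [(15, [1, 2]), (4369, [4, 8]), (9345, [7, 10]), (1179681, [5, 17]), (17303553, [11, 19]),
  (136331265, [14, 21])]),
  (0, [(15, [1, 2]), (4369, [4, 8]), (9345, [7, 10]), (1179681, [5, 17]), (17303553, [11, 19]),
  (268713985, [14, 18])]),
  (0, [(15, [1, 2]), (4369, [4, 8]), (9345, [7, 10]), (1179681, [5, 17]), (17303553, [11, 19]),
  (335544385, [6, 26])]),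
  (0, [(15, [1, 2]), (4369, [4, 8]), (9345, [7, 10]), (1179681, [5, 17]), (17303553, [11, 19]),
  (1073823745, [14, 16])]),
  (0, [(15, [1, 2]), (4369, [4, 8]), (9345, [7, 10]), (1179681, [5, 17]), (17303553, [11, 19]),
  (1082130945, [9, 23])]),
  (0, [(15, [1, 2]), (4369, [4, 8]), (9345, [7, 10]), (1179681, [5, 17]), (17303553, [11, 19]),
  (2151678465, [9, 22])]),
  (0, [(15, [1, 2]), (4369, [4, 8]), (9345, [7, 10]), (1179681, [5, 17]), (17303553, [11, 19]),
  (2185331265, [6, 9, 16])]),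
  (0, [(15, [1, 2]), (4369, [4, 8]), (1179681, [5, 17]), (17040385, [10, 18]), (41959425, [14,
  23]), (338199105, [6, 9, 19])]),
  (0, [(15, [1, 2]), (4369, [4, 8]), (1179681, [5, 17]), (17040385, [10, 18]), (41959425, [14,
  23]), (402653313, [7, 27])]),
  (0, [(15, [1, 2]), (4369, [4, 8]), (1179681, [5, 17]), (17040385, [10, 18]), (75505665, [13,
  23]), (402653313, [7, 27])]),
  (0, [(15, [1, 2]), (4369, [4, 8]), (1179681, [5, 17]), (17040385, [10, 18]), (75505665, [13,
  23]), (2185331265, [6, 9, 16])]),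
  (0, [(15, [1, 2]), (4369, [4, 8]), (9345, [7, 10]), (18465, [5, 11]), (1310785, [6, 18]),
  (16908801, [9, 17]), (37781505, [15, 22])]),
  (0, [(15, [1, 2]), (4369, [4, 8]), (9345, [7, 10]), (18465, [5, 11]), (1310785, [6, 18]),
  (16908801, [9, 17]), (69238785, [15, 21])]),
  (0, [(15, [1, 2]), (4369, [4, 8]), (9345, [7, 10]), (18465, [5, 11]), (1310785, [6, 18]),
  (16908801, [9, 17]), (2147581953, [15, 16])]),
  (0, [(15, [1, 2]), (4369, [4, 8]), (9345, [7, 10]), (1179681, [5, 17]), (2621505, [6, 19]),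
  (20987905, [14, 22]), (33620481, [9, 16])]),
  (0, [(15, [1, 2]), (4369, [4, 8]), (9345, [7, 10]), (1179681, [5, 17]), (2621505, [6, 19]),
  (20987905, [14, 22]), (33818625, [11, 18])]),
  (0, [(15, [1, 2]), (4369, [4, 8]), (9345, [7, 10]), (1179681, [5, 17]), (2621505, [6, 19]),
  (20987905, [14, 22]), (134285313, [11, 16])]),
  (0, [(15, [1, 2]), (4369, [4, 8]), (9345, [7, 10]), (1179681, [5, 17]), (2621505, [6, 19]),
  (20987905, [14, 22]), (276826113, [11, 23])]),
  (0, [(15, [1, 2]), (4369, [4, 8]), (9345, [7, 10]), (1179681, [5, 17]), (2621505, [6, 19]),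
  (20987905, [14, 22]), (1082130945, [9, 23])]),
  (0, [(15, [1, 2]), (4369, [4, 8]), (9345, [7, 10]), (1179681, [5, 17]), (2621505, [6, 19]),
  (33620481, [9, 16]), (268713985, [14, 18])]),
  (0, [(15, [1, 2]), (4369, [4, 8]), (9345, [7, 10]), (1179681, [5, 17]), (2621505, [6, 19]),
  (268713985, [14, 18]), (541067265, [11, 22])]),
  (0, [(15, [1, 2]), (4369, [4, 8]), (9345, [7, 10]), (1179681, [5, 17]), (2621505, [6, 19]),
  (268713985, [14, 18]), (1082130945, [9, 23])]),
  (0, [(15, [1, 2]), (4369, [4, 8]), (9345, [7, 10]), (1179681, [5, 17]), (2621505, [6, 19]),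
  (268713985, [14, 18]), (2147581953, [15, 16])]),
  (0, [(15, [1, 2]), (4369, [4, 8]), (9345, [7, 10]), (1179681, [5, 17]), (17303553, [11, 19]),
  (41959425, [14, 23]), (335544385, [6, 26])]),
  (0, [(15, [1, 2]), (4369, [4, 8]), (9345, [7, 10]), (1179681, [5, 17]), (17303553, [11, 19]),
  (69238785, [15, 21]), (268713985, [14, 18])]),
  (0, [(15, [1, 2]), (4369, [4, 8]), (9345, [7, 10]), (1179681, [5, 17]), (17303553, [11, 19]),
  (69238785, [15, 21]), (671088705, [6, 27])]),
  (0, [(15, [1, 2]), (4369, [4, 8]), (9345, [7, 10]), (1179681, [5, 17]), (17303553, [11, 19]),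
  (69238785, [15, 21]), (1073823745, [14, 16])]),
  (0, [(15, [1, 2]), (4369, [4, 8]), (9345, [7, 10]), (1179681, [5, 17]), (17303553, [11, 19]),
  (69238785, [15, 21]), (1082130945, [9, 23])]),
  (0, [(15, [1, 2]), (4369, [4, 8]), (9345, [7, 10]), (1179681, [5, 17]), (17303553, [11, 19]),
  (136331265, [14, 21]), (335544385, [6, 26])]),
  (0, [(15, [1, 2]), (4369, [4, 8]), (9345, [7, 10]), (1179681, [5, 17]), (17303553, [11, 19]),
  (136331265, [14, 21]), (2185331265, [6, 9, 16])]),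
  (0, [(15, [1, 2]), (4369, [4, 8]), (9345, [7, 10]), (1179681, [5, 17]), (17303553, [11, 19]),
  (268713985, [14, 18]), (2185331265, [6, 9, 16])]),
  (0, [(15, [1, 2]), (4369, [4, 8]), (1179681, [5, 17]), (17040385, [10, 18]), (75505665, [13,
  23]), (402653313, [7, 27]), (537411585, [14, 19])]),
  (0, [(15, [1, 2]), (4369, [4, 8]), (1179681, [5, 17]), (17040385, [10, 18]), (75505665, [13,
  23]), (402653313, [7, 27]), (2185331265, [6, 9, 16])]),
  (0, [(15, [1, 2]), (4369, [4, 8]), (9345, [7, 10]), (1179681, [5, 17]), (2621505, [6, 19]),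
  (20987905, [14, 22]), (33620481, [9, 16]), (276826113, [11, 23])]),
  (0, [(15, [1, 2]), (4369, [4, 8]), (9345, [7, 10]), (1179681, [5, 17]), (2621505, [6, 19]),
  (20987905, [14, 22]), (33818625, [11, 18]), (1082130945, [9, 23])]),
  (0, [(15, [1, 2]), (4369, [4, 8]), (9345, [7, 10]), (1179681, [5, 17]), (2621505, [6, 19]),
  (20987905, [14, 22]), (134285313, [11, 16]), (537165825, [15, 18])]),
  (0, [(15, [1, 2]), (4369, [4, 8]), (9345, [7, 10]), (1179681, [5, 17]), (2621505, [6, 19]),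
  (20987905, [14, 22]), (276826113, [11, 23]), (537165825, [15, 18])]),
  (0, [(15, [1, 2]), (4369, [4, 8]), (9345, [7, 10]), (1179681, [5, 17]), (2621505, [6, 19]),
  (20987905, [14, 22]), (1082130945, [9, 23]), (2147581953, [15, 16])]),
  (0, [(15, [1, 2]), (4369, [4, 8]), (9345, [7, 10]), (1179681, [5, 17]), (2621505, [6, 19]),
  (33620481, [9, 16]), (268713985, [14, 18]), (541067265, [11, 22])]),
  (0, [(15, [1, 2]), (4369, [4, 8]), (9345, [7, 10]), (1179681, [5, 17]), (2621505, [6, 19]),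
  (268713985, [14, 18]), (541067265, [11, 22]), (1082130945, [9, 23])]),
  (0, [(15, [1, 2]), (4369, [4, 8]), (9345, [7, 10]), (1179681, [5, 17]), (17303553, [11, 19]),
  (69238785, [15, 21]), (268713985, [14, 18]), (671088705, [6, 27])]),
  (0, [(15, [1, 2]), (4369, [4, 8]), (1179681, [5, 17]), (17040385, [10, 18]), (75505665, [13,
  23]), (402653313, [7, 27]), (537411585, [14, 19]), (1075841025, [11, 21])]),
  (0, [(15, [1, 2]), (4369, [4, 8]), (1179681, [5, 17]), (17040385, [10, 18]), (75505665, [13,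
  23]), (402653313, [7, 27]), (537411585, [14, 19]), (2185331265, [6, 9, 16])]),
  (0, [(15, [1, 2]), (4369, [4, 8]), (9345, [7, 10]), (1179681, [5, 17]), (2621505, [6, 19]),
  (20987905, [14, 22]), (33620481, [9, 16]), (276826113, [11, 23]), (537165825, [15, 18])]),
  (0, [(15, [1, 2]), (4369, [4, 8]), (9345, [7, 10]), (1179681, [5, 17]), (2621505, [6, 19]),
  (20987905, [14, 22]), (33818625, [11, 18]), (1082130945, [9, 23]), (2147581953, [15, 16])]),
  (0, [(15, [1, 2]), (4369, [4, 8]), (9345, [7, 10]), (1179681, [5, 17]), (2621505, [6, 19]),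
  (20987905, [14, 22]), (134285313, [11, 16]), (537165825, [15, 18]), (1082130945, [9, 23])]),
  (0, [(15, [1, 2]), (4369, [4, 8]), (9345, [7, 10]), (1179681, [5, 17]), (2621505, [6, 19]),
  (268713985, [14, 18]), (541067265, [11, 22]), (1082130945, [9, 23]), (2147581953, [15, 16])]),
  (0, [(15, [1, 2]), (4369, [4, 8]), (1179681, [5, 17]), (17040385, [10, 18]), (75505665, [13,
  23]), (402653313, [7, 27]), (537411585, [14, 19]), (1075841025, [11, 21]), (2185331265, [6, 9,
  16])])]

/-- For each `d ≤ 3`, the masks of the proper subspaces of dimension at least `d + 2` that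
contain the standard subspace of dimension `d`. -/
def cands : List (List ℕ) := [
  [15, 51, 85, 105, 153, 165, 195, 255, 771, 1285, 1545, 2313, 2565, 3075, 3855, 4369, 4641,
  5185, 6273, 8481, 8721, 9345, 10305, 12291, 13107, 15555, 16705, 17025, 17425, 18465, 20485,
  21845, 23205, 24585, 26265, 26985, 33153, 33345, 33825, 34833, 36873, 38505, 39321, 40965,
  42405, 43605, 49155, 50115, 52275, 61455, 65535, 196611, 327685, 393225, 589833, 655365,
  786435, 983055, 1114129, 1179681, 1310785, 1572993, 2162721, 2228241, 2359425, 2621505,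
  3145731, 3342387, 3932355, 4259905, 4325505, 4456465, 4718625, 5242885, 5570645, 5898405,
  6291465, 6684825, 6881385, 8454273, 8519745, 8650785, 8912913, 9437193, 9830505, 10027161,
  10485765, 10813605, 11141205, 12582915, 12779715, 13369395, 15728655, 16711935, 16843009,
  16908801, 17040385, 17303553, 17829889, 18882561, 20987905, 25198593, 33620481, 33685761,
  33818625, 34079745, 34611201, 35655681, 37781505, 41959425, 50331651, 50529027, 51121155,
  53489667, 62963715, 67175425, 67241985, 67371265, 67633665, 68173825, 69238785, 71307265,
  75505665, 83886085, 84215045, 84544005, 89149445, 94412805, 100663305, 101058825, 101254665,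
  106991625, 110125065, 134285313, 134349825, 134480385, 134742273, 135299073, 136331265,
  138420225, 142610433, 150994953, 151389705, 151587081, 157310985, 160469001, 167772165,
  168102405, 168428805, 173056005, 178278405, 201326595, 201526275, 202113795, 204521475,
  213921795, 251658255, 252645135, 267448335, 268505089, 268574721, 268713985, 268992513,
  269484289, 270533121, 272630785, 276826113, 285212689, 286331153, 287449617, 289686545,
  294160401, 301989921, 303178017, 304157217, 306742305, 310659105, 335544385, 336871745,
  338199105, 339809345, 344074305, 402653313, 404259201, 405029505, 406987905, 411113601,
  536944641, 537006081, 537165825, 537411585, 537920001, 538968321, 541067265, 545260545,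
  553648161, 554832417, 555819297, 558385185, 562332705, 570425361, 571548177, 572657937,
  574916625, 579355665, 603979905, 605569665, 606372225, 608311425, 612443265, 671088705,
  672432705, 673726785, 675358785, 679613505, 805306371, 805515267, 806141955, 808452867,
  817892355, 855638067, 858993459, 869059635, 1006633155, 1010615235, 1019428035, 1073823745,
  1073905665, 1074008065, 1074274305, 1074791425, 1075841025, 1077936385, 1082130945, 1090519105,
  1091834945, 1093150785, 1094795585, 1099072065, 1107296385, 1108878465, 1109661825, 1111654785,
  1115767425, 1140850705, 1141982225, 1143113745, 1145311505, 1149772305, 1207959585, 1209173025,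
  1210140705, 1212686625, 1216614945, 1342177285, 1342525445, 1342873605, 1347421445, 1352665605,
  1426063445, 1431655765, 1437248085, 1509949605, 1515890085, 1520786085, 1610612745, 1611042825,
  1611227145, 1616906505, 1620051465, 1711276185, 1718000025, 1721329305, 1761607785, 1768515945,
  1771476585, 2147581953, 2147631105, 2147753985, 2148012033, 2148534273, 2149581825, 2151678465,
  2155872513, 2164260993, 2165840001, 2166629505, 2168603265, 2172748161, 2181038145, 2182359105,
  2183664705, 2185331265, 2189574465, 2214592545, 2215790625, 2216789025, 2219315745, 2223251745,
  2281701393, 2282850321, 2283947025, 2286166545, 2290618641, 2415919113, 2416336905, 2416545801,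
  2422212105, 2425358601, 2516582505, 2523502185, 2526439785, 2566914201, 2573624985, 2576980377,
  2684354565, 2684723205, 2685030405, 2689600005, 2694841605, 2768240805, 2774162085, 2779096485,
  2852126805, 2857740885, 2863289685, 3221225475, 3221471235, 3222024195, 3224374275, 3233809155,
  3271557315, 3275504835, 3284386755, 3422552115, 3425946675, 3435934515, 4026531855, 4027576335,
  4042264335, 4278190335],
  [255, 3855, 13107, 15555, 50115, 52275, 61455, 65535, 983055, 3342387, 3932355, 12779715,
  13369395, 15728655, 16711935, 50529027, 51121155, 53489667, 62963715, 201526275, 202113795,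
  204521475, 213921795, 251658255, 252645135, 267448335, 805515267, 806141955, 808452867,
  817892355, 855638067, 858993459, 869059635, 1006633155, 1010615235, 1019428035, 3221471235,
  3222024195, 3224374275, 3233809155, 3271557315, 3275504835, 3284386755, 3422552115, 3425946675,
  3435934515, 4026531855, 4027576335, 4042264335, 4278190335],
  [65535, 16711935, 252645135, 267448335, 4027576335, 4042264335, 4278190335],
  []]

/-- For each configuration and each way to add a flat to it, the index of a representative of
the new configuration and the matrix of an isomorphism from that representative. -/
def upCodes : List (List ℕ) := [
  [2181570692, 2181316740, 2181185796, 2181190020, 2181185924, 2181189892, 2181324932,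
  2181570693, 2164555908, 2164424964, 2164429188, 2164425092, 2164429060, 2164564100, 2165317765,
  2156036612, 2156040836, 2156045060, 2156049284, 2156036740, 2156040708, 2156045188, 2156049156,
  2164572292, 2156937349, 2157207685, 2156036868, 2156041092, 2156044804, 2156049028, 2164441348,
  2152743173, 2152878341, 2164445572, 2152874373, 2152747397, 2156036996, 2156040964, 2156044932,
  2156048900, 2164441476, 2152878469, 2152743301, 2164445444, 2152747269, 2152874245, 2164580484,
  2156945541, 2157199493, 2165842053, 2181570694, 1090846852, 1090715908, 1090720132, 1090716036,
  1090720004, 1090855044, 1092624517, 1082327556, 1082331780, 1082336004, 1082340228, 1082327684,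
  1082331652, 1082336132, 1082340100, 1090863236, 1084244101, 1084514437, 1082327812, 1082332036,
  1082335748, 1082339972, 1090732292, 1080049925, 1080185093, 1090736516, 1080181125, 1080054149,
  1082327940, 1082331908, 1082335876, 1082339844, 1090732420, 1080185221, 1080050053, 1090736388,
  1080054021, 1080180997, 1090871428, 1084252293, 1084506245, 1093148805, 1141383302, 545457156,
  545461380, 545465604, 545469828, 545474052, 545478276, 545482500, 545486724, 545457284,
  545461252, 545465732, 545469700, 545474180, 545478148, 545482628, 545486596, 1090879620,
  547389573, 547659909, 547930245, 548200581, 545457412, 545461636, 545465348, 545469572,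
  545474308, 545478532, 545482244, 545486468, 1090748676, 543195397, 543330565, 543736069,
  543871237, 1090752900, 543326597, 543199621, 543867269, 543740293, 545457540, 545461508,
  545465476, 545469444, 545474436, 545478404, 545482372, 545486340, 1090748804, 543330693,
  543195525, 543871365, 543736197, 1090752772, 543199493, 543326469, 543740165, 543867141,
  1090887812, 547397765, 547651717, 547938437, 548192389, 1093673093, 605036678, 622338182,
  545457668, 545461892, 545466116, 545470340, 545473540, 545477764, 545481988, 545486212,
  1082360324, 274760197, 274895365, 275030533, 275165701, 1082364548, 274891397, 274764421,
  275161733, 275034757, 1082368772, 275022597, 275157765, 274768645, 274903813, 1082372996,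
  275153797, 275026821, 274899845, 274772869, 545457796, 545461764, 545466244, 545470212,
  545473668, 545477636, 545482116, 545486084, 1082360452, 274895493, 274760325, 275165829,
  275030661, 1082364420, 274764293, 274891269, 275034629, 275161605, 1082368900, 275157893,
  275022725, 274903941, 274768773, 1082372868, 275026693, 275153669, 274772741, 274899717,
  1090896004, 547405957, 547676293, 547913861, 548184197, 1085292677, 336609414, 345260166,
  1085563013, 345006214, 336879750, 545457924, 545462148, 545465860, 545470084, 545473796,
  545478020, 545481732, 545485956, 1082360580, 275030789, 275165957, 274760453, 274895621,
  1082364804, 275161989, 275035013, 274891653, 274764677, 1082368516, 274768389, 274903557,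
  275022341, 275157509, 1082372740, 274899589, 274772613, 275153541, 275026565, 1090765060,
  543211781, 543346949, 543719685, 543854853, 1081098501, 202391814, 206717190, 1081233669,
  206590214, 202526982, 1090769284, 543342981, 543216005, 543850885, 543723909, 1081229701,
  206586246, 202523014, 1081102725, 202396038, 206721414, 545458052, 545462020, 545465988,
  545469956, 545473924, 545477892, 545481860, 545485828, 1082360708, 275166085, 275030917,
  274895749, 274760581, 1082364676, 275034885, 275161861, 274764549, 274891525, 1082368644,
  274903685, 274768517, 275157637, 275022469, 1082372612, 274772485, 274899461, 275026437,
  275153413, 1090765188, 543347077, 543211909, 543854981, 543719813, 1081233797, 202527110,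
  206590342, 1081098629, 206717318, 202391942, 1090769156, 543215877, 543342853, 543723781,
  543850757, 1081102597, 206721286, 202395910, 1081229573, 202522886, 206586118, 1090904196,
  547414149, 547668101, 547922053, 548176005, 1085300869, 345268358, 336617606, 1085554821,
  336871558, 344998022, 1094197381, 605560966, 621813894, 1174937734],
  [2181570695, 2165317767, 2156937351, 2157207687, 2156945543, 2157199495, 2165842055,
  2181570696, 1092624519, 1084244103, 1084514439, 1084252295, 1084506247, 1093148807, 1141383304,
  547389575, 547659911, 547930247, 548200583, 547397767, 547651719, 547938439, 548192391,
  1093673095, 605036680, 622338184, 547405959, 547676295, 547913863, 548184199, 1085292679,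
  336609416, 345260168, 1085563015, 345006216, 336879752, 547414151, 547668103, 547922055,
  548176007, 1085300871, 345268360, 336617608, 1085554823, 336871560, 344998024, 1094197383,
  605560968, 621813896, 1174937736],
  [2181570697, 1141383305, 605036681, 622338185, 605560969, 621813897, 1174937737],
  [],
  [2181570698, 2185896074, 2190221450, 2194546826, 2181701770, 2185765002, 2190352522,
  2194415754, 2181832842, 2186158218, 2189959306, 2194284682, 2181963914, 2186027146, 2190090378,
  2194153610, 1141383306, 1145708682, 1150034058, 1154359434, 1141514378, 1145577610, 1150165130,
  1154228362, 1141645450, 1145970826, 1149771914, 1154097290, 1141776522, 1145839754, 1149902986,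
  1153966218, 605036682, 609362058, 613687434, 618012810, 622338186, 626663562, 630988938,
  635314314, 605167754, 609230986, 613818506, 617881738, 622469258, 626532490, 631120010,
  635183242, 605298826, 609624202, 613425290, 617750666, 622600330, 626925706, 630726794,
  635052170, 605429898, 609493130, 613556362, 617619594, 622731402, 626794634, 630857866,
  634921098, 605560970, 609886346, 614211722, 618537098, 621813898, 626139274, 630464650,
  634790026, 1174937738, 2181570699, 2319982731, 2458394763, 2596806795, 1179263114, 2315919499,
  2185896075, 2592743563, 2462720139, 1183588490, 2450268299, 2588680331, 2190221451, 2328633483,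
  1187913866, 2584617099, 2454593675, 2324570251, 2194546827, 605692042, 609755274, 614342794,
  618406026, 621944970, 626008202, 630595722, 634658954, 1175068810, 2320113803, 2181701771,
  2596937867, 2458525835, 1179132042, 2185765003, 2315788427, 2462589067, 2592612491, 1183719562,
  2588811403, 2450399371, 2328764555, 2190352523, 1187782794, 2454462603, 2584486027, 2194415755,
  2324439179, 605823114, 610148490, 613949578, 618274954, 622076042, 626401418, 630202506,
  634527882, 1175199882, 2458656907, 2597068939, 2181832843, 2320244875, 1179525258, 2593005707,
  2462982283, 2316181643, 2186158219, 1183326346, 2189959307, 2328371339, 2450006155, 2588418187,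
  1187651722, 2324308107, 2194284683, 2584354955, 2454331531, 605954186, 610017418, 614080650,
  618143882, 622207114, 626270346, 630333578, 634396810, 1175330954, 2597200011, 2458787979,
  2320375947, 2181963915, 1179394186, 2462851211, 2592874635, 2186027147, 2316050571, 1183457418,
  2328502411, 2190090379, 2588549259, 2450137227, 1187520650, 2194153611, 2324177035, 2454200459,
  2584223883],
  [545457163, 545461387, 545465611, 545469835, 545474059, 545478283, 545482507, 545486731,
  545457291, 545461259, 545465739, 545469707, 545474187, 545478155, 545482635, 545486603,
  545457419, 545461643, 545465355, 545469579, 545474315, 545478539, 545482251, 545486475,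
  545457547, 545461515, 545465483, 545469451, 545474443, 545478411, 545482379, 545486347,
  545457675, 545461899, 545466123, 545470347, 545473547, 545477771, 545481995, 545486219,
  545457803, 545461771, 545466251, 545470219, 545473675, 545477643, 545482123, 545486091,
  545457931, 545462155, 545465867, 545470091, 545473803, 545478027, 545481739, 545485963,
  545458059, 545462027, 545465995, 545469963, 545473931, 545477899, 545481867, 545485835],
  [],
  [2181570700, 2458394764, 2735218828, 3012042892, 2189959308, 2450006156, 2743607436,
  3003654284, 2198347916, 2475171980, 2718441612, 2995265676, 2206736524, 2466783372, 2726830220,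
  2986877068],
  [],
  [],
  [2181570701, 2165317773, 2198347917, 2198872205, 2165842061, 2182619277, 2181570702,
  2181566734, 2181566862, 2315788430, 2315784590, 2315784462, 2450002190, 2450002318, 2450006158,
  2584220046, 2584219918, 2584223886, 2165317774, 2165313806, 2165313934, 2702712974, 2702709006,
  2702709134, 2299535502, 2299531662, 2299531534, 2836930702, 2836926862, 2836926734, 2433749262,
  2433749390, 2433753230, 2971144462, 2971144590, 2971148430, 2567967118, 2567966990, 2567970958,
  3105362318, 3105362190, 3105366158, 2165842062, 2165838094, 2165838222, 2702188686, 2702184718,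
  2702184846, 3255312526, 2181570703, 2332565647, 3255308558, 2165317775, 2434277519, 3255308686,
  2333089935, 2451054735, 2300059790, 2300055950, 2300055822, 2836406414, 2836402574, 2836402446,
  3389530254, 2198347919, 2315788431, 3389526414, 2198872207, 2585272463, 3389526286, 2299535503,
  2568495247, 2434273550, 2434273678, 2434277518, 2970620174, 2970620302, 2970624142, 3523744014,
  2165842063, 2433753231, 3523744142, 2182619279, 2601525391, 3523747982, 2450006159, 2601001103,
  2568491406, 2568491278, 2568495246, 3104838030, 3104837902, 3104841870, 3657961870, 2316837007,
  2467307663, 3657961742, 2300059791, 2567970959, 3657965710, 2466783375, 2584223887],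
  [2593792143, 2577014927, 2610045071, 2609520783, 2576490639, 2592743567, 1554653327,
  1504321679, 1570906255, 1569333391, 1503797391, 1552556175, 1018306703, 984752271, 1035083919,
  1001529487, 1050812559, 1049763983, 1051336847, 1050288271, 983703695, 1016209551, 1001005199,
  1033511055, 1018830991, 1002053775, 1035608207, 985276559, 1589256335, 1505370255, 1067589775,
  1067065487, 1068114063, 1066541199, 1605509263, 1602887823, 1000480911, 1016733839, 984227983,
  1032986767, 1504845967, 1586110607],
  [2181570704, 1141383312, 3255312528, 3288866960, 1174937744, 2248679568],
  [2181570705, 2190352529, 2181570706, 2593005714, 2315788434, 2458787986, 2324570258,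
  2450006162, 2190352530, 2584223890, 2165321874, 2446602386, 2702717202, 2849648914, 2299539602,
  2580820114, 2715431186, 2836934930, 2178166930, 2433757330, 2971152658, 3118084370, 2312384658,
  2567975058, 2983866642, 3105370386, 2165846290, 2312778002, 2702192786, 2983473298, 3255312530,
  2181570707, 3666747538, 2324570259, 2178560274, 2300064018, 2836410514, 3117691026, 3389530258,
  2315788435, 3532529810, 2190352531, 2434281746, 2581213458, 2715037842, 2970628242, 3398312082,
  2593005715, 3523747986, 2450006163, 2446995730, 2568499474, 2849255570, 3104845970, 3264094354,
  2458787987, 3657965714, 2584223891],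
  [2181570706, 2181574802, 2198347922, 2198352018, 1279930514, 1279926418, 1292509330,
  1292513426, 2181570708, 1279926420, 889897490, 2181570709, 2181574805, 877298194, 2869440661,
  2869436565, 1829380244, 2869436564, 3272610069, 3307344149, 3390574997, 3429372309, 3272610197,
  3307344277, 3390574869, 3429372181, 2198347924, 1816797332, 889881106, 2198347925, 2198352021,
  2489861141, 2181570710, 2624078869, 1829380246, 877314578, 2852663445, 2852659349, 1292509332,
  2852659348, 3038922261, 1279926422, 3173139989, 2869436566, 3793228053, 3844215061, 3943698837,
  3966243221, 2489861653, 2198347926, 3038921749, 1816797334, 3793228181, 3844215189, 3943698709,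
  3966243093, 2624079381, 1292509334, 3173139477, 2852659350],
  [2308317331, 2332565651, 2181566742, 2332561814, 2735214998, 2852655382, 2165317782,
  1310335126, 1050022294, 891031830, 1306140822, 1008079254, 3507495062, 920391958, 1331306646,
  2836406422, 4077392278, 4194832662, 932974870, 1029050774, 4178583702, 3523744022, 878448918,
  1285169302, 1070993814, 3674739094],
  [2181570711, 2743607447],
  [2181570712, 2181570713, 2315788441, 2450006169, 2584223897, 2610307225, 2849644697,
  2476089497, 2715426969, 2341871769, 3118080153, 2207654041, 2983862425, 2312773785, 3147178137,
  3255312537, 2181570714, 2178556057, 3012960409, 3389530265, 2315788442, 2581209241, 2878742681,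
  3523747993, 2450006170, 2446991513, 2744524953, 3657965721, 2584223898],
  [2593005721, 2181570715, 2852659355, 2181570716, 3813982748, 2181570717, 2827125275,
  2580820124, 2554647451, 2836934940, 3411284381, 3390579101, 3793265564, 3008237853, 3008237852,
  2165846300, 2957300635, 2156036635, 2983473308, 2165863709, 2181570718, 2852659357, 3411329564,
  2852659356, 3789177885, 2605584668, 3390612380, 2605584669, 3386524701, 3793232285, 3813937565,
  2836952349, 2852659358],
  [2324570266, 2727223454, 2324570270, 2165321886, 3641716894, 3252302110, 2983866654,
  2836410526, 3532529822, 2581213470, 4203618462, 3923390750, 4044370078],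
  [2181574812, 2165322012, 3091632923, 1279926428, 1883570971, 1231167900, 1753416859,
  2181570719, 2181570720, 882118940, 1231163808, 2181570721, 849613212, 1279930529, 2165313824,
  1753420448, 889881116, 818226465, 1309951004, 2181570722, 1220743841, 856232604, 1259439393,
  2156036640, 2156036641, 2250528924, 1279930530, 1259414812, 856244897, 889897505, 2233641244,
  2151957536, 882127138, 2181570723, 1279930531, 882127139, 2181570724],
  [3813982748, 2181574813, 3114147996, 1279930525, 3982967452, 2045649052, 1011515933,
  1404051616, 354599971, 1586807837, 2527545501, 1587421597, 2527994269, 3575783585, 3541049505,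
  948385697, 1383645724, 2719494435, 3468215325, 2181570725, 2181570726, 2621129372, 1684549923,
  1259459873, 3468380317, 1279926437, 1279926438, 3751420326, 3575824929, 3966243238, 3498492449,
  3793228198, 3541123745, 3756663206, 3498525345],
  [2181570718, 1829384350, 2181570722, 2181570725, 1829384357, 1829384354, 3272610213,
  3429372197, 1011532318, 988557602, 2852659364, 1469845797, 3038921765, 3219394981, 4025501221],
  [2181570727],
  [],
  [2181570728, 2849644712, 2580820136, 3146395816, 2328506664, 2971152680, 2165846312,
  3133813032, 2581209256, 2986877096, 2341089448, 2849255592],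
  [],
  [2181570729, 1556881577, 2181570730, 1556881578, 2097811754, 3137868074, 2097811753,
  3137868073, 2181570731, 3008237867, 1967919403, 1279926443, 2097811755, 1556881579, 2458788011,
  3137868075],
  [2165321896, 1292509355, 2299539626, 1279948457, 2181570732, 2181570733, 2198868395,
  2181570734, 2181570735, 2156036651, 2181570736, 2152121392, 2152121389, 2181570737, 2181570738,
  1289143339, 2181570739, 2428663081, 2181570740],
  [1556881577, 1946947883, 1985118761, 2580820141, 3659014573, 3800991275, 4216243251,
  2996445611, 2165846320, 1565672491, 2198918064, 3411329581, 2823210032, 3520737587, 2605584690,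
  3390612402, 2831447728, 3632694829],
  [3813982772, 2580820148, 2836934964, 3793265588, 2852659380, 2605584692],
  [2181574828, 2869436588, 1279926444, 1829384364, 1924149420, 1542594732, 3165659308,
  2645700780, 889881132, 3730777388, 1520747052, 3181318828, 1011532332, 4120872236, 1944879660,
  2627027628, 3995370028, 3999220396, 3865887276, 3860140716],
  [1279944361, 1829397673, 2181589673, 2869454889, 1855070382, 2259300526, 2933928110,
  1322918062, 903709998, 889881135, 1796238889, 2181570741, 2181570742, 877314607, 1310025134,
  2869436598, 1243115177, 2869436597, 1243130934, 3910708278, 3775982774, 1796271286],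
  [2165322029, 4061696811, 1279926445, 3781716011, 3971024043, 1542594732, 849613229, 4276856495,
  1883579702, 889881136, 2181570743, 1231163831, 2831319606, 2250528944, 1259414832, 882127159,
  3632683190, 1989871533, 2876152621, 3723783341, 2181570744],
  [1231167924, 2181570741, 849613236, 2165313845, 856232628, 2156036661, 1259414836, 2151957557],
  [2181574833, 2165322033, 1279926450, 3775982774, 882118962, 1989871533, 1834813357, 3792231222,
  889881138, 4012836781, 1309951026, 4147578797, 3170568109, 2554641206, 1586431917, 650973873,
  3707570093, 1029113773, 261309105, 2558688438],
  [2181570744, 1279930552, 818226488, 1220743864, 1259439416, 2156036664, 856244920, 889897528],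
  [3813982772, 2045649076, 1404051637, 3575783608, 2621129396, 1259459896, 3498492472,
  3541123768],
  [2198917936, 3114148018, 3982967472, 1544700978, 1404051638, 3975366834, 1520453168,
  2457176880, 2527823666, 818076976, 2573391920, 1281916342, 2823046198, 4281784752, 3941226678,
  2543019830, 4093541936, 3583827888, 4157898162, 3192660400],
  [],
  [2181570745, 2181570746, 3399135930, 2181570747],
  [2181570748, 2181570749, 2181570750, 1279926462, 2181570751, 1279926463, 2181570752,
  1279926464],
  [2181570748, 1556881597, 2181570753, 2827125308, 1753420476, 1279926465],
  [1556881600, 2181570753, 2554647484, 3008237887, 2181570754, 2181570755, 2181570756, 882693438],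
  [2836930746, 2852659394, 3642241346, 2198868418, 2156036674, 2181570757, 2836934981,
  2831435330, 3628516418, 3675263429],
  [1292509379, 2299539644, 3642241346, 2198868419, 2181570758, 2181570759, 2181570760,
  2181570761, 4107688137, 1310094655],
  [3553763513, 598435902, 2446602429, 3105370429, 2181570762, 2152121418, 4211660106, 465041470,
  452066110, 3995595581, 2181570763],
  [2874053434, 1346700092, 1757611196, 2554647486, 2181570758, 2198868422, 2165846342, 948373436,
  3272135998, 2719523774, 2181570764],
  [739389633, 1279948480, 2181570757, 1955729856, 2181570762, 4077392199, 2428782143, 2525797321,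
  3142501440, 4031038025],
  [2345803963, 3775952575, 2181570760, 3386126527, 3386524735, 2428782143, 3776459071,
  2152121416, 2605584712, 2428663103],
  [1946947903, 3775952576, 2181570761, 4211660106, 2165846342, 2525797321, 3881737161,
  2152121417, 1948157503, 2428663104],
  [3675263429, 4107688137, 452066110, 3272135998, 4031038025, 4061667785, 4111121481, 2605584712],
  [2181570763, 2181570764],
  [2933928139, 1322918091, 877314636, 1310025163],
  [1279944384, 1829397695, 2181589695, 2869454912, 814188874, 818255690, 877314630, 1310025162,
  4281784774, 2127517127, 4147578822, 2664340295],
  [1981059906, 1279926471, 651125572, 1494287555, 2563087170, 2181570765, 3476520263, 4239442503,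
  3482722509, 4006606914, 2929422275, 1883663555, 2181570766],
  [4276856524, 2181570766, 1231163854, 882127182],
  [],
  [],
  [],
  [2181570767, 1279926479],
  [2181570768, 1279926480],
  [2181570769, 3008237905],
  [2181570767, 1279926481, 2181570770, 903251537],
  [2181570768, 3008237905, 1004870225, 2181570771],
  [1556881616, 2181570772],
  [1556881619, 2181570772, 2181570773, 1279926485],
  [592397007, 2097811794, 2181570773, 1556881621],
  [1279926485, 1556881621],
  [1955729875, 1139111763, 3142501459, 1639256787],
  [739033679, 739389647, 2181570774, 2165846358, 3272136017, 2428663121],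
  [2299539663, 3642241364, 2181570774, 3024873298, 291759315, 4075897558],
  [3386126546, 3024873298, 3726054098, 2428663122],
  [2466779474, 2165846358, 291759315, 1676380625],
  [2446602448, 3105370448, 3152388950, 2456789846, 465041489, 452066129],
  [],
  [],
  [4061696853, 1562600277, 1494287573, 4128597973, 2181570775, 2831484885, 4087870677,
  2939679573, 2181570776],
  [2181570776, 3482722520],
  [2181570777],
  [2181570778],
  [2181570779],
  [2181570777],
  [2181570778],
  [1556881626],
  [2181570780],
  [2299539673, 463844186, 3272136027],
  [3091632988, 3900924764, 1753416924, 944203740, 2831484892, 2286417116, 1355150172, 2181570781],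
  [2181570781],
  [],
  [],
  [],
  [],
  []]

/-- For each configuration and each of its flats, the index of a representative of the
configuration without that flat and the matrix of an isomorphism from that representative. -/
def downCodes : List (List ℕ) := [
  [],
  [],
  [],
  [],
  [2181570688],
  [2181570688],
  [2181570688],
  [2181570689],
  [2181570689],
  [2181570690],
  [2156036612, 2181570692],
  [274760197, 2181570692],
  [547389575, 2181570695],
  [2190377482, 2190352522, 2181570698],
  [340427274, 1145708682, 2181570698],
  [2592768523, 2592743563, 2181570698],
  [2745204876, 2743607436, 2181570700],
  [2202960397, 2178556045, 2198872205, 2181570701],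
  [286331534, 1145704718, 2181570702, 2181570701],
  [2203353615, 2312380559, 2332565647, 2181570701],
  [828917262, 1231163790, 2165313806, 2181570702],
  [292046350, 1634210062, 2702709006, 2181570702],
  [488800783, 1416110223, 2165317775, 2181570702],
  [3550511248, 1988632720, 3288866960, 2181570704],
  [2173862417, 2186027153, 2194284689, 2190352529, 2181570705],
  [3537683474, 2605592722, 2181574930, 2593005714, 2181570705],
  [2438365715, 2304516243, 2333089939, 2324570259, 2181570705],
  [291668500, 1556881554, 1279926418, 2458787986, 2181570706],
  [2031174293, 3411288213, 1279926420, 2446602386, 2181570706],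
  [3697837589, 3697811861, 2181574805, 2849648914, 2181570706],
  [177934998, 3008237846, 2181570710, 2324570259, 2181570706],
  [3865870868, 2645696660, 1924145300, 1829380244, 2181570708],
  [3864822292, 2058367125, 3031441557, 2869436564, 2181570708],
  [879265301, 2058367253, 2971148437, 3429372309, 2181570708],
  [3937420822, 3131314582, 2165313814, 2181570710, 2181570708],
  [3566551701, 3591705237, 3776455061, 3793228181, 2181570708],
  [4050142742, 3647082902, 3507491094, 2852659350, 2181570708],
  [3987752470, 1684541718, 1444679958, 2181570710, 2181570709],
  [1231274901, 4222624149, 2719494421, 2624078869, 2181570709],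
  [1688240279, 2466783383, 2995265687, 2743607447, 2181570711],
  [4220954268, 4208763804, 2181574940, 2165321884, 2610307225, 2181570713],
  [1279948448, 1556881565, 3982967452, 2458787997, 3813982748, 2181570715],
  [291684892, 1096954012, 1753420443, 2299539612, 2827125275, 2181570715],
  [296133537, 1158287645, 1816797340, 4204405149, 2165846300, 2181570715],
  [3866001953, 3035635873, 2869436575, 3675263388, 2836934940, 2181570716],
  [4191503009, 379523747, 1279926433, 2446602397, 3390579101, 2181570716],
  [3982299808, 2036867232, 1231163680, 4211660060, 3008237852, 2181570716],
  [3055985569, 4234728353, 1216549536, 2198868380, 2165846300, 2181570716],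
  [3199779366, 3205243302, 1216549537, 2198868381, 2165863709, 2181570716],
  [2715075107, 2605592867, 2181574819, 2735265052, 2605584668, 2181570716],
  [3399140390, 3411288230, 1279926435, 4195918749, 2605584669, 2181570716],
  [3756869789, 2914991133, 2233645468, 2459599389, 3813937565, 2181570716],
  [177947301, 1712726181, 988164386, 2446602398, 2852659358, 2181570716],
  [3994337826, 1538404517, 3031441573, 1829384354, 2181570722, 2181570720],
  [3864822307, 1538404518, 3031441574, 2827141665, 1220743841, 2181570720],
  [2265941281, 3472467617, 3069755937, 2957357985, 1220743841, 2181570721],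
  [3937437221, 1131688229, 769269925, 2527990181, 2181570724, 2181570721],
  [3914760750, 3109822638, 2181574958, 2165321902, 3679727912, 3146395816, 2181570728],
  [4191466159, 4216644271, 3406831788, 2165321900, 3390582952, 2971152680, 2181570728],
  [2706801201, 2304516273, 2181574961, 2165321905, 2471768360, 2341089448, 2181570728],
  [291684911, 1096954029, 3920255147, 2299539629, 3789177899, 2181570730, 2181570729],
  [299193134, 3194303273, 1369845934, 2119607209, 2580820142, 1556881578, 2181570729],
  [223196590, 4098570923, 3976944043, 3809006899, 3813982767, 2097811753, 2181570729],
  [2181589686, 1158287666, 3982967469, 2697217584, 2983473329, 3008237867, 2181570729],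
  [185100982, 1504325936, 3915541168, 2688996656, 3813982770, 1556881579, 2181570729],
  [286343856, 1096954032, 1753420459, 2286207536, 877298219, 2181570731, 2181570730],
  [3390625079, 4246868397, 1816797356, 4077916589, 2852659372, 1279926443, 2181570731],
  [286331575, 1504325933, 1816797357, 2727223469, 2165846317, 1556881579, 2181570731],
  [534844087, 1701188011, 1830949291, 803090731, 924594475, 2458788011, 2181570731],
  [3954395312, 2976488368, 3051164332, 3636741680, 2836934963, 2181570736, 2181570732],
  [3379083702, 2976050742, 1757614774, 2198868402, 2156036653, 2181570735, 2181570733],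
  [1294138678, 1290825398, 1279926455, 3364259376, 3406303536, 2152121389, 2181570733],
  [379536045, 379536049, 1834944301, 2735265069, 2605584691, 2181570737, 2181570733],
  [4262919472, 4272634930, 3064634285, 2987925939, 2965521456, 2181570738, 2181570733],
  [3982299830, 4246893878, 4234692150, 4211660082, 3008237872, 2181570736, 2181570734],
  [3982299829, 3563593909, 3575779637, 4211660084, 3008237876, 2181570740, 2181570734],
  [3055985592, 4234728376, 1757614773, 2198868404, 2165846324, 2181570740, 2181570735],
  [1332134455, 2985697463, 4179112247, 3439997239, 2131628471, 1231163831, 2181570743],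
  [2265941304, 3472467640, 3069755960, 2957358008, 1220743864, 2181570744, 2181570743],
  [291684934, 1096954054, 2455787715, 2299539655, 2827125311, 2827125308, 2181570751, 2181570748],
  [296145866, 4234752832, 1346720586, 2119607232, 2580820170, 1556881601, 2181570752, 2181570749],
  [223196618, 3190635200, 1753692863, 3470191433, 3813982790, 3008237888, 1279926463, 2181570750],
  [480232903, 1158287689, 1906716872, 2332561737, 2983473352, 1967919427, 1279926463, 2181570751],
  [3755908935, 1504325957, 3752792009, 2446995781, 3755908937, 1556881602, 1279926464,
  2181570752],
  [3575793223, 4246868423, 1753420482, 4077916615, 2827125314, 2181570754, 1279926465,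
  2181570753],
  [3475276365, 4184355139, 4184355138, 2740195779, 2869957058, 1279926468, 2181570755,
  2181570754],
  [4092318538, 4055345098, 3480681799, 2198868425, 2156036681, 2198868422, 2181570759,
  2181570758],
  [2196423245, 2985697485, 1306140877, 4234682573, 867836109, 2116296909, 3482722509, 2181570765],
  [1332134478, 2985697486, 4179112270, 3439997262, 2131628494, 1231163854, 2181570766,
  2181570765],
  [291684950, 1096954070, 1753420498, 2299539670, 2827125330, 877298255, 2181570770, 1279926479,
  2181570767],
  [3755908950, 3194303315, 3721590870, 2119607251, 3688985814, 1556881620, 2181570771,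
  1279926480, 2181570768],
  [3618569942, 2531350993, 3190635217, 3417159126, 3809006934, 577718481, 1004870225, 3008237905,
  2181570769],
  [529695319, 1144922325, 1421353173, 2323390677, 2600083669, 2458788053, 1556881621, 1279926485,
  2181570773],
  [2196423256, 2985697496, 1306140888, 4234682584, 867836120, 2116296920, 3482722520, 2181570776,
  2181570775]]

/-- The `i`-th representative. -/
def conf (i : ℕ) : ℕ × List (ℕ × List ℕ) := nth (0, []) confs i

/-- The index stored in a code. -/
def index (e : ℕ) : ℕ := Nat.land e 127

/-- The matrix of `e` is invertible. -/
def invertibleCode (e : ℕ) : Bool :=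
  Nat.beq (imageMask e [1, 2, 4, 8, 16]) 4294967295

/-- The matrix of `e` preserves the standard subspace of dimension `d`. -/
def fixesStd (d e : ℕ) : Bool :=
  Nat.beq (imageMask e (stdGens d)) (stdMask d)

/-- The matrix of `e` is an isomorphism from the representative stored in `e` to a configuration
with loop space of dimension `d` and flats satisfying `p`. -/
def codeOK (d e : ℕ) (p : ℕ → Bool) : Bool :=
  both (Nat.beq (conf (index e)).1 d) <| both (invertibleCode e) <| both (fixesStd d e) <|
    all (conf (index e)).2 fun f => p (imageMask e f.2)

/-- Matches the codes in a list with those members of `Fs` that can be added to the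
configuration `i`, whose flats are `ms`. -/
def upLoop (i d l : ℕ) (ms : List (ℕ × List ℕ)) (Fs : List ℕ) : List ℕ → Bool :=
  fold (fun F (ih : List ℕ → Bool) es =>
    Bool.rec (ih es) (List.rec false (fun e es _ =>
      both (both (Nat.blt i (index e)) (Nat.blt (index e) 94)) <|
      both (codeOK d e fun x => either (Nat.beq x F) (any ms fun m => Nat.beq m.1 x)) (ih es)) es)
      (all ms fun m => Nat.beq (Nat.land F m.1) l)) (fun _ => true) Fs

/-- The list of codes for the additions of flats to the configuration `i` is correct. -/
def upCheck (i : ℕ) : Bool :=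
  upLoop i (conf i).1 (stdMask (conf i).1) (conf i).2 (nth [] cands (conf i).1)
    (nth [] upCodes i)

/-- The matrix of `e` is an isomorphism from the representative stored in `e`, which comes before
the representative `i`, to the latter without its flat `f`. -/
def downOK (i d : ℕ) (ms : List (ℕ × List ℕ)) (f : ℕ × List ℕ) (e : ℕ) : Bool :=
  both (Nat.blt (index e) i) <|
    both (codeOK d e fun x => any ms fun m => both (Nat.beq m.1 x) (Bool.not (Nat.beq x f.1))) <|
    all ms fun m => either (Nat.beq m.1 f.1) <|
      any (conf (index e)).2 fun f' => Nat.beq m.1 (imageMask e f'.2)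

/-- Matches two lists with respect to a relation. -/
def matched {α β : Type} (p : α → β → Bool) : List α → List β → Bool :=
  fold (fun f (ih : List β → Bool) es => List.rec false (fun e es _ => both (p f e) (ih es)) es)
    (fun es => List.rec true (fun _ _ _ => false) es)

/-- The list of codes for the removals of flats from the configuration `i` is correct. -/
def downCheck (i : ℕ) : Bool :=
  matched (downOK i (conf i).1 (conf i).2) (conf i).2 (nth [] downCodes i)

/-- Two vectors lie in a common flat. -/
def related (ms : List (ℕ × List ℕ)) (x y : ℕ) : Bool :=
  any ms fun m => both (bitOf m.1 x) (bitOf m.1 y)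

/-- One step of the weight recursion defining the invariant. -/
def weightStep (i : ℕ) (c : ℕ → ℕ) (x : ℕ) : ℕ :=
  Nat.mod (fold (fun y s => Nat.add s <| Nat.mul (Nat.mul (c y)
    (c (Nat.xor x y))) (Bool.rec 1 7 (related (conf i).2 x y))) 0 range32) 65521

/-- Pack 32 values, 16 bits each, into one number. -/
def pack (c : ℕ → ℕ) : ℕ := fold (fun x s => Nat.add (c x) (Nat.mul s 65536)) 0 range32

/-- Extract a value from a packed number. -/
def unpack (s x : ℕ) : ℕ := Nat.land (Nat.shiftRight s (Nat.mul 16 x)) 65535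

/-- The numerical isomorphism invariant of the `i`-th representative. -/
def invariantN (i : ℕ) : ℕ :=
  fold (fun v s => Nat.add s (Nat.mul v v)) 0 <| range32.map <|
    unpack <| pack <| weightStep i <| unpack <| pack <| weightStep i <|
    unpack <| pack <| weightStep i <| fun x => Bool.rec 3 2 (bitOf (stdMask (conf i).1) x)

/-- Every index stored in `es` is stored in `es'`. -/
def deckSub (es es' : List ℕ) : Bool :=
  all es fun a => any es' fun b => Nat.beq (index a) (index b)

/-- The representatives `i` and `j` are told apart by their decks or by their invariants. -/
def separated (i j : ℕ) : Bool :=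
  Bool.rec true (Bool.rec true
    (Bool.rec true false (Nat.beq (invariantN i) (invariantN j)))
    (deckSub (nth [] downCodes j) (nth [] downCodes i)))
    (deckSub (nth [] downCodes i) (nth [] downCodes j))

/-- The configuration `c` is valid. -/
def validCheck (c : ℕ × List (ℕ × List ℕ)) : Bool :=
  both (Nat.blt c.1 4) <| all c.2 fun f =>
    both (all f.2 fun g => Nat.blt g 32) <|
    both (Nat.beq (spanMask f.2) f.1) <|
    both (Nat.beq (Nat.land f.1 (stdMask c.1)) (stdMask c.1)) <|
    both (Bool.not (Nat.beq f.1 4294967295)) <|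
    both (all range32 fun x =>
      Bool.not (Nat.beq (Nat.land f.1 (spanMask (x :: stdGens c.1))) f.1)) <|
    all c.2 fun f' => either (Nat.beq f.1 f'.1) (Nat.beq (Nat.land f.1 f'.1) (stdMask c.1))

/-- One vector together with the standard subspace of dimension `d` does not generate
everything. -/
def topCheck (d : ℕ) : Bool :=
  all range32 fun x => Bool.not (Nat.beq (spanMask (x :: stdGens d)) 4294967295)

/-- Generators of all subspaces of the span of the first `k` basis vectors. -/
def genLists : ℕ → List (List ℕ)
  | 0 => [[]]
  | k + 1 => genLists k ++ (genLists k).flatMap fun gs =>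
    ((List.range (2 ^ k)).filter fun w => Nat.beq (Nat.mod (cosetMask gs w) (2 ^ w)) 0).map
      fun w => Nat.xor w (2 ^ k) :: gs

/-- If the subspace with mask `F` contains the standard subspace of dimension `d`, then it is
everything, or listed as a candidate, or generated by the latter and one vector. -/
def candCheck (d F : ℕ) : Bool :=
  Bool.rec true
    (either (Nat.beq F 4294967295) <|
      either (any (nth [] cands d) fun c => Nat.beq F c) <|
      any range32 fun x => Nat.beq F (spanMask (x :: stdGens d)))
    (Nat.beq (Nat.land F (stdMask d)) (stdMask d))

end

set_option maxRecDepth 100000 in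
lemma all_validCheck : all confs validCheck = true := by decide +kernel

set_option maxRecDepth 100000 in
lemma all_topCheck : all (List.range 4) topCheck = true := by decide +kernel

set_option maxRecDepth 100000 in
lemma all_candCheck :
    (all (genLists 5) fun gs => all (List.range 4) fun d => candCheck d (spanMask gs)) = true := by
  decide +kernel

set_option maxRecDepth 100000 in
lemma all_downCheck : all (List.range 94) downCheck = true := by decide +kernel

set_option maxRecDepth 100000 in
lemma all_upCheck : all (List.range 94) upCheck = true := by decide +kernel

set_option maxRecDepth 100000 in
lemma all_separated :
    (all (List.range 94) fun j => all (List.range j) fun i => separated i j) = true := by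
  decide +kernel

/-! ### Meaning of the computations -/

section Spec

variable {α β : Type}

@[simp] lemma both_eq_true {a b : Bool} : both a b = true ↔ a = true ∧ b = true := by
  cases a <;> cases b <;> simp [both]

@[simp] lemma either_eq_true {a b : Bool} : either a b = true ↔ a = true ∨ b = true := by
  cases a <;> cases b <;> simp [either]

@[simp] lemma boolNot_eq_true {a : Bool} : Bool.not a = true ↔ ¬ a = true := by
  cases a <;> simp

@[simp] lemma natBeq_eq_true {a b : ℕ} : Nat.beq a b = true ↔ a = b :=
  ⟨Nat.eq_of_beq_eq_true, fun h => h ▸ Nat.beq_refl a⟩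

@[simp] lemma natBlt_eq_true {a b : ℕ} : Nat.blt a b = true ↔ a < b := by
  rw [Nat.blt, Nat.ble_eq]; rfl

@[simp] lemma fold_nil (f : α → β → β) (b : β) : fold f b [] = b := rfl

@[simp] lemma fold_cons (f : α → β → β) (b : β) (x : α) (l : List α) :
    fold f b (x :: l) = f x (fold f b l) := rfl

@[simp] lemma all_eq_true {l : List α} {p : α → Bool} :
    all l p = true ↔ ∀ x ∈ l, p x = true := by
  induction l with
  | nil => simp [all]
  | cons x l ih =>
    unfold all at ih ⊢
    simp [ih]

@[simp] lemma any_eq_true {l : List α} {p : α → Bool} :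
    any l p = true ↔ ∃ x ∈ l, p x = true := by
  induction l with
  | nil => simp [any]
  | cons x l ih =>
    unfold any at ih ⊢
    simp [ih]

lemma nth_mem_or (a : α) (l : List α) (n : ℕ) : nth a l n ∈ l ∨ nth a l n = a := by
  induction l generalizing n with
  | nil => exact .inr rfl
  | cons x l ih =>
    cases n with
    | zero => exact .inl List.mem_cons_self
    | succ n => exact (ih n).imp (List.mem_cons_of_mem x) id

lemma matched_spec {p : α → β → Bool} {l : List α} {l' : List β} (h : matched p l l' = true) :
    (∀ x ∈ l, ∃ y ∈ l', p x y = true) ∧ ∀ y ∈ l', ∃ x ∈ l, p x y = true := by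
  induction l generalizing l' with
  | nil =>
    cases l' with
    | nil => simp
    | cons y l' => exact absurd h Bool.false_ne_true
  | cons x l ih =>
    cases l' with
    | nil => exact absurd h Bool.false_ne_true
    | cons y l' =>
      obtain ⟨h1, h2⟩ := both_eq_true.1 h
      obtain ⟨h3, h4⟩ := ih h2
      simp only [List.mem_cons, forall_eq_or_imp, exists_eq_or_imp]
      exact ⟨⟨.inl h1, fun z hz => .inr (h3 z hz)⟩, .inl h1, fun z hz => .inr (h4 z hz)⟩

lemma upLoop_spec {i d l : ℕ} {ms : List (ℕ × List ℕ)} {Fs es : List ℕ}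
    (h : upLoop i d l ms Fs es = true) {F : ℕ} (hF : F ∈ Fs)
    (hl : ∀ m ∈ ms, Nat.land F m.1 = l) :
    ∃ e, i < index e ∧ index e < 94 ∧
      codeOK d e (fun x => either (Nat.beq x F) (any ms fun m => Nat.beq m.1 x)) = true := by
  induction Fs generalizing es with
  | nil => simp at hF
  | cons F' Fs ih =>
    unfold upLoop at h ih
    rw [fold_cons] at h
    rcases List.mem_cons.1 hF with rfl | hF
    · have : all ms (fun m => Nat.beq (Nat.land F m.1) l) = true := by simpa using hl
      rw [this] at h
      cases es with
      | nil => exact absurd h Bool.false_ne_true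
      | cons e es =>
        obtain ⟨h1, h2⟩ := both_eq_true.1 h
        obtain ⟨h3, h4⟩ := both_eq_true.1 h1
        exact ⟨e, natBlt_eq_true.1 h3, natBlt_eq_true.1 h4, (both_eq_true.1 h2).1⟩
    · cases hb : all ms (fun m => Nat.beq (Nat.land F' m.1) l) with
      | false =>
        rw [hb] at h
        exact ih h hF
      | true =>
        rw [hb] at h
        cases es with
        | nil => exact absurd h Bool.false_ne_true
        | cons e es => exact ih (both_eq_true.1 (both_eq_true.1 h).2).2 hF

lemma mem_range32 {x : ℕ} : x ∈ range32 ↔ x < 32 := by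
  rw [← List.mem_range]; rfl

lemma bitOf_eq_testBit (m x : ℕ) : bitOf m x = m.testBit x := by
  rw [Bool.eq_iff_iff, bitOf, natBeq_eq_true, Nat.testBit]
  change 1 &&& (m >>> x) = 1 ↔ _
  rw [Nat.one_and_eq_mod_two]
  simp

end Spec

/-! ### Encoding of vectors and subspaces -/

section Encoding

/-- The five-dimensional space over the field with two elements. -/
abbrev Vec := Fin 5 → ZMod 2

/-- The vector whose coordinates are the binary digits of `n`. -/
def dec (n : ℕ) : Vec := fun i => if n.testBit i then 1 else 0

lemma dec_xor (a b : ℕ) : dec (a ^^^ b) = dec a + dec b := by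
  funext i
  simp only [dec, Nat.testBit_xor, Pi.add_apply]
  cases a.testBit i <;> cases b.testBit i <;> decide

lemma dec_zero : dec 0 = 0 := by
  funext i; simp [dec]

lemma dec_bijective : Function.Bijective fun x : Fin 32 => dec x := by
  have : Function.Injective fun x : Fin 32 => dec x := by
    intro x y h
    refine Fin.ext (Nat.eq_of_testBit_eq fun i => ?_)
    by_cases hi : i < 5
    · have := congrFun h ⟨i, hi⟩
      simp only [dec] at this
      revert this
      cases (x : ℕ).testBit i <;> cases (y : ℕ).testBit i <;> simp
    · have hp : 2 ^ 5 ≤ 2 ^ i := Nat.pow_le_pow_right (by norm_num) (by omega)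
      rw [Nat.testBit_lt_two_pow (by omega), Nat.testBit_lt_two_pow (by omega)]
  rw [Fintype.bijective_iff_injective_and_card]
  exact ⟨this, by simp⟩

/-- The encoding of vectors by numbers below 32. -/
noncomputable def decEquiv : Fin 32 ≃ Vec := Equiv.ofBijective _ dec_bijective

lemma exists_dec (v : Vec) : ∃ x < 32, dec x = v := by
  obtain ⟨x, rfl⟩ := dec_bijective.2 v
  exact ⟨x, x.2, rfl⟩

lemma dec_injOn {x y : ℕ} (hx : x < 32) (hy : y < 32) (h : dec x = dec y) : x = y :=
  congrArg Fin.val (dec_bijective.1 (a₁ := ⟨x, hx⟩) (a₂ := ⟨y, hy⟩) h)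

lemma xor_lt_32 {x y : ℕ} (hx : x < 32) (hy : y < 32) : x ^^^ y < 32 :=
  Nat.xor_lt_two_pow (n := 5) hx hy

/-- The subspace generated by a list of encoded vectors. -/
def S (gs : List ℕ) : Submodule (ZMod 2) Vec := span (ZMod 2) {v | ∃ g ∈ gs, dec g = v}

lemma S_cons (g : ℕ) (gs : List ℕ) : S (g :: gs) = span (ZMod 2) {dec g} ⊔ S gs := by
  rw [S, S, ← Submodule.span_union]
  congr 1
  ext v
  simp [eq_comm]

lemma S_nil : S [] = ⊥ := by simp [S]

lemma mem_sup_span_iff {W : Submodule (ZMod 2) Vec} {g v : Vec} :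
    v ∈ span (ZMod 2) {g} ⊔ W ↔ v ∈ W ∨ v + g ∈ W := by
  have h2 : g + g = 0 := by
    funext i; exact CharTwo.add_self_eq_zero _
  rw [Submodule.mem_sup]
  constructor
  · rintro ⟨y, hy, w, hw, rfl⟩
    obtain ⟨c, rfl⟩ := Submodule.mem_span_singleton.1 hy
    have hc : c = 0 ∨ c = 1 := by clear hy; revert c; decide
    rcases hc with rfl | rfl
    · left; simpa
    · right
      rwa [one_smul, add_right_comm, h2, zero_add]
  · rintro (h | h)
    · exact ⟨0, Submodule.zero_mem _, v, h, zero_add v⟩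
    · exact ⟨g, Submodule.mem_span_singleton_self g, v + g, h, by
        rw [add_comm, add_assoc, h2, add_zero]⟩

lemma cosetMask_cons (g : ℕ) (gs : List ℕ) (x : ℕ) :
    cosetMask (g :: gs) x = cosetMask gs x ||| cosetMask gs (g ^^^ x) := rfl

lemma cosetMask_lt {gs : List ℕ} (hgs : ∀ g ∈ gs, g < 32) {x : ℕ} (hx : x < 32) :
    cosetMask gs x < 2 ^ 32 := by
  induction gs generalizing x with
  | nil => exact Nat.pow_lt_pow_right (by norm_num) hx
  | cons g gs ih =>
    rw [cosetMask_cons]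
    have h1 := hgs g List.mem_cons_self
    have h2 : ∀ g ∈ gs, g < 32 := fun g' h => hgs g' (List.mem_cons_of_mem g h)
    exact Nat.or_lt_two_pow (ih h2 hx) (ih h2 (xor_lt_32 h1 hx))

lemma testBit_cosetMask {gs : List ℕ} (hgs : ∀ g ∈ gs, g < 32) {x y : ℕ} (hx : x < 32)
    (hy : y < 32) : (cosetMask gs x).testBit y = true ↔ dec (x ^^^ y) ∈ S gs := by
  induction gs generalizing x with
  | nil =>
    change (2 ^ x).testBit y = true ↔ _
    rw [Nat.testBit_two_pow, S_nil, Submodule.mem_bot, decide_eq_true_iff]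
    constructor
    · rintro rfl
      rw [Nat.xor_self, dec_zero]
    · intro h
      rw [← dec_zero] at h
      exact Nat.xor_eq_zero_iff.1 (dec_injOn (xor_lt_32 hx hy) (by norm_num) h)
  | cons g gs ih =>
    have h1 := hgs g List.mem_cons_self
    have h2 : ∀ g ∈ gs, g < 32 := fun g' h => hgs g' (List.mem_cons_of_mem g h)
    rw [cosetMask_cons, Nat.testBit_or, Bool.or_eq_true, ih h2 hx, ih h2 (xor_lt_32 h1 hx),
      S_cons, mem_sup_span_iff, ← dec_xor, Nat.xor_assoc, Nat.xor_comm g]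

open Classical in
/-- The bit mask of a subspace. -/
noncomputable def maskOf (F : Submodule (ZMod 2) Vec) : ℕ :=
  Nat.ofBits fun i : Fin 32 => decide (dec i ∈ F)

lemma maskOf_lt (F : Submodule (ZMod 2) Vec) : maskOf F < 2 ^ 32 := Nat.ofBits_lt_two_pow _

lemma testBit_maskOf {F : Submodule (ZMod 2) Vec} {y : ℕ} (hy : y < 32) :
    (maskOf F).testBit y = true ↔ dec y ∈ F := by
  rw [maskOf, Nat.testBit_ofBits_lt _ _ hy]
  simp

lemma eq_maskOf {F : Submodule (ZMod 2) Vec} {m : ℕ} (hm : m < 2 ^ 32)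
    (h : ∀ y < 32, m.testBit y = true ↔ dec y ∈ F) : m = maskOf F := by
  refine Nat.eq_of_testBit_eq fun y => ?_
  by_cases hy : y < 32
  · rw [Bool.eq_iff_iff, h y hy, testBit_maskOf hy]
  · have hp : 2 ^ 32 ≤ 2 ^ y := Nat.pow_le_pow_right (by norm_num) (by omega)
    rw [Nat.testBit_lt_two_pow (hm.trans_le hp),
      Nat.testBit_lt_two_pow ((maskOf_lt F).trans_le hp)]

lemma maskOf_injective : Function.Injective maskOf := by
  intro F F' h
  ext v
  obtain ⟨y, hy, rfl⟩ := exists_dec v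
  rw [← testBit_maskOf hy, h, testBit_maskOf hy]

lemma maskOf_inf (F F' : Submodule (ZMod 2) Vec) :
    Nat.land (maskOf F) (maskOf F') = maskOf (F ⊓ F') := by
  refine eq_maskOf (Nat.and_lt_two_pow _ (maskOf_lt F')) fun y hy => ?_
  change (maskOf F &&& maskOf F').testBit y = true ↔ _
  rw [Nat.testBit_and, Bool.and_eq_true, testBit_maskOf hy, testBit_maskOf hy, Submodule.mem_inf]

lemma maskOf_top : 4294967295 = maskOf ⊤ := by
  refine eq_maskOf (by norm_num) fun y hy => ?_
  rw [show 4294967295 = 2 ^ 32 - 1 from rfl, Nat.testBit_two_pow_sub_one]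
  simpa using hy

lemma spanMask_eq {gs : List ℕ} (hgs : ∀ g ∈ gs, g < 32) : spanMask gs = maskOf (S gs) := by
  refine eq_maskOf (cosetMask_lt hgs (by norm_num)) fun y hy => ?_
  rw [spanMask, testBit_cosetMask hgs (by norm_num) hy, Nat.zero_xor]

lemma le_iff_maskOf {F F' : Submodule (ZMod 2) Vec} :
    F ≤ F' ↔ Nat.land (maskOf F) (maskOf F') = maskOf F := by
  rw [maskOf_inf, maskOf_injective.eq_iff, inf_eq_left]

lemma lt_of_dec_mem_S {k : ℕ} (hk : k ≤ 5) {gs : List ℕ} (hgs : ∀ g ∈ gs, g < 2 ^ k) {x : ℕ}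
    (hx : x < 32) (h : dec x ∈ S gs) : x < 2 ^ k := by
  have hp : 2 ^ k ≤ 32 := (Nat.pow_le_pow_right two_pos hk).trans_eq (by norm_num)
  induction gs generalizing x with
  | nil =>
    rw [S_nil, Submodule.mem_bot, ← dec_zero] at h
    rw [dec_injOn hx (by norm_num) h]
    exact Nat.two_pow_pos k
  | cons g gs ih =>
    have h1 := hgs g List.mem_cons_self
    have h2 : ∀ g ∈ gs, g < 2 ^ k := fun g' h => hgs g' (List.mem_cons_of_mem g h)
    rw [S_cons, mem_sup_span_iff, ← dec_xor] at h
    rcases h with h | h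
    · exact ih h2 hx h
    · have := Nat.xor_lt_two_pow (ih h2 (xor_lt_32 hx (h1.trans_le hp)) h) h1
      rwa [Nat.xor_assoc, Nat.xor_self, Nat.xor_zero] at this

lemma xor_two_pow {w k : ℕ} (hw : w < 2 ^ k) : w ^^^ 2 ^ k = w + 2 ^ k := by
  refine Nat.eq_of_testBit_eq fun y => ?_
  rw [add_comm, Nat.testBit_xor, Nat.testBit_two_pow]
  rcases lt_trichotomy k y with hy | rfl | hy
  · have hlt : 2 ^ k + w < 2 ^ y := by
      have := Nat.pow_le_pow_right (n := 2) (by norm_num) (show k + 1 ≤ y from hy)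
      rw [pow_succ] at this
      omega
    rw [Nat.testBit_lt_two_pow hlt, Nat.testBit_lt_two_pow (by omega)]
    simp [hy.ne]
  · simp [Nat.testBit_two_pow_add_eq, Nat.testBit_lt_two_pow hw]
  · rw [Nat.testBit_two_pow_add_gt hy]
    simp [hy.ne']

lemma exists_genLists {k : ℕ} (hk : k ≤ 5) (F : Submodule (ZMod 2) Vec) :
    ∃ gs ∈ genLists k, (∀ g ∈ gs, g < 2 ^ k) ∧
      ∀ x < 2 ^ k, dec x ∈ F ↔ dec x ∈ S gs := by
  induction k with
  | zero =>
    refine ⟨[], List.mem_singleton_self _, by simp, fun x hx => ?_⟩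
    obtain rfl : x = 0 := by simpa using hx
    simp [dec_zero]
  | succ k ih =>
    obtain ⟨gs, hgs, hlt, hF⟩ := ih (by omega)
    have hp : 2 ^ k < 32 := Nat.pow_lt_pow_right (n := 5) (by norm_num) (by omega)
    have hsucc : 2 ^ (k + 1) = 2 ^ k + 2 ^ k := by rw [pow_succ]; ring
    have hgs32 : ∀ g ∈ gs, g < 32 := fun g hg => (hlt g hg).trans hp
    have hp' : 2 ^ (k + 1) ≤ 32 := (Nat.pow_le_pow_right two_pos hk).trans_eq (by norm_num)
    have hpos : 0 < 2 ^ k := Nat.two_pow_pos k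
    have hxor {w : ℕ} (hw : w < 2 ^ k) : w ^^^ 2 ^ k = w + 2 ^ k := xor_two_pow hw
    have hsplit {x : ℕ} (hx : x < 2 ^ (k + 1)) (hxk : ¬ x < 2 ^ k) :
        ∃ w < 2 ^ k, x = w ^^^ 2 ^ k := by
      refine ⟨x - 2 ^ k, by omega, ?_⟩
      rw [hxor (by omega)]
      omega
    by_cases hex : ∃ w, w < 2 ^ k ∧ dec (w ^^^ 2 ^ k) ∈ F
    · classical
      obtain ⟨hw, hwF⟩ := Nat.find_spec hex
      have hmin {v : ℕ} (hv : v < Nat.find hex) : ¬ (v < 2 ^ k ∧ dec (v ^^^ 2 ^ k) ∈ F) :=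
        Nat.find_min hex hv
      generalize Nat.find hex = w at hw hwF hmin
      refine ⟨Nat.xor w (2 ^ k) :: gs, ?_, ?_, ?_⟩
      · rw [genLists, List.mem_append, List.mem_flatMap]
        refine .inr ⟨gs, hgs, List.mem_map.2 ⟨w, List.mem_filter.2 ⟨List.mem_range.2 hw, ?_⟩, rfl⟩⟩
        rw [natBeq_eq_true]
        refine Nat.eq_of_testBit_eq fun y => ?_
        change (cosetMask gs w % 2 ^ w).testBit y = _
        rw [Nat.testBit_mod_two_pow, Nat.zero_testBit, Bool.and_eq_false_iff]
        by_cases hy : y < w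
        · right
          rw [← Bool.not_eq_true, testBit_cosetMask hgs32 (by omega) (by omega),
            ← hF _ (Nat.xor_lt_two_pow hw (hy.trans hw)), dec_xor]
          intro h
          refine hmin hy ⟨hy.trans hw, ?_⟩
          rw [dec_xor] at hwF ⊢
          have h' := Submodule.add_mem _ h hwF
          have h0 : dec w + dec w = 0 := by rw [← dec_xor, Nat.xor_self, dec_zero]
          rwa [add_comm (dec w) (dec y), add_assoc, ← add_assoc (dec w), h0, zero_add] at h'
        · left; simpa using hy
      · intro g hg
        rcases List.mem_cons.1 hg with rfl | hg
        · change w ^^^ 2 ^ k < _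
          rw [hxor hw]; omega
        · have := hlt g hg; omega
      · intro x hx
        rw [S_cons, mem_sup_span_iff]
        change _ ↔ _ ∨ dec x + dec (w ^^^ 2 ^ k) ∈ _
        by_cases hxk : x < 2 ^ k
        · rw [hF x hxk]
          refine (or_iff_left ?_).symm
          rw [← dec_xor, ← Nat.xor_assoc]
          intro h
          have hxw := Nat.xor_lt_two_pow hxk hw
          have h' := xor_two_pow hxw
          have := lt_of_dec_mem_S (by omega) hlt (by omega) h
          omega
        · obtain ⟨v, hv, rfl⟩ := hsplit hx hxk
          have hvw : dec (v ^^^ 2 ^ k) + dec (w ^^^ 2 ^ k) = dec (v ^^^ w) := by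
            rw [← dec_xor, Nat.xor_comm w, ← Nat.xor_assoc, Nat.xor_assoc v, Nat.xor_self,
              Nat.xor_zero]
          rw [hvw, ← hF _ (Nat.xor_lt_two_pow hv hw), ← hvw, Submodule.add_mem_iff_left F hwF]
          refine (or_iff_right ?_).symm
          have := hxor hv
          intro h
          have := lt_of_dec_mem_S (by omega) hlt (by omega) h
          omega
    · refine ⟨gs, List.mem_append_left _ hgs, fun g hg => (hlt g hg).trans (by omega), ?_⟩
      intro x hx
      by_cases hxk : x < 2 ^ k
      · exact hF x hxk
      · obtain ⟨v, hv, rfl⟩ := hsplit hx hxk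
        refine iff_of_false (fun h => hex ⟨v, hv, h⟩) fun h => ?_
        have := hxor hv
        have := lt_of_dec_mem_S (by omega) hlt (by omega) h
        omega

end Encoding

/-! ### Matrices packed into numbers -/

section Codes

/-- The linear map whose matrix is packed into `e`. -/
def codeMap (e : ℕ) : Vec →ₗ[ZMod 2] Vec :=
  Fintype.linearCombination (ZMod 2) fun k : Fin 5 => dec (col e (7 + 5 * k))

lemma land_shiftRight_one (x k : ℕ) :
    Nat.land (Nat.shiftRight x k) 1 = if x.testBit k then 1 else 0 := by
  change x >>> k &&& 1 = _
  rw [Nat.testBit, Nat.and_comm 1, Nat.and_one_is_mod]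
  rcases Nat.mod_two_eq_zero_or_one (x >>> k) with h | h <;> simp [h]

lemma dec_mul_bit (x : ℕ) (k : Fin 5) (c : ℕ) :
    dec (Nat.mul (Nat.land (Nat.shiftRight x k) 1) c) = dec x k • dec c := by
  rw [land_shiftRight_one, dec]
  change dec (_ * _) = _
  split_ifs <;> simp [dec_zero]

lemma dec_applyCode (e x : ℕ) : dec (applyCode e x) = codeMap e (dec x) := by
  rw [codeMap, Fintype.linearCombination_apply, Fin.sum_univ_five, ← dec_mul_bit, ← dec_mul_bit,
    ← dec_mul_bit, ← dec_mul_bit, ← dec_mul_bit, ← dec_xor, ← dec_xor, ← dec_xor, ← dec_xor,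
    Nat.xor_assoc, Nat.xor_assoc, Nat.xor_assoc]
  rfl

lemma col_lt (e k : ℕ) : col e k < 32 :=
  (Nat.and_le_right : (e >>> k) &&& 31 ≤ 31).trans_lt (by norm_num)

lemma mul_bit_lt (x k e j : ℕ) :
    Nat.mul (Nat.land (Nat.shiftRight x k) 1) (col e j) < 32 := by
  rw [land_shiftRight_one]
  change (if x.testBit k then 1 else 0) * _ < _
  have := col_lt e j
  split_ifs <;> omega

lemma applyCode_lt (e x : ℕ) : applyCode e x < 32 :=
  xor_lt_32 (mul_bit_lt x 0 e _) (xor_lt_32 (mul_bit_lt ..) (xor_lt_32 (mul_bit_lt ..)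
    (xor_lt_32 (mul_bit_lt ..) (mul_bit_lt ..))))

lemma imageMask_eq (e : ℕ) (gs : List ℕ) :
    imageMask e gs = spanMask (gs.map (applyCode e)) := by
  refine congrFun (?_ : _ = cosetMask _) 0
  induction gs with
  | nil => rfl
  | cons g gs ih => rw [fold_cons, ih]; rfl

lemma map_codeMap (e : ℕ) (gs : List ℕ) :
    (S gs).map (codeMap e) = S (gs.map (applyCode e)) := by
  rw [S, S, Submodule.map_span]
  congr 1
  ext v
  simp only [Set.mem_image, Set.mem_ofPred_eq, List.mem_map]
  constructor
  · rintro ⟨_, ⟨g, hg, rfl⟩, rfl⟩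
    exact ⟨_, ⟨g, hg, rfl⟩, dec_applyCode e g⟩
  · rintro ⟨_, ⟨g, hg, rfl⟩, rfl⟩
    exact ⟨_, ⟨g, hg, rfl⟩, (dec_applyCode e g).symm⟩

lemma imageMask_eq_maskOf (e : ℕ) (gs : List ℕ) :
    imageMask e gs = maskOf ((S gs).map (codeMap e)) := by
  rw [imageMask_eq, map_codeMap]
  refine spanMask_eq fun g hg => ?_
  obtain ⟨x, -, rfl⟩ := List.mem_map.1 hg
  exact applyCode_lt e x

lemma exists_equiv {e : ℕ} (h : invertibleCode e = true) :
    ∃ g : Vec ≃ₗ[ZMod 2] Vec, g.toLinearMap = codeMap e := by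
  rw [invertibleCode, natBeq_eq_true, imageMask_eq_maskOf, maskOf_top] at h
  have hs : Function.Surjective (codeMap e) := by
    rw [← LinearMap.range_eq_top, ← top_le_iff, ← maskOf_injective h]
    exact LinearMap.map_le_range
  exact ⟨.ofBijective _ ⟨LinearMap.injective_iff_surjective.2 hs, hs⟩, rfl⟩

end Codes

/-! ### The representatives -/

section Representatives

open Config

lemma stdGens_lt (d : ℕ) : ∀ g ∈ stdGens d, g < 32 := by
  intro g hg
  have : g ∈ [1, 2, 4] := List.mem_of_mem_take hg
  clear hg
  revert g
  decide

lemma stdMask_eq (d : ℕ) : stdMask d = maskOf (S (stdGens d)) := spanMask_eq (stdGens_lt d)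

lemma spanMask_cons_stdGens {x : ℕ} (hx : x < 32) (d : ℕ) :
    spanMask (x :: stdGens d) = maskOf (S (stdGens d) ⊔ span (ZMod 2) {dec x}) := by
  rw [spanMask_eq, S_cons, sup_comm]
  exact List.forall_mem_cons.2 ⟨hx, stdGens_lt d⟩

lemma conf_mem (i : ℕ) : conf i ∈ confs := by
  rcases nth_mem_or (0, []) confs i with h | h
  · exact h
  · rw [conf, h, confs]
    exact List.mem_cons_self

/-- The configuration described by the data. -/
def rep (i : ℕ) : Config (ZMod 2) Vec :=
  ⟨S (stdGens (conf i).1), {F | ∃ f ∈ (conf i).2, S f.2 = F}⟩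

lemma conf_fst_lt (i : ℕ) : (conf i).1 < 4 := by
  have h := all_eq_true.1 all_validCheck _ (conf_mem i)
  exact natBlt_eq_true.1 (both_eq_true.1 h).1

lemma flat_spec {i : ℕ} {f : ℕ × List ℕ} (hf : f ∈ (conf i).2) :
    (∀ g ∈ f.2, g < 32) ∧ f.1 = maskOf (S f.2) ∧ (rep i).loops ≤ S f.2 ∧ S f.2 ≠ ⊤ ∧
      (∀ x, ¬ S f.2 ≤ (rep i).loops ⊔ span (ZMod 2) {x}) ∧
      ∀ f' ∈ (conf i).2, S f.2 ≠ S f'.2 → S f.2 ⊓ S f'.2 ≤ (rep i).loops := by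
  have h := all_eq_true.1 all_validCheck _ (conf_mem i)
  have h1 := all_eq_true.1 (both_eq_true.1 h).2
  have hm {f : ℕ × List ℕ} (hf : f ∈ (conf i).2) : (∀ g ∈ f.2, g < 32) ∧ f.1 = maskOf (S f.2) := by
    have := h1 f hf
    simp only [both_eq_true, all_eq_true, natBlt_eq_true, natBeq_eq_true] at this
    exact ⟨this.1, by rw [← this.2.1, spanMask_eq this.1]⟩
  have h2 := h1 f hf
  simp only [both_eq_true, either_eq_true, all_eq_true, natBlt_eq_true, natBeq_eq_true,
    boolNot_eq_true, stdMask_eq, (hm hf).2] at h2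
  obtain ⟨-, -, h3, h4, h5, h6⟩ := h2
  refine ⟨(hm hf).1, (hm hf).2, ?_, ?_, fun v => ?_, fun f' hf' hne => ?_⟩
  · rw [maskOf_inf, maskOf_injective.eq_iff] at h3
    exact inf_eq_right.1 h3
  · rwa [maskOf_top, maskOf_injective.eq_iff] at h4
  · obtain ⟨x, hx, rfl⟩ := exists_dec v
    have := h5 x (mem_range32.2 hx)
    rwa [spanMask_cons_stdGens hx, ← le_iff_maskOf] at this
  · rcases h6 f' hf' with h | h
    · rw [(hm hf').2, maskOf_injective.eq_iff] at h
      exact absurd h hne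
    · rw [(hm hf').2, maskOf_inf, maskOf_injective.eq_iff] at h
      exact h.le

lemma stdGens_sup_ne_top {d : ℕ} (hd : d < 4) (v : Vec) :
    S (stdGens d) ⊔ span (ZMod 2) {v} ≠ ⊤ := by
  obtain ⟨x, hx, rfl⟩ := exists_dec v
  have h := all_eq_true.1 (all_eq_true.1 all_topCheck d (List.mem_range.2 hd)) x (mem_range32.2 hx)
  rwa [boolNot_eq_true, natBeq_eq_true, spanMask_cons_stdGens hx, maskOf_top,
    maskOf_injective.eq_iff] at h

lemma valid_rep (i : ℕ) : (rep i).Valid where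
  loops_le := by
    rintro _ ⟨f, hf, rfl⟩
    exact (flat_spec hf).2.2.1
  ne_top := by
    rintro _ ⟨f, hf, rfl⟩
    exact (flat_spec hf).2.2.2.1
  nontrivial := by
    rintro _ ⟨f, hf, rfl⟩
    exact (flat_spec hf).2.2.2.2.1
  inf_le := by
    rintro _ ⟨f, hf, rfl⟩ _ ⟨f', hf', rfl⟩
    exact (flat_spec hf).2.2.2.2.2 f' hf'
  sup_ne_top := stdGens_sup_ne_top (conf_fst_lt i)

lemma codeOK_spec {d e : ℕ} {p : ℕ → Bool} (h : codeOK d e p = true) :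
    ∃ g : Vec ≃ₗ[ZMod 2] Vec, (conf (index e)).1 = d ∧
      ((rep (index e)).map g).loops = S (stdGens d) ∧
      ∀ f ∈ (conf (index e)).2, imageMask e f.2 = maskOf ((S f.2).map g.toLinearMap) ∧
        p (maskOf ((S f.2).map g.toLinearMap)) = true := by
  simp only [codeOK, both_eq_true, natBeq_eq_true, all_eq_true] at h
  obtain ⟨rfl, h1, h2, h3⟩ := h
  obtain ⟨g, hg⟩ := exists_equiv h1
  rw [fixesStd, natBeq_eq_true, imageMask_eq_maskOf, ← hg, stdMask_eq,
    maskOf_injective.eq_iff] at h2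
  refine ⟨g, rfl, h2, fun f hf => ?_⟩
  have := h3 f hf
  rw [imageMask_eq_maskOf, ← hg] at this
  exact ⟨by rw [imageMask_eq_maskOf, ← hg], this⟩

/-- The configuration without one of its flats. -/
def Config.erase (C : Config (ZMod 2) Vec) (F : Submodule (ZMod 2) Vec) :
    Config (ZMod 2) Vec :=
  ⟨C.loops, C.flats \ {F}⟩

lemma downOK_spec {i e : ℕ} {f : ℕ × List ℕ} (hf : f ∈ (conf i).2)
    (h : downOK i (conf i).1 (conf i).2 f e = true) :
    index e < i ∧ (rep (index e)).Iso ((rep i).erase (S f.2)) := by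
  simp only [downOK, both_eq_true, natBlt_eq_true, all_eq_true] at h
  obtain ⟨h1, h2, h3⟩ := h
  obtain ⟨g, -, hL, hp⟩ := codeOK_spec h2
  refine ⟨h1, g, Config.ext hL (Set.Subset.antisymm ?_ ?_)⟩
  · rintro _ ⟨_, ⟨f', hf', rfl⟩, rfl⟩
    have h := (hp f' hf').2
    simp only [any_eq_true, both_eq_true, natBeq_eq_true, boolNot_eq_true] at h
    obtain ⟨m, hm, h4, h5⟩ := h
    rw [(flat_spec hm).2.1, maskOf_injective.eq_iff] at h4
    refine ⟨⟨m, hm, h4⟩, fun h6 => h5 ?_⟩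
    rw [Set.mem_singleton_iff] at h6
    rw [h6, (flat_spec hf).2.1]
  · rintro _ ⟨⟨m, hm, rfl⟩, hne⟩
    have h := h3 m hm
    simp only [either_eq_true, any_eq_true, natBeq_eq_true] at h
    rcases h with h | ⟨f', hf', h⟩
    · rw [(flat_spec hm).2.1, (flat_spec hf).2.1, maskOf_injective.eq_iff] at h
      exact absurd h hne
    · rw [(hp f' hf').1, (flat_spec hm).2.1, maskOf_injective.eq_iff] at h
      exact ⟨S f'.2, ⟨f', hf', rfl⟩, h.symm⟩

lemma deck_spec {i : ℕ} (hi : i < 94) :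
    (∀ F ∈ (rep i).flats, ∃ e ∈ nth [] downCodes i,
      index e < i ∧ (rep (index e)).Iso ((rep i).erase F)) ∧
    ∀ e ∈ nth [] downCodes i, ∃ F ∈ (rep i).flats,
      index e < i ∧ (rep (index e)).Iso ((rep i).erase F) := by
  have h := all_eq_true.1 all_downCheck i (List.mem_range.2 hi)
  obtain ⟨h1, h2⟩ := matched_spec h
  constructor
  · rintro _ ⟨f, hf, rfl⟩
    obtain ⟨e, he, h⟩ := h1 f hf
    exact ⟨e, he, downOK_spec hf h⟩
  · intro e he
    obtain ⟨f, hf, h⟩ := h2 e he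
    exact ⟨S f.2, ⟨f, hf, rfl⟩, downOK_spec hf h⟩

lemma maskOf_mem_cands {d : ℕ} (hd : d < 4) {F : Submodule (ZMod 2) Vec}
    (h1 : S (stdGens d) ≤ F) (h2 : F ≠ ⊤)
    (h3 : ∀ x, ¬ F ≤ S (stdGens d) ⊔ span (ZMod 2) {x}) : maskOf F ∈ nth [] cands d := by
  obtain ⟨gs, hgs, hlt, h⟩ := exists_genLists le_rfl F
  obtain rfl : F = S gs := by
    ext v
    obtain ⟨x, hx, rfl⟩ := exists_dec v
    exact h x hx
  have hc := all_eq_true.1 (all_eq_true.1 all_candCheck gs hgs) d (List.mem_range.2 hd)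
  rw [spanMask_eq hlt, candCheck] at hc
  have hb : Nat.beq (Nat.land (maskOf (S gs)) (stdMask d)) (stdMask d) = true := by
    rw [natBeq_eq_true, stdMask_eq, maskOf_inf, inf_eq_right.2 h1]
  rw [hb] at hc
  simp only [either_eq_true, any_eq_true, natBeq_eq_true] at hc
  rcases hc with hc | ⟨c, hc, heq⟩ | ⟨x, hx, hc⟩
  · rw [maskOf_top, maskOf_injective.eq_iff] at hc
    exact absurd hc h2
  · rwa [heq]
  · rw [spanMask_cons_stdGens (mem_range32.1 hx), maskOf_injective.eq_iff] at hc
    exact absurd hc.le (h3 (dec x))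

lemma exists_larger_rep {i : ℕ} (hi : i < 94) {C : Config (ZMod 2) Vec} (hC : C.Valid)
    (hL : (rep i).loops = C.loops) (hsub : (rep i).flats ⊆ C.flats) (hne : rep i ≠ C) :
    ∃ j, i < j ∧ j < 94 ∧ ∃ g : Vec ≃ₗ[ZMod 2] Vec,
      ((rep j).map g).loops = C.loops ∧ ((rep j).map g).flats ⊆ C.flats := by
  obtain ⟨F, hF, hFi⟩ : ∃ F ∈ C.flats, F ∉ (rep i).flats := by
    by_contra! h
    exact hne (Config.ext hL (hsub.antisymm h))
  have hcand : maskOf F ∈ nth [] cands (conf i).1 := by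
    refine maskOf_mem_cands (conf_fst_lt i) ?_ (hC.ne_top F hF) ?_
    · exact hL.trans_le (hC.loops_le F hF)
    · have := hC.nontrivial F hF
      rwa [← hL] at this
  have h := all_eq_true.1 all_upCheck i (List.mem_range.2 hi)
  obtain ⟨e, h1, h2, h3⟩ := upLoop_spec h hcand (by
    intro m hm
    rw [(flat_spec hm).2.1, stdMask_eq, maskOf_inf, maskOf_injective.eq_iff]
    have hmC : S m.2 ∈ C.flats := hsub ⟨m, hm, rfl⟩
    have hle : (rep i).loops ≤ F := hL.trans_le (hC.loops_le F hF)
    refine le_antisymm ?_ (le_inf hle (flat_spec hm).2.2.1)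
    refine (hC.inf_le F hF _ hmC ?_).trans hL.symm.le
    rintro rfl
    exact hFi ⟨m, hm, rfl⟩)
  obtain ⟨g, -, hgL, hp⟩ := codeOK_spec h3
  refine ⟨index e, h1, h2, g, hgL.trans hL, ?_⟩
  rintro _ ⟨_, ⟨f, hf, rfl⟩, rfl⟩
  have h := (hp f hf).2
  simp only [either_eq_true, any_eq_true, natBeq_eq_true, maskOf_injective.eq_iff] at h
  rcases h with h | ⟨m, hm, h⟩
  · rwa [h]
  · rw [(flat_spec hm).2.1, maskOf_injective.eq_iff] at h
    exact hsub ⟨m, hm, h⟩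

end Representatives

/-! ### Every configuration is isomorphic to a representative -/

section Completeness

lemma exists_equiv_map_eq {F F' : Submodule (ZMod 2) Vec}
    (h : finrank (ZMod 2) F = finrank (ZMod 2) F') :
    ∃ g : Vec ≃ₗ[ZMod 2] Vec, F.map g.toLinearMap = F' := by
  obtain ⟨Q, hQ⟩ := Submodule.exists_isCompl F
  obtain ⟨Q', hQ'⟩ := Submodule.exists_isCompl F'
  have h1 := Submodule.finrank_add_eq_of_isCompl hQ
  have h2 := Submodule.finrank_add_eq_of_isCompl hQ'
  let g := (Submodule.prodEquivOfIsCompl F Q hQ).symm ≪≫ₗ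
    (LinearEquiv.prodCongr (LinearEquiv.ofFinrankEq F F' h)
      (LinearEquiv.ofFinrankEq Q Q' (by omega))) ≪≫ₗ Submodule.prodEquivOfIsCompl F' Q' hQ'
  refine ⟨g, Submodule.eq_of_le_of_finrank_eq ?_ ?_⟩
  · rintro _ ⟨x, hx, rfl⟩
    have : (Submodule.prodEquivOfIsCompl F Q hQ).symm x = (⟨x, hx⟩, 0) :=
      Submodule.prodEquivOfIsCompl_symm_apply_left F Q hQ ⟨x, hx⟩
    simp [g, this]
  · rw [← h]
    exact LinearEquiv.finrank_map_eq g F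

lemma finrank_S_stdGens {d : ℕ} (hd : d < 4) : finrank (ZMod 2) (S (stdGens d)) = d := by
  have hli : LinearIndependent (ZMod 2) fun i : Fin d => dec (2 ^ (i : ℕ)) := by
    have h := (Pi.basisFun (ZMod 2) (Fin 5)).linearIndependent.comp
      (Fin.castLE (by omega : d ≤ 5)) (Fin.castLE_injective _)
    convert h using 1
    funext i j
    simp [dec, Nat.testBit_two_pow, Pi.single_apply, Fin.ext_iff, eq_comm]
  have h := finrank_span_eq_card hli
  rw [Fintype.card_fin] at h
  have hset : {v | ∃ g ∈ stdGens d, dec g = v} = Set.range fun i : Fin d => dec (2 ^ (i : ℕ)) := by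
    clear hli h
    ext v
    interval_cases d <;> simp [stdGens, Fin.exists_fin_succ]
  rwa [S, hset]

lemma Config.Valid.finrank_loops_lt {C : Config (ZMod 2) Vec} (hC : C.Valid) :
    finrank (ZMod 2) C.loops < 4 := by
  by_contra! h
  obtain ⟨Q, hQ⟩ := Submodule.exists_isCompl C.loops
  have h1 := Submodule.finrank_add_eq_of_isCompl hQ
  rw [finrank_fin_fun] at h1
  obtain ⟨v, hv⟩ := finrank_le_one_iff.1 (show finrank (ZMod 2) Q ≤ 1 by omega)
  refine hC.sup_ne_top v (top_le_iff.1 ?_)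
  rw [← hQ.sup_eq_top]
  refine sup_le_sup_left (fun w hw => ?_) _
  obtain ⟨c, hc⟩ := hv ⟨w, hw⟩
  exact Submodule.mem_span_singleton.2 ⟨c, congrArg Subtype.val hc⟩

/-- `C'` arises from `C` by adding flats. -/
def Config.Sub (C C' : Config (ZMod 2) Vec) : Prop :=
  C.loops = C'.loops ∧ C.flats ⊆ C'.flats

lemma Config.Sub.map {C C' : Config (ZMod 2) Vec} (h : C.Sub C') (g : Vec ≃ₗ[ZMod 2] Vec) :
    (C.map g).Sub (C'.map g) :=
  ⟨congrArg (Submodule.map g.toLinearMap) h.1, Set.image_mono h.2⟩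

lemma exists_iso_rep_of_sub (n : ℕ) {i : ℕ} (hi : i < 94) (hn : 94 ≤ i + n)
    {C : Config (ZMod 2) Vec} (hC : C.Valid) {g : Vec ≃ₗ[ZMod 2] Vec}
    (h : ((rep i).map g).Sub C) : ∃ j < 94, (rep j).Iso C := by
  induction n generalizing i g with
  | zero => omega
  | succ n ih =>
    by_cases heq : (rep i).map g = C
    · exact ⟨i, hi, g, heq⟩
    have hs := h.map g.symm
    rw [Config.map_map, LinearEquiv.self_trans_symm, Config.map_refl] at hs
    obtain ⟨j, hij, hj, k, hk⟩ := exists_larger_rep hi (hC.map g.symm) hs.1 hs.2 (by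
      intro h'
      rw [h', Config.map_map, LinearEquiv.symm_trans_self, Config.map_refl] at heq
      exact heq rfl)
    have hk' := Config.Sub.map (C' := C.map g.symm) hk g
    rw [Config.map_map, Config.map_map, LinearEquiv.symm_trans_self, Config.map_refl] at hk'
    exact ih hj (by omega) hk'

lemma exists_iso_rep {C : Config (ZMod 2) Vec} (hC : C.Valid) : ∃ j < 94, (rep j).Iso C := by
  have hd := hC.finrank_loops_lt
  generalize hdL : finrank (ZMod 2) C.loops = d at hd
  have hconf : conf d = (d, []) := by
    interval_cases d <;> rfl
  obtain ⟨g, hg⟩ := exists_equiv_map_eq ((finrank_S_stdGens hd).trans hdL.symm)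
  refine exists_iso_rep_of_sub 94 (i := d) (by omega) (by omega) hC (g := g) ⟨?_, ?_⟩
  · change (S (stdGens (conf d).1)).map _ = _
    rwa [hconf]
  · rintro _ ⟨_, ⟨f, hf, rfl⟩, rfl⟩
    simp [hconf] at hf

end Completeness

/-! ### The representatives are pairwise non-isomorphic -/

section Invariant

open Classical in
/-- Iterated vector weights attached to a configuration. -/
noncomputable def weight (C : Config (ZMod 2) Vec) : ℕ → Vec → ℕ
  | 0, x => if x ∈ C.loops then 2 else 3
  | n + 1, x => (∑ y, weight C n y * weight C n (x + y) *
      (if ∃ F ∈ C.flats, x ∈ F ∧ y ∈ F then 7 else 1)) % 65521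

lemma weight_lt (C : Config (ZMod 2) Vec) (n : ℕ) (x : Vec) : weight C n x < 65536 := by
  cases n with
  | zero => rw [weight]; split_ifs <;> norm_num
  | succ n => exact (Nat.mod_lt _ (by norm_num)).trans (by norm_num)

lemma weight_map (C : Config (ZMod 2) Vec) (g : Vec ≃ₗ[ZMod 2] Vec) (n : ℕ) (x : Vec) :
    weight (C.map g) n (g x) = weight C n x := by
  have hmem {F : Submodule (ZMod 2) Vec} {x : Vec} : g x ∈ F.map g.toLinearMap ↔ x ∈ F :=
    ⟨fun ⟨_, hy, h⟩ => g.injective h ▸ hy, fun h => ⟨x, h, rfl⟩⟩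
  classical
  induction n generalizing x with
  | zero =>
    rw [weight, weight]
    exact if_congr hmem rfl rfl
  | succ n ih =>
    rw [weight, weight, ← g.toEquiv.sum_comp]
    refine congrArg (· % 65521) (Finset.sum_congr rfl fun y _ => ?_)
    rw [LinearEquiv.coe_toEquiv, ih, ← map_add, ih]
    congr 1
    refine if_congr ?_ rfl rfl
    change (∃ F ∈ Submodule.map g.toLinearMap '' C.flats, _) ↔ _
    simp only [Set.exists_mem_image, hmem]

/-- A numerical isomorphism invariant. -/
noncomputable def invariant (C : Config (ZMod 2) Vec) : ℕ :=
  ∑ x, weight C 3 x * weight C 3 x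

lemma invariant_map (C : Config (ZMod 2) Vec) (g : Vec ≃ₗ[ZMod 2] Vec) :
    invariant (C.map g) = invariant C := by
  rw [invariant, ← g.toEquiv.sum_comp]
  exact Finset.sum_congr rfl fun x _ => by rw [LinearEquiv.coe_toEquiv, weight_map]

lemma fold_add_eq_sum {α : Type} (f : α → ℕ) (l : List α) :
    fold (fun y s => Nat.add s (f y)) 0 l = (l.map f).sum := by
  induction l with
  | nil => rfl
  | cons x l ih =>
    rw [fold_cons, ih, List.map_cons, List.sum_cons, add_comm]
    rfl

lemma sum_range32 {f : ℕ → ℕ} {F : Vec → ℕ} (h : ∀ x < 32, f x = F (dec x)) :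
    (range32.map f).sum = ∑ v, F v := by
  have h1 : (range32.map f).sum = ∑ x ∈ Finset.range 32, f x := rfl
  rw [h1, Finset.sum_range, ← decEquiv.sum_comp]
  exact Finset.sum_congr rfl fun x _ => h x x.2

lemma fold_pack_div {c : ℕ → ℕ} {l : List ℕ} (hc : ∀ x ∈ l, c x < 65536) (k : ℕ) :
    fold (fun x s => Nat.add (c x) (Nat.mul s 65536)) 0 l / 65536 ^ k % 65536 =
      (l.map c).getD k 0 := by
  induction l generalizing k with
  | nil => simp
  | cons x l ih =>
    have hx := hc x List.mem_cons_self
    have ih := ih fun y hy => hc y (List.mem_cons_of_mem x hy)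
    rw [fold_cons]
    generalize fold (fun x s => Nat.add (c x) (Nat.mul s 65536)) 0 l = s at ih
    change (c x + s * 65536) / _ % _ = _
    cases k with
    | zero =>
      rw [pow_zero, Nat.div_one, Nat.add_mul_mod_self_right, Nat.mod_eq_of_lt hx]
      rfl
    | succ k =>
      rw [pow_succ', ← Nat.div_div_eq_div_mul, Nat.add_mul_div_right _ _ (by norm_num),
        Nat.div_eq_of_lt hx, zero_add, ih k]
      rfl

lemma unpack_pack {c : ℕ → ℕ} (hc : ∀ x < 32, c x < 65536) {x : ℕ} (hx : x < 32) :
    unpack (pack c) x = c x := by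
  change (pack c >>> (16 * x)) &&& (2 ^ 16 - 1) = _
  rw [Nat.and_two_pow_sub_one_eq_mod, Nat.shiftRight_eq_div_pow, pow_mul]
  refine (fold_pack_div (fun y hy => hc y (mem_range32.1 hy)) x).trans ?_
  have : range32 = List.range 32 := rfl
  rw [this, List.getD_eq_getElem _ _ (by simpa using hx)]
  simp

lemma related_iff {i x y : ℕ} (hx : x < 32) (hy : y < 32) :
    related (conf i).2 x y = true ↔ ∃ F ∈ (rep i).flats, dec x ∈ F ∧ dec y ∈ F := by
  simp only [related, any_eq_true, both_eq_true, bitOf_eq_testBit]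
  constructor
  · rintro ⟨f, hf, h⟩
    rw [(flat_spec hf).2.1, testBit_maskOf hx, testBit_maskOf hy] at h
    exact ⟨_, ⟨f, hf, rfl⟩, h⟩
  · rintro ⟨_, ⟨f, hf, rfl⟩, h⟩
    refine ⟨f, hf, ?_⟩
    rwa [(flat_spec hf).2.1, testBit_maskOf hx, testBit_maskOf hy]

lemma unpack_pack_weightStep {i n : ℕ} {c : ℕ → ℕ}
    (hc : ∀ x < 32, c x = weight (rep i) n (dec x)) :
    ∀ x < 32, unpack (pack (weightStep i c)) x = weight (rep i) (n + 1) (dec x) := by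
  have h : ∀ x < 32, weightStep i c x = weight (rep i) (n + 1) (dec x) := by
    intro x hx
    rw [weightStep, fold_add_eq_sum, weight]
    have hmod {a b n : ℕ} (h : a = b) : Nat.mod a n = b % n := h ▸ rfl
    refine hmod (sum_range32 fun y hy => ?_)
    change c y * c (x ^^^ y) * _ = _
    rw [hc y hy, hc _ (xor_lt_32 hx hy), dec_xor]
    congr 1
    have := related_iff (i := i) hx hy
    cases hr : related (conf i).2 x y with
    | false => rw [if_neg (by rw [← this, hr]; simp)]
    | true => rw [if_pos (this.1 hr)]
  intro x hx
  rw [unpack_pack (fun y hy => by rw [h y hy]; exact weight_lt ..) hx, h x hx]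

lemma stdMask_weight (i : ℕ) : ∀ x < 32,
    (Bool.rec 3 2 (bitOf (stdMask (conf i).1) x) : ℕ) = weight (rep i) 0 (dec x) := by
  intro x hx
  rw [bitOf_eq_testBit, stdMask_eq, weight]
  have : (maskOf (S (stdGens (conf i).1))).testBit x = true ↔ dec x ∈ (rep i).loops :=
    testBit_maskOf hx
  cases hb : (maskOf (S (stdGens (conf i).1))).testBit x with
  | false => rw [if_neg (by rw [← this, hb]; simp)]
  | true => rw [if_pos (this.1 hb)]

lemma fold_sq_eq_invariant {C : Config (ZMod 2) Vec} {c : ℕ → ℕ}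
    (hc : ∀ x < 32, c x = weight C 3 (dec x)) :
    fold (fun v s => Nat.add s (Nat.mul v v)) 0 (range32.map c) = invariant C := by
  rw [fold_add_eq_sum (fun v => Nat.mul v v), List.map_map]
  refine sum_range32 fun x hx => ?_
  rw [Function.comp_apply, hc x hx]
  rfl

lemma invariantN_eq (i : ℕ) : invariantN i = invariant (rep i) := by
  unfold invariantN
  apply fold_sq_eq_invariant
  apply unpack_pack_weightStep (n := 2)
  apply unpack_pack_weightStep (n := 1)
  apply unpack_pack_weightStep (n := 0)
  apply stdMask_weight

lemma Config.map_erase (C : Config (ZMod 2) Vec) (F : Submodule (ZMod 2) Vec)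
    (g : Vec ≃ₗ[ZMod 2] Vec) :
    (C.erase F).map g = (C.map g).erase (F.map g.toLinearMap) := by
  refine Config.ext rfl ?_
  change _ '' (_ \ _) = _ '' _ \ _
  rw [Set.image_sdiff (Submodule.map_injective_of_injective g.injective), Set.image_singleton]

lemma deckSub_of_iso {i j : ℕ} (hi : i < 94) (hj : j < 94) (h : (rep i).Iso (rep j))
    (ih : ∀ k < i, ∀ l < 94, (rep k).Iso (rep l) → k = l) :
    deckSub (nth [] downCodes i) (nth [] downCodes j) = true ∧
      deckSub (nth [] downCodes j) (nth [] downCodes i) = true := by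
  simp only [deckSub, all_eq_true, any_eq_true, natBeq_eq_true]
  obtain ⟨g, hg⟩ := h
  have herase (F : Submodule (ZMod 2) Vec) :
      ((rep i).erase F).Iso ((rep j).erase (F.map g.toLinearMap)) :=
    ⟨g, by rw [Config.map_erase, hg]⟩
  constructor
  · intro a ha
    obtain ⟨F, hF, hai, h1⟩ := (deck_spec hi).2 a ha
    obtain ⟨b, hb, hbj, h2⟩ := (deck_spec hj).1 (F.map g.toLinearMap) (by
      rw [← hg]; exact ⟨F, hF, rfl⟩)
    exact ⟨b, hb, ih _ hai _ (hbj.trans hj) ((h1.trans (herase F)).trans h2.symm)⟩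
  · intro b hb
    obtain ⟨F', hF', hbj, h2⟩ := (deck_spec hj).2 b hb
    rw [← hg] at hF'
    obtain ⟨F, hF, rfl⟩ := hF'
    obtain ⟨a, ha, hai, h1⟩ := (deck_spec hi).1 F hF
    exact ⟨a, ha, (ih _ hai _ (hbj.trans hj) ((h1.trans (herase F)).trans h2.symm)).symm⟩

lemma eq_of_iso {i j : ℕ} (hi : i < 94) (hj : j < 94) (h : (rep i).Iso (rep j)) : i = j := by
  induction i using Nat.strong_induction_on generalizing j with
  | _ i ih =>
    obtain ⟨h1, h2⟩ := deckSub_of_iso hi hj h fun k hk l hl => ih k hk (hk.trans hi) hl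
    have h3 : invariantN i = invariantN j := by
      obtain ⟨g, hg⟩ := h
      rw [invariantN_eq, invariantN_eq, ← hg, invariant_map]
    have hsep {a b : ℕ} (hab : a < b) (hb : b < 94) : separated a b = true :=
      all_eq_true.1 (all_eq_true.1 all_separated b (List.mem_range.2 hb)) a (List.mem_range.2 hab)
    rcases lt_trichotomy i j with hij | hij | hij
    · have := hsep hij hj
      rw [separated, h1, h2, natBeq_eq_true.2 h3] at this
      exact absurd this Bool.false_ne_true
    · exact hij
    · have := hsep hij hi
      rw [separated, h1, h2, natBeq_eq_true.2 h3.symm] at this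
      exact absurd this Bool.false_ne_true

end Invariant

/-- The representatives are in bijection with the isomorphism classes. -/
lemma bijective_mk_rep :
    Function.Bijective fun i : Fin 94 => Quot.mk (fun r₁ r₂ :
        {r : Submodule (ZMod 2) Vec → ℕ // IsQMatroid r ∧ r ⊤ = 2} =>
      ∃ g : Vec ≃ₗ[ZMod 2] Vec, ∀ X : Submodule (ZMod 2) Vec,
        r₁.1 X = r₂.1 (Submodule.map g.toLinearMap X))
      ⟨(rep i).rk, (valid_rep i).isQMatroid, (valid_rep i).rk_top⟩ := by
  constructor
  · intro i j h
    have key : ∀ r₁ r₂ : {r : Submodule (ZMod 2) Vec → ℕ // IsQMatroid r ∧ r ⊤ = 2},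
        Relation.EqvGen (fun r₁ r₂ => ∃ g : Vec ≃ₗ[ZMod 2] Vec, ∀ X : Submodule (ZMod 2) Vec,
          r₁.1 X = r₂.1 (Submodule.map g.toLinearMap X)) r₁ r₂ →
        (configOf r₁.2.1).Iso (configOf r₂.2.1) := by
      intro r₁ r₂ h
      induction h with
      | rel r₁ r₂ h =>
        rw [(valid_configOf r₁.2.1 r₁.2.2).iso_iff (valid_configOf r₂.2.1 r₂.2.2),
          rk_configOf r₁.2.1 r₁.2.2, rk_configOf r₂.2.1 r₂.2.2]
        exact h
      | refl r => exact .refl _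
      | symm _ _ _ ih => exact ih.symm
      | trans _ _ _ _ _ ih1 ih2 => exact ih1.trans ih2
    have hrep (k : ℕ) : configOf (valid_rep k).isQMatroid = rep k :=
      (valid_configOf (valid_rep k).isQMatroid (valid_rep k).rk_top).eq_of_rk_eq (valid_rep k)
        (rk_configOf (valid_rep k).isQMatroid (valid_rep k).rk_top)
    have h' := key _ _ (Quot.eqvGen_exact h)
    rw [hrep, hrep] at h'
    exact Fin.ext (eq_of_iso i.2 j.2 h')
  · rintro ⟨r, hr, h2⟩
    obtain ⟨j, hj, h⟩ := exists_iso_rep (valid_configOf hr h2)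
    refine ⟨⟨j, hj⟩, Quot.sound ?_⟩
    have := ((valid_rep j).iso_iff (valid_configOf hr h2)).1 h
    rwa [rk_configOf hr h2] at this

end QMatroidCount

/-- there are exactly 94 isomorphism classes of q-matroids of
rank 2 on a 5-dimensional vector space over F₂. -/
theorem stmt15 :
    Nat.card (Quot (fun r₁ r₂ :
        {r : Submodule (ZMod 2) (Fin 5 → ZMod 2) → ℕ // IsQMatroid r ∧ r ⊤ = 2} =>
      ∃ g : (Fin 5 → ZMod 2) ≃ₗ[ZMod 2] (Fin 5 → ZMod 2),
        ∀ X : Submodule (ZMod 2) (Fin 5 → ZMod 2),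
          r₁.1 X = r₂.1 (Submodule.map g.toLinearMap X))) = 94 := by
  rw [← Nat.card_eq_of_bijective _ QMatroidCount.bijective_mk_rep, Nat.card_fin]
end

section
/- There exist at most 31 isomorphism classes of q-matroids of rank 2 on a 4-dimensional vector space over F_3; that is, the set of functions r on the lattice of subspaces of F_3^4 satisfying the q-matroid axioms with r(F_3^4) = 2, considered up to the equivalence r ~ r∘ĝ for F_3-linear automorphisms g of F_3^4, has at most 31 equivalence classes. -/
open Module Submodule

variable {K V V₁ V₂ : Type*}

section General

variable [Field K] [AddCommGroup V] [Module K V]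

/-- The rank function of the q-matroid of rank two with loop space `L` whose rank-one flats
are `H` and the spaces that cover `L` and are not contained in `H`. -/
noncomputable def flagRank (L H X : Submodule K V) : ℕ :=
  open Classical in
  if X ≤ L then 0 else if X ≤ H ∨ finrank K ↥(X ⊔ L) ≤ finrank K L + 1 then 1 else 2

/-- The rank function of the loopless q-matroid of rank two whose rank-one flats of dimension
two are the members of `F`. -/
noncomputable def spreadRank (F : Set (Submodule K V)) (X : Submodule K V) : ℕ :=
  open Classical in
  if X = ⊥ then 0 else if finrank K X = 1 ∨ X ∈ F then 1 else 2

/-- A set of two-dimensional subspaces any two of which intersect trivially. -/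
def IsPartialSpread (F : Set (Submodule K V)) : Prop :=
  (∀ X ∈ F, finrank K X = 2) ∧ ∀ X ∈ F, ∀ Y ∈ F, X ≠ Y → X ⊓ Y = ⊥

theorem flagRank_map (g : V ≃ₗ[K] V) (L H X : Submodule K V) :
    flagRank (L.map g.toLinearMap) (H.map g.toLinearMap) (X.map g.toLinearMap) =
      flagRank L H X := by
  have h (A B : Submodule K V) : A.map g.toLinearMap ≤ B.map g.toLinearMap ↔ A ≤ B :=
    Submodule.map_le_map_iff_of_injective g.injective A B
  have h' (A : Submodule K V) : finrank K (A.map g.toLinearMap) = finrank K A :=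
    LinearEquiv.finrank_map_eq g A
  classical
  unfold flagRank
  refine if_congr (h X L) rfl (if_congr (or_congr (h X H) ?_) rfl rfl)
  rw [← Submodule.map_sup, h', h']

theorem spreadRank_map (g : V ≃ₗ[K] V) (F : Set (Submodule K V)) (X : Submodule K V) :
    spreadRank (Submodule.map g.toLinearMap '' F) (X.map g.toLinearMap) = spreadRank F X := by
  have hinj : Function.Injective (Submodule.map g.toLinearMap) :=
    Submodule.map_injective_of_injective g.injective
  have h : X.map g.toLinearMap = ⊥ ↔ X = ⊥ := by
    rw [← hinj.eq_iff (a := X), Submodule.map_bot]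
  have h' : finrank K (X.map g.toLinearMap) = finrank K X := LinearEquiv.finrank_map_eq g X
  classical
  unfold spreadRank
  exact if_congr h rfl (if_congr (or_congr (by rw [h']) hinj.mem_set_image) rfl rfl)

variable [FiniteDimensional K V]

/-- A linear equivalence between subspaces of spaces of equal dimension extends to the
whole spaces. -/
theorem exists_linearEquiv_extending [AddCommGroup V₁] [Module K V₁] [FiniteDimensional K V₁]
    (hV : finrank K V = finrank K V₁) {W : Submodule K V} {W₁ : Submodule K V₁} (e : W ≃ₗ[K] W₁) :
    ∃ g : V ≃ₗ[K] V₁, ∀ x : W, g x = e x := by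
  obtain ⟨C, hC⟩ := W.exists_isCompl
  obtain ⟨C₁, hC₁⟩ := W₁.exists_isCompl
  have h1 := Submodule.finrank_add_eq_of_isCompl hC
  have h2 := Submodule.finrank_add_eq_of_isCompl hC₁
  have h3 := e.finrank_eq
  let f : C ≃ₗ[K] C₁ := LinearEquiv.ofFinrankEq C C₁ (by omega)
  refine ⟨(prodEquivOfIsCompl W C hC).symm ≪≫ₗ (e.prodCongr f) ≪≫ₗ
    prodEquivOfIsCompl W₁ C₁ hC₁, fun x => ?_⟩
  simp

/-- The linear group acts transitively on the pairs of nested subspaces of given dimensions. -/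
theorem exists_linearEquiv_map_flag {L H L' H' : Submodule K V} (hL : L ≤ H) (hL' : L' ≤ H')
    (hLd : finrank K L = finrank K L') (hHd : finrank K H = finrank K H') :
    ∃ g : V ≃ₗ[K] V, L.map g.toLinearMap = L' ∧ H.map g.toLinearMap = H' := by
  let e : L.submoduleOf H ≃ₗ[K] L'.submoduleOf H' :=
    submoduleOfEquivOfLe hL ≪≫ₗ LinearEquiv.ofFinrankEq L L' hLd ≪≫ₗ
      (submoduleOfEquivOfLe hL').symm
  obtain ⟨f, hf⟩ := exists_linearEquiv_extending hHd e
  obtain ⟨g, hg⟩ := exists_linearEquiv_extending rfl f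
  have key {A B : Submodule K V} (hd : finrank K A = finrank K B) (h : ∀ x ∈ A, g x ∈ B) :
      A.map g.toLinearMap = B :=
    Submodule.eq_of_le_of_finrank_eq (Submodule.map_le_iff_le_comap.2 h)
      ((LinearEquiv.finrank_map_eq g A).trans hd)
  refine ⟨g, key hLd fun x hx => ?_, key hHd fun x hx => ?_⟩
  · have h1 := hg ⟨x, hL hx⟩
    have h2 := hf ⟨⟨x, hL hx⟩, hx⟩
    simp only at h1 h2
    rw [h1, h2]
    exact (e _).2
  · rw [show g x = _ from hg ⟨x, hx⟩]
    exact (f _).2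

end General

section Rank

variable [Field K] [AddCommGroup V] [Module K V] {r : Submodule K V → ℕ}

namespace IsQMatroid

theorem rank_sup_loopSpace (hr : IsQMatroid r) {L : Submodule K V} (hL : r L = 0)
    (X : Submodule K V) : r (X ⊔ L) = r X := by
  have h1 := hr.2.2 X L
  have h2 := hr.2.1 X (X ⊔ L) le_sup_left
  omega

theorem rank_sup_le_one (hr : IsQMatroid r) {X Y : Submodule K V} (hX : r X ≤ 1) (hY : r Y ≤ 1)
    (h : r (X ⊓ Y) ≠ 0) : r (X ⊔ Y) ≤ 1 := by
  have := hr.2.2 X Y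
  omega

variable [FiniteDimensional K V]

theorem rank_le_add_finrank_sub (hr : IsQMatroid r) {X Y : Submodule K V} (h : X ≤ Y) :
    r Y + finrank K X ≤ r X + finrank K Y := by
  obtain ⟨C, hC⟩ := exists_isCompl (⟨X, h⟩ : Set.Iic Y)
  have h1 : X ⊔ C = Y := congrArg Subtype.val hC.sup_eq_top
  have h2 : X ⊓ C = ⊥ := congrArg Subtype.val hC.inf_eq_bot
  have h3 := hr.2.2 X C
  have h4 := Submodule.finrank_sup_add_finrank_inf_eq X (C : Submodule K V)
  have h5 := hr.1 C
  rw [h1, h2, finrank_bot] at h4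
  rw [h1] at h3
  omega

/-- Every q-matroid has a largest subspace of rank zero. -/
theorem exists_loopSpace (hr : IsQMatroid r) :
    ∃ L : Submodule K V, ∀ X, r X = 0 ↔ X ≤ L := by
  have hb : r ⊥ = 0 := by simpa using hr.1 ⊥
  obtain ⟨L, hL, hmax⟩ := WellFounded.has_min (wellFounded_gt (α := Submodule K V))
    {X | r X = 0} ⟨⊥, hb⟩
  refine ⟨L, fun X => ⟨fun hX => ?_, fun hX => Nat.le_zero.1 (hL ▸ hr.2.1 X L hX)⟩⟩
  by_contra hXL
  have h := hr.2.2 X L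
  have hX0 : r (X ⊔ L) = 0 := by
    have hL0 : r L = 0 := hL
    omega
  exact hmax (X ⊔ L) hX0 (right_lt_sup.2 hXL)

variable {L : Submodule K V}

theorem eq_flagRank (hr : IsQMatroid r) (htop : r ⊤ = 2) (hV : finrank K V = 4)
    (hL : ∀ X, r X = 0 ↔ X ≤ L) {H : Submodule K V} (hH : finrank K H = 3) (hrH : r H ≤ 1) :
    L ≤ H ∧ r = flagRank L H := by
  have hL0 : r L = 0 := (hL L).2 le_rfl
  have htop' {X : Submodule K V} (hX : H ≤ X) (hX1 : r X ≤ 1) : X = H := by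
    refine (Submodule.eq_of_le_of_finrank_le hX ?_).symm
    by_contra hlt
    have : X = ⊤ := Submodule.eq_top_of_finrank_eq (by have := X.finrank_le; omega)
    rw [this] at hX1
    omega
  have hLH : L ≤ H := by
    rw [← htop' (le_sup_left : H ≤ H ⊔ L) (by rwa [hr.rank_sup_loopSpace hL0])]
    exact le_sup_right
  refine ⟨hLH, funext fun X => ?_⟩
  have h2 : r X ≤ 2 := htop ▸ hr.2.1 X ⊤ le_top
  have hs := hr.rank_sup_loopSpace hL0 X
  unfold flagRank
  split_ifs with h0 h1
  · exact (hL X).2 h0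
  · have hX0 := mt (hL X).1 h0
    rcases h1 with h1 | h1
    · have := hr.2.1 X H h1
      omega
    · have := hr.rank_le_add_finrank_sub (le_sup_right : L ≤ X ⊔ L)
      omega
  · push Not at h1
    by_contra hne
    have hX1 : r (X ⊔ L) ≤ 1 := by omega
    have hinf : r ((X ⊔ L) ⊓ H) ≠ 0 := fun h => by
      have h3 := Submodule.finrank_mono ((hL _).1 h)
      have h4 := Submodule.finrank_sup_add_finrank_inf_eq (X ⊔ L) H
      have h5 := ((X ⊔ L) ⊔ H).finrank_le
      omega
    have h6 := htop' le_sup_right (hr.rank_sup_le_one hX1 hrH hinf)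
    exact h1.1 (le_sup_left.trans (le_sup_left.trans h6.le))

theorem rank_eq_two_of_three_le_finrank (hr : IsQMatroid r) (htop : r ⊤ = 2)
    (hV : finrank K V = 4) (hH : ∀ H : Submodule K V, finrank K H = 3 → 2 ≤ r H)
    {X : Submodule K V} (hX : 3 ≤ finrank K X) : r X = 2 := by
  refine le_antisymm (htop ▸ hr.2.1 X ⊤ le_top) ?_
  rcases hX.eq_or_lt with h | h
  · exact hH X h.symm
  · have : X = ⊤ := Submodule.eq_top_of_finrank_eq (by have := X.finrank_le; omega)
    rw [this, htop]

theorem finrank_loopSpace_le_one (hr : IsQMatroid r) (htop : r ⊤ = 2) (hV : finrank K V = 4)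
    (hH : ∀ H : Submodule K V, finrank K H = 3 → 2 ≤ r H) (hL0 : r L = 0) :
    finrank K L ≤ 1 := by
  by_contra! h
  have h3 : ¬ 3 ≤ finrank K L := fun h3 => by
    have := hr.rank_eq_two_of_three_le_finrank htop hV hH h3
    omega
  have hlt : L ≠ ⊤ := by
    rintro rfl
    rw [finrank_top] at h3
    omega
  obtain ⟨x, -, hx⟩ := SetLike.exists_of_lt (lt_top_iff_ne_top.2 hlt)
  have hxL : ¬ K ∙ x ≤ L := fun h => hx (h (mem_span_singleton_self x))
  have h4 := Submodule.finrank_lt_finrank_of_lt (left_lt_sup.2 hxL)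
  have h5 := Submodule.finrank_add_le_finrank_add_finrank L (K ∙ x)
  have h6 : finrank K (K ∙ x) ≤ 1 := by
    simpa using finrank_span_le_card (R := K) ({x} : Set V)
  have h7 := hr.rank_le_add_finrank_sub (le_sup_left : L ≤ L ⊔ K ∙ x)
  have h8 := hH (L ⊔ K ∙ x) (by omega)
  omega

theorem eq_flagRank_self (hr : IsQMatroid r) (htop : r ⊤ = 2) (hV : finrank K V = 4)
    (hL : ∀ X, r X = 0 ↔ X ≤ L) (hL1 : finrank K L = 1)
    (hH : ∀ H : Submodule K V, finrank K H = 3 → 2 ≤ r H) : r = flagRank L L := by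
  have hL0 : r L = 0 := (hL L).2 le_rfl
  funext X
  have hs := hr.rank_sup_loopSpace hL0 X
  unfold flagRank
  split_ifs with h0 h1
  · exact (hL X).2 h0
  · have hX0 := mt (hL X).1 h0
    have := hr.rank_le_add_finrank_sub (le_sup_right : L ≤ X ⊔ L)
    have := h1.resolve_left h0
    omega
  · push Not at h1
    rw [← hs]
    exact hr.rank_eq_two_of_three_le_finrank htop hV hH (by omega)

theorem eq_spreadRank (hr : IsQMatroid r) (htop : r ⊤ = 2) (hV : finrank K V = 4)
    (hL : ∀ X, r X = 0 ↔ X = ⊥) (hH : ∀ H : Submodule K V, finrank K H = 3 → 2 ≤ r H) :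
    ∃ F, IsPartialSpread F ∧ r = spreadRank F := by
  refine ⟨{X | finrank K X = 2 ∧ r X ≤ 1}, ⟨fun X hX => hX.1, fun X hX Y hY hne => ?_⟩,
    funext fun X => ?_⟩
  · by_contra hinf
    have h1 := hr.rank_sup_le_one hX.2 hY.2 (mt (hL _).1 hinf)
    have h2 : ¬ 3 ≤ finrank K ↥(X ⊔ Y) := fun h => by
      have := hr.rank_eq_two_of_three_le_finrank htop hV hH h
      omega
    have hX2 := hX.1
    have hY2 := hY.1
    have h3 := Submodule.eq_of_le_of_finrank_le (le_sup_left : X ≤ X ⊔ Y) (by omega)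
    have h4 := Submodule.eq_of_le_of_finrank_le (le_sup_right : Y ≤ X ⊔ Y) (by omega)
    exact hne (h3.trans h4.symm)
  · have h2 : r X ≤ 2 := htop ▸ hr.2.1 X ⊤ le_top
    unfold spreadRank
    split_ifs with h0 h1
    · exact (hL X).2 h0
    · have hX0 := mt (hL X).1 h0
      rcases h1 with h1 | h1
      · have := hr.1 X
        omega
      · have := h1.2
        omega
    · simp only [Set.mem_ofPred_eq, not_or, not_and, not_le] at h1
      have hX0 : finrank K X ≠ 0 := mt Submodule.finrank_eq_zero.1 h0
      by_cases h : finrank K X = 2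
      · have := h1.2 h
        omega
      · exact hr.rank_eq_two_of_three_le_finrank htop hV hH (by omega)

end IsQMatroid

end Rank

/-- Representatives of the elements of `F₃`. -/
def residues : List ℕ := [0, 1, 2]

/-- A vector of `F₃⁴` with coordinates given by natural numbers. -/
abbrev NatVec := ℕ × ℕ × ℕ × ℕ

/-- A line, given by two spanning vectors. -/
abbrev NatLine := NatVec × NatVec

/-- A matrix, given by its columns. -/
abbrev NatMat := NatVec × NatVec × NatVec × NatVec

namespace NatVec

/-- The vector whose coordinates are the last four base-3 digits of `n`. -/
def ofCode (n : ℕ) : NatVec := (n % 3, n / 3 % 3, n / 9 % 3, n / 27 % 3)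

/-- The linear combination `a • u + b • v`. -/
def comb (a : ℕ) (u : NatVec) (b : ℕ) (v : NatVec) : NatVec :=
  (a * u.1 + b * v.1, a * u.2.1 + b * v.2.1, a * u.2.2.1 + b * v.2.2.1,
    a * u.2.2.2 + b * v.2.2.2)

/-- Coordinatewise congruence modulo 3. -/
def congr (u v : NatVec) : Bool :=
  u.1 % 3 == v.1 % 3 && (u.2.1 % 3 == v.2.1 % 3 &&
    (u.2.2.1 % 3 == v.2.2.1 % 3 && u.2.2.2 % 3 == v.2.2.2 % 3))

end NatVec

namespace NatLine

/-- The line encoded by the base-3 digits of `n`. -/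
def ofCode (n : ℕ) : NatLine := (NatVec.ofCode n, NatVec.ofCode (n / 81))

/-- Membership of a vector in a line. -/
def contains (l : NatLine) (w : NatVec) : Bool :=
  residues.any fun a => residues.any fun b => w.congr (NatVec.comb a l.1 b l.2)

/-- The lines `l` and `m` have a common nonzero vector. -/
def meets (l m : NatLine) : Bool :=
  [(1, 0), (0, 1), (1, 1), (1, 2)].any fun c =>
    !(NatVec.comb c.1 l.1 c.2 l.2).congr (0, 0, 0, 0) &&
      m.contains (NatVec.comb c.1 l.1 c.2 l.2)

end NatLine

namespace NatMat

/-- The matrix encoded by the base-3 digits of `n`. -/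
def ofCode (n : ℕ) : NatMat :=
  (NatVec.ofCode n, NatVec.ofCode (n / 81), NatVec.ofCode (n / 6561),
    NatVec.ofCode (n / 531441))

/-- The product of a matrix and a vector. -/
def mulVec (g : NatMat) (x : NatVec) : NatVec :=
  NatVec.comb 1 (NatVec.comb x.1 g.1 x.2.1 g.2.1) 1
    (NatVec.comb x.2.2.1 g.2.2.1 x.2.2.2 g.2.2.2)

/-- The matrix `h` is a left inverse of `g`. -/
def isLeftInv (h g : NatMat) : Bool :=
  (h.mulVec g.1).congr (1, 0, 0, 0) && (h.mulVec g.2.1).congr (0, 1, 0, 0) &&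
    (h.mulVec g.2.2.1).congr (0, 0, 1, 0) && (h.mulVec g.2.2.2).congr (0, 0, 0, 1)

/-- The matrix `g` maps the line `l` into the line `m`. -/
def sends (g : NatMat) (l m : NatLine) : Bool :=
  m.contains (g.mulVec l.1) && m.contains (g.mulVec l.2)

/-- The matrix `g` maps each line of `S` into a line of `T`, and each line of `T` contains
the image of a line of `S`. -/
def sendsAll (g : NatMat) (S T : List NatLine) : Bool :=
  (S.all fun l => T.any fun m => g.sends l m) && T.all fun m => S.any fun l => g.sends l m

end NatMat

/-- The lines of `F₃⁴` in reduced row echelon form. -/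
def natLines : List NatLine :=
  (residues.flatMap fun a => residues.flatMap fun b =>
    residues.flatMap fun c => residues.map fun d => ((1, 0, a, b), (0, 1, c, d))) ++
  (residues.flatMap fun a => residues.flatMap fun b =>
    residues.map fun c => ((1, a, 0, b), (0, 0, 1, c))) ++
  (residues.flatMap fun a => residues.map fun b => ((1, a, b, 0), (0, 0, 0, 1))) ++
  (residues.flatMap fun a => residues.map fun b => ((0, 1, 0, a), (0, 0, 1, b))) ++
  (residues.map fun a => ((0, 1, a, 0), (0, 0, 0, 1))) ++
  [((0, 0, 1, 0), (0, 0, 0, 1))]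

/-- Representatives of the orbits of partial line spreads, each line being encoded by the
base-3 digits of a number. -/
def spreadCodes : List (List ℕ) :=
  [[], [244], [244, 2196], [244, 2196, 2440], [244, 2196, 2440, 3187], [244, 2196, 2440, 3916],
   [244, 2196, 2440, 4636], [244, 2196, 2440, 3187, 3943], [244, 2196, 2440, 3187, 6130],
   [244, 2196, 2440, 3187, 5383], [244, 2196, 2440, 3916, 3214],
   [244, 2196, 2440, 3187, 3943, 1009], [244, 2196, 2440, 3187, 3943, 1738],
   [244, 2196, 2440, 3187, 3943, 6121], [244, 2196, 2440, 3187, 6130, 5383],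
   [244, 2196, 2440, 3187, 6130, 3961], [244, 2196, 2440, 3187, 3943, 1009, 1765],
   [244, 2196, 2440, 3187, 3943, 1009, 6121], [244, 2196, 2440, 3187, 3943, 1738, 1036],
   [244, 2196, 2440, 3187, 6130, 5383, 1765], [244, 2196, 2440, 3187, 3943, 1009, 1765, 4636],
   [244, 2196, 2440, 3187, 3943, 1009, 1765, 6121],
   [244, 2196, 2440, 3187, 6130, 5383, 1765, 4636],
   [244, 2196, 2440, 3187, 3943, 1009, 1765, 4636, 6121],
   [244, 2196, 2440, 3187, 6130, 5383, 1765, 4636, 1018],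
   [244, 2196, 2440, 3187, 3943, 1009, 1765, 4636, 6121, 5419],
   [244, 2196, 2440, 3187, 6130, 5383, 1765, 4636, 1018, 3961]]

/-- For each representative and each line (in the order of `natLines`) that meets none of its
members: the index of the representative of the enlarged partial spread, followed by a matrix
achieving the equivalence and the inverse of that matrix, both encoded by base-3 digits. -/
def extensionCodes : List (List (ℕ × ℕ × ℕ)) :=
  [[(1, 36354751, 6639979), (1, 36227581, 6642354), (1, 28045688, 27795104),
    (1, 40463153, 31395543), (1, 30459084, 29964288), (1, 36651211, 32992973),
    (1, 36356695, 1799437), (1, 23594818, 16517995), (1, 36242242, 16868082),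
    (1, 36354789, 6469448), (1, 23494689, 12849303), (1, 40553091, 7611117),
    (1, 36211662, 3763689), (1, 23785155, 2699783), (1, 6186312, 3735371), (1, 36356733, 1628906),
    (1, 23594886, 2700503), (1, 40600962, 2171275), (1, 18036864, 706517), (1, 17653815, 621219),
    (1, 6227775, 13295314), (1, 17611209, 575286), (1, 18004869, 575314), (1, 6341580, 2133514),
    (1, 17882397, 581893), (1, 17807310, 555656), (1, 17632350, 568776), (1, 41623236, 32956172),
    (1, 6818382, 3761953), (1, 6843897, 2148197), (1, 21934728, 16483038), (1, 25679034, 4260720),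
    (1, 22764528, 3245957), (1, 41618133, 32424800), (1, 12130605, 2684307),
    (1, 23233257, 555411), (1, 18882927, 16156256), (1, 21119148, 3735692),
    (1, 35460819, 2174434), (1, 41647050, 3200010), (1, 32720850, 32428065),
    (1, 12179448, 1630147), (1, 38017359, 2666815), (1, 34152948, 565415),
    (1, 18888030, 16674573), (1, 31434390, 32102146), (1, 35223165, 3748825),
    (1, 6876702, 2148184), (1, 38101923, 1606092), (1, 22968630, 560908), (1, 7817670, 33165109),
    (1, 6881805, 2686348), (1, 7359930, 739108), (1, 12084678, 2689588), (1, 16567182, 15951587),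
    (1, 15324372, 3240354), (1, 25604676, 2135050), (1, 41565645, 32424810),
    (1, 23085270, 580597), (1, 39145158, 1633400), (1, 21875679, 16482959),
    (1, 11432943, 4286973), (1, 8481258, 3226305), (1, 41839749, 32956198), (1, 34094628, 578532),
    (1, 38899485, 2685264), (1, 32848020, 2138586), (1, 34107021, 567440),
    (1, 22686768, 32811955), (1, 29932785, 3763238), (1, 7752060, 33163068),
    (1, 12560697, 566427), (1, 11915469, 32815198), (1, 39204936, 4303398),
    (1, 35191818, 2174437), (1, 37926963, 3200901), (1, 18160560, 16874641),
    (1, 18741177, 4298824), (1, 6668937, 4300120), (1, 13264218, 3239425),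
    (1, 31505832, 32627280), (1, 27642227, 16495173), (1, 40646861, 31397455),
    (1, 23653138, 18092386), (1, 36145323, 2148453), (1, 23895963, 4272814),
    (1, 27957942, 4294612), (1, 36159921, 1621360), (1, 6020820, 3198988), (1, 5962500, 3730348),
    (1, 9045090, 16148412), (1, 22844232, 32811929), (1, 22614597, 32811930),
    (1, 28175877, 570735), (1, 22808268, 1632172), (1, 18826470, 4301064), (1, 39865428, 2679732),
    (1, 34349778, 566387), (1, 29633157, 4288013), (1, 22861143, 735975), (1, 40132728, 16147265),
    (1, 28470717, 942505), (1, 6918237, 568467), (1, 12305547, 578572), (1, 12929607, 3239397),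
    (1, 7462080, 1641049), (1, 25961157, 4260733), (1, 18273150, 3743492), (1, 648085, 8573148),
    (1, 679437, 2137536), (1, 648090, 3732588), (1, 920574, 13826889), (1, 760356, 4262409),
    (1, 924381, 4261680), (1, 880236, 6388659), (1, 917091, 3732345), (1, 817947, 3199446),
    (1, 16495011, 15950544), (1, 7047189, 731505), (1, 13443966, 17403705),
    (1, 29251161, 1641009), (1, 29447991, 1641981), (1, 32787513, 1606983),
    (1, 18622350, 1627932), (1, 25939287, 2135022), (1, 38183571, 3730332), (1, 873027, 6917751),
    (1, 752337, 3197178), (1, 823050, 2669868), (1, 553320, 1601640)],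
   [(2, 36354751, 6639979), (2, 36223531, 35698648), (2, 36623752, 22222354),
    (2, 36512215, 11481997), (2, 36308824, 40540666), (2, 36380995, 27064372),
    (2, 27851695, 6817126), (2, 28120696, 36394114), (2, 27720475, 21349741),
    (2, 28009159, 11659144), (2, 27877939, 41236132), (2, 27805768, 26191759),
    (2, 22412626, 26637907), (2, 6882739, 41137717), (2, 12197149, 26441077),
    (2, 19105882, 18567877), (2, 30266143, 33264517), (2, 38887297, 39923932),
    (2, 22491358, 19814467), (2, 6685909, 19880077), (2, 18935296, 18390730),
    (2, 11934709, 20063785), (2, 29898727, 33087370), (2, 39235030, 19978492),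
    (2, 22629139, 41341108), (2, 6666226, 34228984), (2, 12026563, 34412692),
    (2, 18843442, 18489145), (2, 39169420, 11580412), (2, 30200533, 33369493),
    (2, 22425748, 26113027), (2, 6600616, 6062611), (2, 29865922, 33021760),
    (2, 38900419, 40993375), (2, 11915026, 6246319), (2, 18705661, 18141412),
    (2, 22760359, 35042548), (2, 6620299, 34760425), (2, 30095557, 33454786),
    (2, 38966029, 34694815), (2, 18738466, 18207022), (2, 12000319, 34944133),
    (2, 22681627, 11941267), (2, 6817129, 26257369), (2, 39130054, 26821615),
    (2, 29931532, 33100492), (2, 12065929, 11560729), (2, 18909052, 18384169),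
    (2, 36315385, 5025973), (2, 36243214, 34084642), (2, 36643435, 20608348),
    (2, 27812329, 5203120), (2, 28140379, 34780108), (2, 27740158, 19735735),
    (2, 30233338, 33271078), (2, 30003703, 33185785), (2, 30069313, 33448225),
    (2, 38972590, 5281852), (2, 39103810, 26277052), (2, 39156298, 12105292),
    (2, 19073077, 18574438), (2, 19040272, 18305437), (2, 18771271, 18220144),
    (2, 11869099, 5183437), (2, 11980636, 19532344), (2, 12131539, 41321425),
    (2, 33986230, 20083468), (2, 33586009, 34616083), (2, 33966547, 21697474),
    (2, 33723790, 26539492), (2, 33651619, 41072107), (2, 33566326, 36230089),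
    (2, 22497919, 5098144), (2, 22694749, 11396704), (2, 22655383, 40271665),
    (2, 6554689, 4999729), (2, 6712153, 19348636), (2, 6751519, 11377021), (2, 33697546, 6633418),
    (2, 33855010, 11475436), (2, 33658180, 5019412)],
   [(3, 33658180, 5019412), (3, 33953425, 19545466), (3, 33540082, 33540079),
    (3, 33835327, 9861430), (3, 33717229, 24387484), (3, 33599131, 38382097),
    (3, 24092242, 5196559), (3, 23974144, 19191172), (3, 24387487, 33717226),
    (3, 24269389, 10038577), (3, 24033193, 24033190), (3, 24151291, 38559244),
    (3, 14762500, 14585350), (3, 29111407, 29111404), (3, 38677345, 19427368),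
    (3, 19545469, 33953422), (3, 5196562, 24092239), (3, 9979531, 38618293),
    (3, 14585353, 14762497), (3, 28757113, 28757110), (3, 19309273, 5078461),
    (3, 38382100, 33599128), (3, 5137513, 9743332), (3, 10038580, 24269386),
    (3, 14408206, 14408203), (3, 28934260, 28934257), (3, 38441149, 5255608),
    (3, 19250224, 19250221), (3, 9920482, 9920479), (3, 5255611, 38441146),
    (3, 14644402, 14644399), (3, 28993309, 29170453), (3, 5078464, 19309270),
    (3, 9861433, 33835324), (3, 38559247, 24151288), (3, 19427371, 38677342),
    (3, 14821549, 14821546), (3, 28816162, 28816159), (3, 4960366, 4960363),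
    (3, 9802384, 19486417), (3, 19486420, 9802381), (3, 38323051, 38323048),
    (3, 14467255, 14467252), (3, 29170456, 28993306), (3, 9743335, 5137510),
    (3, 5019415, 33658177), (3, 38618296, 9979528), (3, 19191175, 23974141)],
   [(4, 14408200, 14408200), (4, 14585187, 14762334), (4, 16271773, 16271773),
    (5, 14408200, 14408200), (4, 26769453, 5773847), (5, 5078300, 19309350),
    (4, 9861350, 33835650), (4, 5137670, 9743492), (4, 4960200, 4960200), (4, 32017924, 32017924),
    (5, 23974300, 19191250), (4, 38382343, 33599374), (5, 29111650, 29111650),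
    (4, 10038903, 24269306), (4, 24033350, 24033350), (4, 5773847, 26769453),
    (6, 14408200, 14408200), (5, 33953750, 19545550), (5, 9802300, 19486500),
    (5, 38677750, 19427450), (4, 19309267, 5078458), (4, 11022564, 11022564),
    (4, 29111650, 29111650), (5, 19250300, 19250300), (4, 33835650, 9861350),
    (4, 28757030, 28757436), (4, 37266887, 37266887)],
   [(7, 14408200, 14408200), (8, 14408200, 14408200), (7, 19545550, 33953750),
    (9, 14408200, 14408200), (7, 4294611, 3747852), (7, 2710467, 2150586),
    (8, 11088334, 41820058), (8, 9743492, 5137670), (7, 3207654, 1113201), (7, 566442, 1603827),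
    (9, 19309267, 5078458), (7, 9802300, 19486500), (7, 33835650, 9861350), (8, 4294164, 5643981)],
   [(7, 41547186, 2143826), (10, 14408200, 14408200), (7, 4287987, 2136006),
    (7, 13726386, 2149577), (7, 28264122, 2162501), (7, 38323292, 38323295),
    (7, 3220785, 2162979), (7, 28427427, 2172581), (10, 9861350, 33835650),
    (7, 13545558, 2133665), (7, 41893479, 2169710), (7, 9979852, 38618459), (7, 3741264, 2165895),
    (10, 33835650, 9861350), (7, 24151692, 38559086)],
   [(8, 9743492, 5137670), (8, 14585187, 14762334), (8, 12715791, 26965877),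
    (8, 40009471, 37332583), (8, 29170290, 28993143), (8, 5137670, 9743492),
    (8, 14467172, 14467578), (8, 8864318, 10826057), (8, 38382343, 33599374),
    (8, 10038903, 24269306), (8, 38618290, 9979525), (8, 15687435, 16402584),
    (8, 19309267, 5078458), (8, 29334398, 31952643), (8, 5019738, 33658097),
    (8, 19191418, 23974387), (8, 28757030, 28757436), (8, 22511035, 5642704)],
   [(11, 14408200, 14408200), (12, 14408200, 14408200), (12, 28757350, 28757350),
    (11, 33953750, 19545550), (11, 15727043, 15727043), (13, 14408200, 14408200),
    (13, 19309350, 5078300)],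
   [(14, 14408200, 14408200), (11, 41236458, 26834657), (11, 9540025, 42712685),
    (14, 1115183, 15522651), (14, 22517165, 10545967), (11, 25699924, 5774167),
    (11, 29340958, 31952400), (14, 15392513, 15392513), (15, 14408200, 14408200)],
   [(14, 14408200, 14408200), (14, 11088334, 41820058), (14, 2672380, 5711733),
    (14, 32017924, 32017924), (14, 41892392, 19998335)],
   [(13, 4287987, 2136006), (13, 13726386, 2149577), (13, 4301118, 2673288),
    (13, 7881264, 3765983), (13, 28539675, 1114174), (13, 35976933, 1092547),
    (13, 41893479, 2169710), (13, 9979852, 38618459), (13, 21166551, 3742187),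
    (13, 9861758, 33835408)],
   [(16, 14408200, 14408200), (16, 15392513, 15392513), (17, 14408200, 14408200),
    (17, 33717550, 24387650)],
   [(18, 14408200, 14408200), (18, 4294611, 3747852)],
   [(17, 14408200, 14408200), (18, 4294611, 3747852), (17, 9802300, 19486500),
    (17, 25620872, 22406388), (17, 38441550, 5255450)],
   [(19, 14408200, 14408200), (19, 41820058, 11088334), (19, 4303350, 2161530),
    (19, 41892392, 19998335)],
   [(19, 41892392, 19998335), (16, 7696300, 36341629), (16, 35770983, 40547150),
    (19, 21586097, 42404150), (19, 20910151, 6187267), (16, 21093941, 10379828),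
    (16, 30200450, 30719175), (19, 42909184, 13181293)],
   [(20, 14408200, 14408200), (21, 14408200, 14408200), (21, 4960200, 4960200)],
   [(21, 14408200, 14408200), (21, 35698652, 35698652), (21, 29111650, 29111650)],
   [],
   [(22, 14408200, 14408200), (22, 11088334, 41820058), (22, 14821706, 14821706)],
   [(23, 14408200, 14408200), (23, 4960200, 4960200)],
   [(23, 14408200, 14408200), (23, 14027662, 8910082)],
   [(24, 14408200, 14408200), (24, 5137670, 9743492)],
   [(25, 14408200, 14408200)],
   [(26, 14408200, 14408200)],
   [],
   []]

/-- Representatives of the orbits of partial line spreads. -/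
def natSpreads : List (List NatLine) := spreadCodes.map fun S => S.map NatLine.ofCode

/-- Every line of `ls` that meets no member of `S` extends `S` to a partial spread which a
matrix from `C` sends to a member of `natSpreads`. -/
def checkExtensions (S : List NatLine) : List NatLine → List (ℕ × ℕ × ℕ) → Bool
  | [], _ => true
  | l :: ls, C =>
    bif S.any l.meets then checkExtensions S ls C
    else match C with
      | [] => false
      | c :: C =>
        (match natSpreads[c.1]? with
          | none => false
          | some T =>
            (NatMat.ofCode c.2.2).isLeftInv (NatMat.ofCode c.2.1) &&
              (NatMat.ofCode c.2.1).sendsAll (l :: S) T) &&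
        checkExtensions S ls C

theorem checkExtensions_eq_true :
    ((List.range 27).all fun i => checkExtensions (natSpreads.getD i []) natLines
      (extensionCodes.getD i [])) = true := by
  decide +kernel

theorem length_natSpreads : natSpreads.length = 27 := rfl

theorem exists_extensionCodes {S : List NatLine} (hS : S ∈ natSpreads) :
    ∃ C, checkExtensions S natLines C = true := by
  obtain ⟨i, hi, rfl⟩ := List.mem_iff_getElem.1 hS
  have h := List.all_eq_true.1 checkExtensions_eq_true i
    (List.mem_range.2 (length_natSpreads ▸ hi))
  rw [List.getD_eq_getElem _ _ hi] at h
  exact ⟨_, h⟩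

section Echelon

variable [Field K]

/-- Two-dimensional subspaces of a coordinate space have bases in echelon form. -/
theorem exists_echelon_pair {n : ℕ} {W : Submodule K (Fin n → K)} (hW : finrank K W = 2) :
    ∃ p q : Fin n, ∃ u ∈ W, ∃ v ∈ W, p < q ∧ u p = 1 ∧ u q = 0 ∧ v q = 1 ∧
      (∀ i < p, u i = 0) ∧ ∀ i < q, v i = 0 := by
  have hne : W ≠ ⊥ := by
    rintro rfl
    simp at hW
  obtain ⟨x, hxW, hx⟩ := W.ne_bot_iff.1 hne
  obtain ⟨i, hi⟩ := Function.ne_iff.1 hx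
  obtain ⟨p, ⟨y, hyW, hy⟩, hp⟩ := WellFounded.has_min (wellFounded_lt (α := Fin n))
    {p | ∃ x ∈ W, x p ≠ 0} ⟨i, x, hxW, hi⟩
  have hp (i : Fin n) (hi : i < p) (x : Fin n → K) (hx : x ∈ W) : x i = 0 := by
    by_contra h
    exact hp i ⟨x, hx, h⟩ hi
  obtain ⟨w, hwW, hw⟩ : ∃ w ∈ W, w ∉ K ∙ y := by
    by_contra! h
    have h1 := Submodule.finrank_mono (show W ≤ K ∙ y from h)
    have h2 : finrank K (K ∙ y) ≤ 1 := by
      simpa using finrank_span_le_card (R := K) ({y} : Set (Fin n → K))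
    omega
  have hzW : w - (w p / y p) • y ∈ W := W.sub_mem hwW (W.smul_mem _ hyW)
  have hz : w - (w p / y p) • y ≠ 0 := fun h => hw <| by
    rw [sub_eq_zero.1 h]
    exact (K ∙ y).smul_mem _ (mem_span_singleton_self y)
  have hzp : (w - (w p / y p) • y) p = 0 := by
    simp [div_mul_cancel₀ _ hy]
  generalize w - (w p / y p) • y = z at hzW hz hzp
  obtain ⟨j, hj⟩ := Function.ne_iff.1 hz
  obtain ⟨q, hzq, hq⟩ := WellFounded.has_min (wellFounded_lt (α := Fin n))
    {q | z q ≠ 0} ⟨j, hj⟩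
  have hq (i : Fin n) (hi : i < q) : z i = 0 := by
    by_contra h
    exact hq i h hi
  have hzq : z q ≠ 0 := hzq
  have hpq : p < q := by
    by_contra! h
    rcases h.lt_or_eq with h | h
    · exact hzq (hp q h z hzW)
    · exact hzq (h ▸ hzp)
  have huW : (y p)⁻¹ • (y - (y q / z q) • z) ∈ W :=
    W.smul_mem _ (W.sub_mem hyW (W.smul_mem _ hzW))
  refine ⟨p, q, _, huW, (z q)⁻¹ • z, W.smul_mem _ hzW, hpq, ?_, ?_, ?_, fun i hi => ?_,
    fun i hi => ?_⟩
  · simp [hzp, hy]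
  · simp [div_mul_cancel₀ _ hzq]
  · simp [hzq]
  · exact hp i hi _ huW
  · simp [hq i hi]

theorem span_pair_eq_of_echelon {n : ℕ} {W : Submodule K (Fin n → K)} (hW : finrank K W = 2)
    {p q : Fin n} {u v : Fin n → K} (hu : u ∈ W) (hv : v ∈ W) (hup : u p = 1) (huq : u q = 0)
    (hvp : v p = 0) (hvq : v q = 1) : span K {u, v} = W := by
  have hli : LinearIndependent K ![u, v] := by
    refine LinearIndependent.pair_iff.2 fun s t h => ?_
    have h1 := congrFun h p
    have h2 := congrFun h q
    simp [hup, hvp] at h1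
    simp [huq, hvq] at h2
    exact ⟨h1, h2⟩
  have h := finrank_span_eq_card hli
  rw [Matrix.range_cons_cons_empty] at h
  refine Submodule.eq_of_le_of_finrank_eq (span_le.2 ?_) ?_
  · rintro x (rfl | rfl)
    exacts [hu, hv]
  · rw [h, hW]
    simp

end Echelon

namespace NatVec

/-- The vector over `F₃` with the given coordinates. -/
def toVec (w : NatVec) : Fin 4 → ZMod 3 := ![w.1, w.2.1, w.2.2.1, w.2.2.2]

/-- The coordinates of a vector over `F₃` as natural numbers. -/
def ofVec (x : Fin 4 → ZMod 3) : NatVec := ((x 0).val, (x 1).val, (x 2).val, (x 3).val)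

theorem toVec_ofVec (x : Fin 4 → ZMod 3) : (ofVec x).toVec = x := by
  ext i
  fin_cases i <;> simp [toVec, ofVec]

theorem toVec_comb (a b : ℕ) (u v : NatVec) :
    (comb a u b v).toVec = (a : ZMod 3) • u.toVec + (b : ZMod 3) • v.toVec := by
  ext i
  fin_cases i <;> simp [toVec, comb]

theorem congr_iff (u v : NatVec) : u.congr v = true ↔ u.toVec = v.toVec := by
  simp only [congr, Bool.and_eq_true, beq_iff_eq, toVec, Matrix.vecCons_inj, and_true,
    ZMod.natCast_eq_natCast_iff']

end NatVec

namespace NatLine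

/-- The subspace of `F₃⁴` spanned by the two vectors. -/
def toSubmodule (l : NatLine) : Submodule (ZMod 3) (Fin 4 → ZMod 3) :=
  span (ZMod 3) {l.1.toVec, l.2.toVec}

theorem comb_mem (l : NatLine) (a b : ℕ) : (NatVec.comb a l.1 b l.2).toVec ∈ l.toSubmodule :=
  mem_span_pair.2 ⟨a, b, (NatVec.toVec_comb a b l.1 l.2).symm⟩

theorem finrank_toSubmodule_le (l : NatLine) : finrank (ZMod 3) l.toSubmodule ≤ 2 := by
  classical
  refine (finrank_span_le_card (R := ZMod 3) {l.1.toVec, l.2.toVec}).trans ?_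
  simpa using Finset.card_le_two (a := l.1.toVec) (b := l.2.toVec)

theorem mem_of_contains {l : NatLine} {w : NatVec} (h : l.contains w = true) :
    w.toVec ∈ l.toSubmodule := by
  simp only [contains, List.any_eq_true, NatVec.congr_iff] at h
  obtain ⟨a, -, b, -, h⟩ := h
  exact h ▸ l.comb_mem a b

theorem inf_ne_bot_of_meets {l m : NatLine} (h : l.meets m = true) :
    l.toSubmodule ⊓ m.toSubmodule ≠ ⊥ := by
  simp only [meets, List.any_eq_true, Bool.and_eq_true, Bool.not_eq_true', Bool.eq_false_iff,
    ne_eq, NatVec.congr_iff] at h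
  obtain ⟨c, -, hc0, hc⟩ := h
  refine (Submodule.ne_bot_iff _).2 ⟨_, ⟨l.comb_mem c.1 c.2, mem_of_contains hc⟩, fun h => hc0 ?_⟩
  rw [h]
  ext i
  fin_cases i <;> simp [NatVec.toVec]

end NatLine

namespace NatMat

/-- The linear map over `F₃` with the given matrix. -/
def toLin (g : NatMat) : (Fin 4 → ZMod 3) →ₗ[ZMod 3] (Fin 4 → ZMod 3) :=
  Fintype.linearCombination (ZMod 3)
    ![g.1.toVec, g.2.1.toVec, g.2.2.1.toVec, g.2.2.2.toVec]

theorem toLin_toVec (g : NatMat) (x : NatVec) : g.toLin x.toVec = (g.mulVec x).toVec := by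
  rw [mulVec, NatVec.toVec_comb, NatVec.toVec_comb, NatVec.toVec_comb]
  simp [toLin, Fintype.linearCombination_apply, Fin.sum_univ_four, NatVec.toVec, add_assoc]

theorem toLin_leftInverse {g h : NatMat} (H : h.isLeftInv g = true) :
    h.toLin ∘ₗ g.toLin = LinearMap.id := by
  simp only [isLeftInv, Bool.and_eq_true, NatVec.congr_iff] at H
  obtain ⟨⟨⟨h0, h1⟩, h2⟩, h3⟩ := H
  refine (Pi.basisFun (ZMod 3) (Fin 4)).ext fun i => ?_
  have hg : g.toLin (Pi.single i 1) =
      ![g.1.toVec, g.2.1.toVec, g.2.2.1.toVec, g.2.2.2.toVec] i := by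
    simp [toLin, Fintype.linearCombination_apply_single]
  rw [Pi.basisFun_apply, LinearMap.comp_apply, hg, LinearMap.id_apply]
  ext j
  fin_cases i <;>
    simp only [Fin.zero_eta, Fin.mk_one, Fin.reduceFinMk, Matrix.cons_val, toLin_toVec,
      h0, h1, h2, h3] <;>
    fin_cases j <;> simp [NatVec.toVec]

theorem map_le_of_sends {g : NatMat} {l m : NatLine} (h : g.sends l m = true) :
    l.toSubmodule.map g.toLin ≤ m.toSubmodule := by
  simp only [sends, Bool.and_eq_true] at h
  rw [NatLine.toSubmodule, Submodule.map_span_le]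
  rintro x (rfl | rfl)
  · rw [toLin_toVec]
    exact NatLine.mem_of_contains h.1
  · rw [toLin_toVec]
    exact NatLine.mem_of_contains h.2

end NatMat

theorem exists_natLine {W : Submodule (ZMod 3) (Fin 4 → ZMod 3)} (hW : finrank (ZMod 3) W = 2) :
    ∃ l ∈ natLines, l.toSubmodule = W := by
  obtain ⟨p, q, u, hu, v, hv, hpq, hup, huq, hvq, hui, hvi⟩ := exists_echelon_pair hW
  refine ⟨(NatVec.ofVec u, NatVec.ofVec v), ?_, ?_⟩
  · have hval (x : ZMod 3) : x.val ∈ residues := by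
      have := ZMod.val_lt x
      simp only [residues, List.mem_cons, List.not_mem_nil, or_false]
      omega
    have h0 : 0 ∈ residues := by simp [residues]
    have h1 : (1 : ZMod 3).val = 1 := rfl
    fin_cases p <;> fin_cases q <;> simp [Fin.forall_fin_succ] at * <;>
      simp [natLines, NatVec.ofVec, *]
  · rw [NatLine.toSubmodule, NatVec.toVec_ofVec, NatVec.toVec_ofVec]
    exact span_pair_eq_of_echelon hW hu hv hup huq (hvi p hpq) hvq

theorem exists_extension {S : List NatLine} {ls : List NatLine} {C : List (ℕ × ℕ × ℕ)}
    (h : checkExtensions S ls C = true) {l : NatLine} (hl : l ∈ ls)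
    (hS : ∀ m ∈ S, l.toSubmodule ⊓ m.toSubmodule = ⊥) :
    ∃ T ∈ natSpreads, ∃ g h : NatMat, h.isLeftInv g = true ∧ g.sendsAll (l :: S) T = true := by
  induction ls generalizing C with
  | nil => simp at hl
  | cons l' ls ih =>
    rw [checkExtensions.eq_def] at h
    simp only at h
    cases hany : S.any l'.meets with
    | true =>
      rw [hany, cond_true] at h
      rcases List.mem_cons.1 hl with rfl | hl
      · obtain ⟨m, hm, hlm⟩ := List.any_eq_true.1 hany
        exact absurd (hS m hm) (NatLine.inf_ne_bot_of_meets hlm)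
      · exact ih h hl
    | false =>
      rw [hany, cond_false] at h
      cases C with
      | nil => simp at h
      | cons c C =>
        simp only [Bool.and_eq_true] at h
        obtain ⟨h1, h2⟩ := h
        rcases List.mem_cons.1 hl with rfl | hl
        · cases hT : natSpreads[c.1]? with
          | none => simp [hT] at h1
          | some T =>
            simp only [hT, Bool.and_eq_true] at h1
            exact ⟨T, List.mem_of_getElem? hT, _, _, h1.1, h1.2⟩
        · exact ih h2 hl

/-- Every partial line spread of `F₃⁴` is equivalent to one of the representatives. -/
theorem exists_map_eq_natSpread {F : Set (Submodule (ZMod 3) (Fin 4 → ZMod 3))}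
    (hF : IsPartialSpread F) : ∃ S ∈ natSpreads,
      ∃ g : (Fin 4 → ZMod 3) ≃ₗ[ZMod 3] (Fin 4 → ZMod 3),
        Submodule.map g.toLinearMap '' F = NatLine.toSubmodule '' {l | l ∈ S} := by
  induction F, F.toFinite using Set.Finite.induction_on with
  | empty => exact ⟨[], by simp [natSpreads, spreadCodes], LinearEquiv.refl _ _, by simp⟩
  | @insert X F hXF _ ih =>
    obtain ⟨S, hS, g, hg⟩ := ih ⟨fun Y hY => hF.1 Y (.inr hY),
      fun Y hY Z hZ => hF.2 Y (.inr hY) Z (.inr hZ)⟩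
    obtain ⟨l, hl, hlX⟩ := exists_natLine
      ((LinearEquiv.finrank_map_eq g X).trans (hF.1 X (.inl rfl)))
    have hrank : ∀ m ∈ l :: S, finrank (ZMod 3) m.toSubmodule = 2 := by
      intro m hm
      rcases List.mem_cons.1 hm with rfl | hm
      · rw [hlX]
        exact (LinearEquiv.finrank_map_eq g X).trans (hF.1 X (.inl rfl))
      · obtain ⟨Y, hY, hYm⟩ := hg.ge ⟨m, hm, rfl⟩
        rw [← hYm]
        exact (LinearEquiv.finrank_map_eq g Y).trans (hF.1 Y (.inr hY))
    have hdisj : ∀ m ∈ S, l.toSubmodule ⊓ m.toSubmodule = ⊥ := by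
      intro m hm
      obtain ⟨Y, hY, hYm⟩ := hg.ge ⟨m, hm, rfl⟩
      rw [hlX, ← hYm, ← Submodule.map_inf _ g.injective,
        hF.2 X (.inl rfl) Y (.inr hY) (by rintro rfl; exact hXF hY), Submodule.map_bot]
    obtain ⟨C, hC⟩ := exists_extensionCodes hS
    obtain ⟨T, hT, a, b, hab, hall⟩ := exists_extension hC hl hdisj
    let f : (Fin 4 → ZMod 3) ≃ₗ[ZMod 3] (Fin 4 → ZMod 3) :=
      LinearEquiv.ofInjectiveEndo a.toLin
        (LinearMap.injective_of_comp_eq_id _ _ (NatMat.toLin_leftInverse hab))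
    have hmap {m n : NatLine} (hm : m ∈ l :: S) (h : a.sends m n = true) :
        m.toSubmodule.map f.toLinearMap = n.toSubmodule :=
      Submodule.eq_of_le_of_finrank_le (NatMat.map_le_of_sends h) <| by
        rw [LinearEquiv.finrank_map_eq f, hrank m hm]
        exact n.finrank_toSubmodule_le
    refine ⟨T, hT, g ≪≫ₗ f, ?_⟩
    have hinsert : Submodule.map g.toLinearMap '' insert X F =
        NatLine.toSubmodule '' {m | m ∈ l :: S} := by
      have : {m | m ∈ l :: S} = insert l {m | m ∈ S} := by
        ext
        simp
      rw [this, Set.image_insert_eq, Set.image_insert_eq, hlX, hg]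
    have himage : Submodule.map (g ≪≫ₗ f).toLinearMap '' insert X F =
        Submodule.map f.toLinearMap '' (Submodule.map g.toLinearMap '' insert X F) := by
      rw [Set.image_image]
      exact Set.image_congr fun Y _ => Submodule.map_comp _ _ Y
    rw [himage, hinsert, Set.image_image]
    simp only [NatMat.sendsAll, Bool.and_eq_true, List.all_eq_true, List.any_eq_true] at hall
    ext Y
    constructor
    · rintro ⟨m, hm, rfl⟩
      obtain ⟨n, hn, hmn⟩ := hall.1 m hm
      exact ⟨n, hn, (hmap hm hmn).symm⟩
    · rintro ⟨n, hn, rfl⟩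
      obtain ⟨m, hm, hmn⟩ := hall.2 n hn
      exact ⟨m, hm, hmap hm hmn⟩

theorem card_quot_le_of_classification {α ι : Type*} [Finite ι] {R : α → α → Prop}
    (P : ι → α → Prop) (hex : ∀ a, ∃ i, P i a) (hrel : ∀ i a b, P i a → P i b → R a b) :
    Nat.card (Quot R) ≤ Nat.card ι := by
  choose c hc using hex
  refine Nat.card_le_card_of_injective (fun x : Quot R => c x.out) fun x y h => ?_
  rw [← x.out_eq, ← y.out_eq]
  exact Quot.sound (hrel (c x.out) _ _ (hc _) (by rw [show c x.out = c y.out from h]; exact hc _))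

/-- The dimensions of the two subspaces in a rank function of the form `flagRank L H` that
occur for q-matroids of rank two in dimension four. -/
def flagDims : Fin 4 → ℕ × ℕ := ![(0, 3), (1, 3), (2, 3), (1, 1)]

/-- The classification of q-matroids of rank two on `F₃⁴`: there are four families given by
flags, and one family for each representative of the partial line spreads. -/
def HasClass (r : Submodule (ZMod 3) (Fin 4 → ZMod 3) → ℕ) :
    Fin 4 ⊕ Fin natSpreads.length → Prop
  | .inl k => ∃ L H : Submodule (ZMod 3) (Fin 4 → ZMod 3), L ≤ H ∧
      finrank (ZMod 3) L = (flagDims k).1 ∧ finrank (ZMod 3) H = (flagDims k).2 ∧ r = flagRank L H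
  | .inr k => ∃ F, r = spreadRank F ∧ ∃ g : (Fin 4 → ZMod 3) ≃ₗ[ZMod 3] (Fin 4 → ZMod 3),
      Submodule.map g.toLinearMap '' F = NatLine.toSubmodule '' {l | l ∈ natSpreads.get k}

theorem IsQMatroid.exists_hasClass {r : Submodule (ZMod 3) (Fin 4 → ZMod 3) → ℕ}
    (hr : IsQMatroid r) (htop : r ⊤ = 2) : ∃ i, HasClass r i := by
  have hV : finrank (ZMod 3) (Fin 4 → ZMod 3) = 4 := by simp
  obtain ⟨L, hL⟩ := hr.exists_loopSpace
  have hL0 : r L = 0 := (hL L).2 le_rfl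
  by_cases hH : ∀ H : Submodule (ZMod 3) (Fin 4 → ZMod 3), finrank (ZMod 3) H = 3 → 2 ≤ r H
  · rcases (hr.finrank_loopSpace_le_one htop hV hH hL0).lt_or_eq with hL1 | hL1
    · obtain rfl := Submodule.finrank_eq_zero.1 (Nat.lt_one_iff.1 hL1)
      obtain ⟨F, hF, hrF⟩ := hr.eq_spreadRank htop hV (fun X => (hL X).trans le_bot_iff) hH
      obtain ⟨S, hS, g, hg⟩ := exists_map_eq_natSpread hF
      obtain ⟨k, rfl⟩ := List.mem_iff_get.1 hS
      exact ⟨.inr k, F, hrF, g, hg⟩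
    · exact ⟨.inl 3, L, L, le_rfl, hL1, hL1, hr.eq_flagRank_self htop hV hL hL1 hH⟩
  · push Not at hH
    obtain ⟨H, hH3, hrH⟩ := hH
    obtain ⟨hLH, hrLH⟩ := hr.eq_flagRank htop hV hL hH3 (Nat.lt_succ_iff.1 hrH)
    have hle : finrank (ZMod 3) L ≤ 2 := by
      have := hr.rank_le_add_finrank_sub (le_top : L ≤ ⊤)
      rw [htop, hL0, finrank_top] at this
      omega
    obtain h | h | h : finrank (ZMod 3) L = 0 ∨ finrank (ZMod 3) L = 1 ∨
      finrank (ZMod 3) L = 2 := by omega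
    · exact ⟨.inl 0, L, H, hLH, h, hH3, hrLH⟩
    · exact ⟨.inl 1, L, H, hLH, h, hH3, hrLH⟩
    · exact ⟨.inl 2, L, H, hLH, h, hH3, hrLH⟩

theorem HasClass.exists_linearEquiv {r₁ r₂ : Submodule (ZMod 3) (Fin 4 → ZMod 3) → ℕ}
    {i : Fin 4 ⊕ Fin natSpreads.length} (h₁ : HasClass r₁ i) (h₂ : HasClass r₂ i) :
    ∃ g : (Fin 4 → ZMod 3) ≃ₗ[ZMod 3] (Fin 4 → ZMod 3),
      ∀ X, r₁ X = r₂ (X.map g.toLinearMap) := by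
  rcases i with k | k
  · obtain ⟨L, H, hLH, hL, hH, rfl⟩ := h₁
    obtain ⟨L', H', hLH', hL', hH', rfl⟩ := h₂
    obtain ⟨g, rfl, rfl⟩ :=
      exists_linearEquiv_map_flag hLH hLH' (hL.trans hL'.symm) (hH.trans hH'.symm)
    exact ⟨g, fun X => (flagRank_map g L H X).symm⟩
  · obtain ⟨F, rfl, g, hg⟩ := h₁
    obtain ⟨F', rfl, g', hg'⟩ := h₂
    refine ⟨g ≪≫ₗ g'.symm, fun X => ?_⟩
    rw [← spreadRank_map g F, ← spreadRank_map g' F', hg, hg', ← Submodule.map_comp]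
    congr 2
    ext x
    simp

/-- there are at most 31 isomorphism classes of q-matroids of
rank 2 on a 4-dimensional vector space over F₃. -/
theorem stmt16 :
    Nat.card (Quot (fun r₁ r₂ :
        {r : Submodule (ZMod 3) (Fin 4 → ZMod 3) → ℕ // IsQMatroid r ∧ r ⊤ = 2} =>
      ∃ g : (Fin 4 → ZMod 3) ≃ₗ[ZMod 3] (Fin 4 → ZMod 3),
        ∀ X : Submodule (ZMod 3) (Fin 4 → ZMod 3),
          r₁.1 X = r₂.1 (Submodule.map g.toLinearMap X))) ≤ 31 := by
  refine (card_quot_le_of_classification (fun i r => HasClass r.1 i)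
    (fun r => r.2.1.exists_hasClass r.2.2) fun i r₁ r₂ h₁ h₂ => h₁.exists_linearEquiv h₂).trans ?_
  simp [length_natSpreads]
end
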